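/- arXiv:0711.4336 — 6 statements merged into one kernel-verified Lean document; each statement's English description precedes it below -/
import Mathlib

section
/- Let n ≥ 1 and let X, Z be n×n complex matrices such that [X,Z] + Iₙ has rank 1, and suppose X has only real eigenvalues and Z has only real eigenvalues. Then for every m ≥ 1, the determinant of the n×n matrix X + Σ_{j=1}^m j·T_j·(−Z)^{j−1}, computed in the polynomial ring ℂ[T₁,…,T_m] (viewing the entries of X and of the powers of −Z as constants), is a polynomial in T₁,…,T_m all of whose coefficients are real. -/
section CalogeroMoserReality

open Finset

section PartialFractions

variable {ι K : Type*} [DecidableEq ι] [Field K]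

theorem inv_sub_mul_inv_sub {x y z : K} (hxy : x ≠ y) (hxz : x ≠ z) (hyz : y ≠ z) :
    (x - y)⁻¹ * (y - z)⁻¹ = (x - z)⁻¹ * ((x - y)⁻¹ + (y - z)⁻¹) := by
  have h1 := sub_ne_zero.2 hxy
  have h2 := sub_ne_zero.2 hxz
  have h3 := sub_ne_zero.2 hyz
  field_simp
  ring

/-- The partial fraction coefficient of `∏ j ∈ S, (x - z j)⁻¹` at `z k`. -/
def pfCoeff (z : ι → K) (S : Finset ι) (k : ι) : K := ∏ j ∈ S.erase k, (z k - z j)⁻¹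

theorem pfCoeff_insert_of_ne (z : ι → K) {S : Finset ι} {m k : ι} (hm : m ∉ S) (hk : k ≠ m) :
    pfCoeff z (insert m S) k = (z k - z m)⁻¹ * pfCoeff z S k := by
  rw [pfCoeff, erase_insert_of_ne hk.symm, prod_insert (by simp [hm]), pfCoeff]

theorem pfCoeff_insert_self (z : ι → K) {S : Finset ι} {m : ι} (hm : m ∉ S) :
    pfCoeff z (insert m S) m = ∏ j ∈ S, (z m - z j)⁻¹ := by
  rw [pfCoeff, erase_insert hm]

theorem prod_inv_sub_eq_sum {z : ι → K} (hz : Function.Injective z) {S : Finset ι}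
    (hS : S.Nonempty) : ∀ x : K, (∀ j ∈ S, x ≠ z j) →
      ∏ j ∈ S, (x - z j)⁻¹ = ∑ l ∈ S, (x - z l)⁻¹ * pfCoeff z S l := by
  induction hS using Finset.Nonempty.cons_induction with
  | singleton a => intro x _; simp [pfCoeff]
  | cons m S hm hS ih =>
    intro x hx
    rw [cons_eq_insert] at *
    have hxm : x ≠ z m := hx m (mem_insert_self _ _)
    have hxS : ∀ j ∈ S, x ≠ z j := fun j hj => hx j (mem_insert_of_mem hj)
    have hmS : ∀ j ∈ S, z m ≠ z j := fun j hj h => hm (hz h ▸ hj)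
    rw [prod_insert hm, sum_insert hm, pfCoeff_insert_self z hm, ih x hxS, ih (z m) hmS, mul_sum,
      mul_sum, ← sum_add_distrib]
    refine sum_congr rfl fun l hl => ?_
    have hlm : l ≠ m := fun h => hm (h ▸ hl)
    rw [pfCoeff_insert_of_ne z hm hlm]
    have h := inv_sub_mul_inv_sub (hxS l hl) hxm (hmS l hl).symm
    have h' : (z m - z l)⁻¹ = -(z l - z m)⁻¹ := by rw [← neg_sub, inv_neg]
    rw [h']
    linear_combination (-pfCoeff z S l) * h

theorem sum_inv_sub_sq_mul_pfCoeff {z : ι → K} (hz : Function.Injective z) (S : Finset ι) (x : K)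
    (hx : ∀ j ∈ S, x ≠ z j) :
    ∑ l ∈ S, (x - z l)⁻¹ ^ 2 * pfCoeff z S l =
      (∏ j ∈ S, (x - z j)⁻¹) * ∑ j ∈ S, (x - z j)⁻¹ := by
  induction S using Finset.induction_on with
  | empty => simp
  | insert m S hm ih =>
    have hxm : x ≠ z m := hx m (mem_insert_self _ _)
    have hxS : ∀ j ∈ S, x ≠ z j := fun j hj => hx j (mem_insert_of_mem hj)
    have hmS : ∀ j ∈ S, z m ≠ z j := fun j hj h => hm (hz h ▸ hj)
    rcases S.eq_empty_or_nonempty with rfl | hS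
    · simp [pfCoeff, sq]
    have e1 : ∑ l ∈ S, (x - z l)⁻¹ ^ 2 * pfCoeff z (insert m S) l =
        (x - z m)⁻¹ * (∑ l ∈ S, (x - z l)⁻¹ ^ 2 * pfCoeff z S l) +
        (x - z m)⁻¹ ^ 2 * (∑ l ∈ S, (x - z l)⁻¹ * pfCoeff z S l) -
        (x - z m)⁻¹ ^ 2 * (∑ l ∈ S, (z m - z l)⁻¹ * pfCoeff z S l) := by
      rw [mul_sum, mul_sum, mul_sum, ← sum_add_distrib, ← sum_sub_distrib]
      refine sum_congr rfl fun l hl => ?_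
      have hlm : l ≠ m := fun h => hm (h ▸ hl)
      rw [pfCoeff_insert_of_ne z hm hlm]
      have h := inv_sub_mul_inv_sub (hxS l hl) hxm (hmS l hl).symm
      have h' : (z m - z l)⁻¹ = -(z l - z m)⁻¹ := by rw [← neg_sub, inv_neg]
      rw [h']
      linear_combination (((x - z l)⁻¹ + (x - z m)⁻¹) * pfCoeff z S l) * h
    rw [sum_insert hm, sum_insert hm, prod_insert hm, pfCoeff_insert_self z hm, e1, ih hxS,
      ← prod_inv_sub_eq_sum hz hS x hxS, ← prod_inv_sub_eq_sum hz hS (z m) hmS]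
    ring

theorem sum_inv_sub_mul_pfCoeff_of_mem {z : ι → K} (hz : Function.Injective z) {S : Finset ι}
    {k : ι} (hk : k ∈ S) :
    ∑ l ∈ S, (z k - z l)⁻¹ * pfCoeff z S l =
      -(pfCoeff z S k * ∑ l ∈ S, (z k - z l)⁻¹) := by
  obtain ⟨W, hW, rfl⟩ : ∃ W, k ∉ W ∧ insert k W = S := ⟨S.erase k, by simp, insert_erase hk⟩
  have hkW : ∀ j ∈ W, z k ≠ z j := fun j hj h => hW (hz h ▸ hj)
  rw [sum_insert hW, sum_insert hW, pfCoeff_insert_self z hW]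
  have := sum_inv_sub_sq_mul_pfCoeff hz W (z k) hkW
  simp only [sub_self, inv_zero, zero_mul, zero_add]
  rw [← this, ← sum_neg_distrib]
  refine sum_congr rfl fun l hl => ?_
  rw [pfCoeff_insert_of_ne z hW (fun h => hW (h ▸ hl))]
  have h' : (z l - z k)⁻¹ = -(z k - z l)⁻¹ := by rw [← neg_sub, inv_neg]
  rw [h']; ring

end PartialFractions

section SymmetrizedResolvent

open Equiv

variable {ι : Type*} [Fintype ι] [DecidableEq ι]

/-- The permutations supported on `S`. -/
def permsOn (S : Finset ι) : Finset (Perm ι) := univ.filter fun σ => ∀ x ∉ S, σ x = x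

theorem mem_permsOn {S : Finset ι} {σ : Perm ι} : σ ∈ permsOn S ↔ ∀ x ∉ S, σ x = x := by
  simp [permsOn]

theorem mem_of_mem_permsOn {S : Finset ι} {σ : Perm ι} (h : σ ∈ permsOn S) {x : ι} :
    σ x ∈ S ↔ x ∈ S := by
  rw [mem_permsOn] at h
  constructor
  · intro hx
    by_contra hxS
    rw [h x hxS] at hx
    exact hxS hx
  · intro hx
    by_contra hxS
    have := σ.injective (h _ hxS)
    rw [this] at hxS
    exact hxS hx

theorem permsOn_inv {S : Finset ι} {σ : Perm ι} (h : σ ∈ permsOn S) : σ⁻¹ ∈ permsOn S := by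
  rw [mem_permsOn] at *
  intro x hx
  rw [Perm.inv_eq_iff_eq, h x hx]

theorem permsOn_mul {S : Finset ι} {σ τ : Perm ι} (h : σ ∈ permsOn S) (h' : τ ∈ permsOn S) :
    σ * τ ∈ permsOn S := by
  rw [mem_permsOn] at *
  intro x hx
  rw [Perm.mul_apply, h' x hx, h x hx]

theorem swap_mem_permsOn {S : Finset ι} {k l : ι} (hk : k ∈ S) (hl : l ∈ S) :
    swap k l ∈ permsOn S := by
  rw [mem_permsOn]
  intro x hx
  exact swap_apply_of_ne_of_ne (fun h => hx (h ▸ hk)) (fun h => hx (h ▸ hl))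

theorem permsOn_mono {S T : Finset ι} (h : S ⊆ T) : permsOn S ⊆ permsOn T := by
  intro σ hσ
  rw [mem_permsOn] at *
  exact fun x hx => hσ x fun hxS => hx (h hxS)

theorem permsOn_empty : permsOn (∅ : Finset ι) = {1} := by
  ext σ
  simp [mem_permsOn, Perm.ext_iff]

theorem prod_inv_apply_mul {M : Type*} [CommMonoid M] (r : ι → M) {S : Finset ι} {σ : Perm ι}
    (hσ : σ ∈ permsOn S) (w : Perm ι) :
    ∏ j ∈ S, r ((σ * w)⁻¹ j) = ∏ j ∈ S, r (w⁻¹ j) := by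
  refine prod_bij (fun j _ => σ⁻¹ j) (fun j hj => (mem_of_mem_permsOn (permsOn_inv hσ)).2 hj)
    (fun _ _ _ _ h => σ⁻¹.injective h)
    (fun j hj => ⟨σ j, (mem_of_mem_permsOn hσ).2 hj, by simp⟩) (fun j _ => by simp)

theorem sum_permsOn_eq_sum_swap_mul {M : Type*} [AddCommMonoid M] {S : Finset ι} {k : ι}
    (hk : k ∈ S) (f : ι → Perm ι → M) :
    ∑ σ ∈ permsOn S, f (σ⁻¹ k) σ =
      ∑ m ∈ S, ∑ τ ∈ permsOn (S.erase m), f m (swap k m * τ) := by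
  rw [sum_sigma']
  refine sum_bij' (fun σ _ => ⟨σ⁻¹ k, swap k (σ⁻¹ k) * σ⟩) (fun p _ => swap k p.1 * p.2)
    ?_ ?_ ?_ ?_ ?_
  · intro σ hσ
    have hm : σ⁻¹ k ∈ S := (mem_of_mem_permsOn (permsOn_inv hσ)).2 hk
    refine mem_sigma.2 ⟨hm, mem_permsOn.2 fun x hx => ?_⟩
    by_cases hxm : x = σ⁻¹ k
    · simp [hxm]
    · have hxS : x ∉ S := fun h => hx (mem_erase.2 ⟨hxm, h⟩)
      rw [Perm.mul_apply, mem_permsOn.1 hσ x hxS]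
      exact swap_apply_of_ne_of_ne (fun h => hxS (h ▸ hk)) hxm
  · rintro ⟨m, τ⟩ h
    obtain ⟨hm, hτ⟩ := mem_sigma.1 h
    exact permsOn_mul (swap_mem_permsOn hk hm) (permsOn_mono (erase_subset _ _) hτ)
  · intro σ _
    simp [← mul_assoc]
  · rintro ⟨m, τ⟩ h
    obtain ⟨hm, hτ⟩ := mem_sigma.1 h
    have e : τ⁻¹ m = m := by
      rw [Perm.inv_eq_iff_eq]; exact (mem_permsOn.1 hτ m (by simp)).symm
    have e' : (swap k m * τ)⁻¹ k = m := by
      rw [mul_inv_rev, Perm.mul_apply, swap_inv, swap_apply_left, e]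
    simp only [e']
    simp [← mul_assoc]
  · intro σ _
    simp [← mul_assoc]

variable {K : Type*} [Field K]

/-- The symmetrization of `v` over `permsOn S`, weighted by a product over `S`. -/
def weightedSymm (r : ι → K) (v : Perm ι → K) (S : Finset ι) (w : Perm ι) : K :=
  (∏ j ∈ S, r (w⁻¹ j)) * ∑ σ ∈ permsOn S, v (σ * w)

/-- The variant of `weightedSymm` in which the summands are twisted by a transposition. -/
def weightedSymmSwap (r : ι → K) (v : Perm ι → K) (k : ι) (S : Finset ι) (l : ι) (w : Perm ι) :
    K :=
  (∏ j ∈ S, r (w⁻¹ j)) * ∑ σ ∈ permsOn S, v (swap k l * (σ * w))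

theorem weightedSymmSwap_self (r : ι → K) (v : Perm ι → K) (k : ι) (S : Finset ι) (w : Perm ι) :
    weightedSymmSwap r v k S k w = weightedSymm r v S w := by
  simp only [weightedSymmSwap, weightedSymm, swap_self]
  rfl

theorem weightedSymmSwap_of_mem (r : ι → K) (v : Perm ι → K) {k l : ι} {S : Finset ι}
    (hk : k ∈ S) (hl : l ∈ S) (w : Perm ι) :
    weightedSymmSwap r v k S l w = weightedSymm r v S w := by
  rw [weightedSymmSwap, weightedSymm]
  congr 1
  refine sum_bij (fun σ _ => swap k l * σ)
    (fun σ hσ => permsOn_mul (swap_mem_permsOn hk hl) hσ) (fun _ _ _ _ h => mul_left_cancel h)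
    (fun σ hσ => ⟨swap k l * σ, permsOn_mul (swap_mem_permsOn hk hl) hσ, by simp [← mul_assoc]⟩)
    (fun σ _ => by rw [mul_assoc])

variable {z a μ : ι → K} {v : Perm ι → K}

theorem sub_mul_weightedSymm
    (hv : ∀ k w, a k * v w =
      μ (w⁻¹ k) * v w + ∑ l, (z k - z l)⁻¹ * v (swap k l * w))
    {u : K} (hu : ∀ i, u ≠ μ i) {S : Finset ι} {k : ι} (hk : k ∈ S) (w : Perm ι) :
    (u - a k) * weightedSymm (fun i => (u - μ i)⁻¹) v S w =
      ∑ m ∈ S, weightedSymmSwap (fun i => (u - μ i)⁻¹) v k (S.erase m) m w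
      - (∑ l ∈ S, (z k - z l)⁻¹) * weightedSymm (fun i => (u - μ i)⁻¹) v S w
      - ∑ l ∈ Sᶜ, (z k - z l)⁻¹ * weightedSymmSwap (fun i => (u - μ i)⁻¹) v k S l w := by
  set r : ι → K := fun i => (u - μ i)⁻¹ with hr
  have h1 : ∑ σ ∈ permsOn S, (∏ j ∈ S.erase (σ⁻¹ k), r (w⁻¹ j)) * v (σ * w) =
      ∑ m ∈ S, weightedSymmSwap r v k (S.erase m) m w := by
    rw [sum_permsOn_eq_sum_swap_mul hk
      (fun m σ => (∏ j ∈ S.erase m, r (w⁻¹ j)) * v (σ * w))]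
    simp only [weightedSymmSwap, mul_sum, mul_assoc]
  have h2 : (∑ l ∈ S, (z k - z l)⁻¹) * weightedSymm r v S w =
      ∑ l ∈ S, (z k - z l)⁻¹ * weightedSymmSwap r v k S l w := by
    rw [sum_mul]
    exact sum_congr rfl fun l hl => by rw [weightedSymmSwap_of_mem r v hk hl]
  rw [h2, ← h1, sub_sub, sum_add_sum_compl, eq_sub_iff_add_eq]
  simp only [weightedSymmSwap, weightedSymm, mul_sum]
  rw [sum_comm, ← sum_add_distrib]
  refine sum_congr rfl fun σ hσ => ?_
  have hm : σ⁻¹ k ∈ S := (mem_of_mem_permsOn (permsOn_inv hσ)).2 hk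
  have e1 : ∏ j ∈ S, r (w⁻¹ j) = r (w⁻¹ (σ⁻¹ k)) * ∏ j ∈ S.erase (σ⁻¹ k), r (w⁻¹ j) :=
    (mul_prod_erase _ _ hm).symm
  have e2 : r (w⁻¹ (σ⁻¹ k)) * (u - μ (w⁻¹ (σ⁻¹ k))) = 1 :=
    inv_mul_cancel₀ (sub_ne_zero.2 (hu _))
  have e3 := hv k (σ * w)
  rw [mul_inv_rev, Perm.mul_apply] at e3
  have e4 : ∑ l, (z k - z l)⁻¹ * ((∏ j ∈ S, r (w⁻¹ j)) * v (swap k l * (σ * w))) =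
      (∏ j ∈ S, r (w⁻¹ j)) * ∑ l, (z k - z l)⁻¹ * v (swap k l * (σ * w)) := by
    rw [mul_sum]
    exact sum_congr rfl fun l _ => by ring
  rw [e4]
  rw [← sub_eq_iff_eq_add'] at e3
  rw [← e3, e1]
  linear_combination ((∏ j ∈ S.erase (σ⁻¹ k), r (w⁻¹ j)) * v (σ * w)) * e2

/-- The operators solving `(u - X) ξ = 1` when the diagonal of `X` acts through `v`. -/
def resolventSum (z r : ι → K) (v : Perm ι → K) (k : ι) (w : Perm ι) : K :=
  ∑ S ∈ univ.filter (k ∈ ·), pfCoeff z S k * weightedSymm r v S w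

theorem sub_mul_resolventSum (hz : Function.Injective z)
    (hv : ∀ k w, a k * v w =
      μ (w⁻¹ k) * v w + ∑ l, (z k - z l)⁻¹ * v (swap k l * w))
    {u : K} (hu : ∀ i, u ≠ μ i) (k : ι) (w : Perm ι) :
    (u - a k) * resolventSum z (fun i => (u - μ i)⁻¹) v k w
      - ∑ l, (z k - z l)⁻¹ * resolventSum z (fun i => (u - μ i)⁻¹) v l w = v w := by
  set r : ι → K := fun i => (u - μ i)⁻¹ with hr
  have key : (u - a k) * resolventSum z r v k w =
      ∑ S ∈ univ.filter (k ∈ ·), pfCoeff z S k * weightedSymm r v (S.erase k) w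
      - ∑ S ∈ univ.filter (k ∈ ·),
          pfCoeff z S k * ((∑ l ∈ S, (z k - z l)⁻¹) * weightedSymm r v S w) := by
    have h1 : ∑ S ∈ univ.filter (k ∈ ·), ∑ m ∈ S.erase k,
          pfCoeff z S k * weightedSymmSwap r v k (S.erase m) m w =
        ∑ S ∈ univ.filter (k ∈ ·), ∑ l ∈ Sᶜ,
          pfCoeff z S k * ((z k - z l)⁻¹ * weightedSymmSwap r v k S l w) := by
      rw [sum_sigma', sum_sigma']
      refine sum_bij' (fun p _ => ⟨p.1.erase p.2, p.2⟩) (fun p _ => ⟨insert p.2 p.1, p.2⟩)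
        ?_ ?_ ?_ ?_ ?_
      · rintro ⟨S, m⟩ h
        simp only [mem_sigma, mem_filter, mem_univ, true_and, mem_erase, mem_compl] at h ⊢
        exact ⟨⟨fun e => h.2.1 e.symm, h.1⟩, by simp⟩
      · rintro ⟨S, m⟩ h
        simp only [mem_sigma, mem_filter, mem_univ, true_and, mem_erase, mem_compl,
          mem_insert] at h ⊢
        exact ⟨Or.inr h.1, fun e => h.2 (e ▸ h.1), Or.inl trivial⟩
      · rintro ⟨S, m⟩ h
        simp only [mem_sigma, mem_filter, mem_univ, true_and, mem_erase] at h ⊢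
        simp [insert_erase h.2.2]
      · rintro ⟨S, m⟩ h
        simp only [mem_sigma, mem_filter, mem_univ, true_and, mem_compl] at h ⊢
        simp [erase_insert h.2]
      · rintro ⟨S, m⟩ h
        simp only [mem_sigma, mem_filter, mem_univ, true_and, mem_erase] at h ⊢
        have := pfCoeff_insert_of_ne z (notMem_erase m S) (k := k) (fun e => h.2.1 e.symm)
        rw [insert_erase h.2.2] at this
        rw [this]; ring
    rw [resolventSum, mul_sum]
    have h2 : ∀ S ∈ univ.filter (k ∈ ·), (u - a k) * (pfCoeff z S k * weightedSymm r v S w) =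
        pfCoeff z S k * weightedSymm r v (S.erase k) w
        + ∑ m ∈ S.erase k, pfCoeff z S k * weightedSymmSwap r v k (S.erase m) m w
        - pfCoeff z S k * ((∑ l ∈ S, (z k - z l)⁻¹) * weightedSymm r v S w)
        - ∑ l ∈ Sᶜ, pfCoeff z S k * ((z k - z l)⁻¹ * weightedSymmSwap r v k S l w) := by
      intro S hS
      have hk : k ∈ S := by simpa using hS
      have e := sub_mul_weightedSymm hv hu hk w
      rw [← hr, ← add_sum_erase _ _ hk, weightedSymmSwap_self] at e
      rw [← mul_sum, ← mul_sum]
      linear_combination (pfCoeff z S k) * e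
    rw [sum_congr rfl h2, sum_sub_distrib, sum_sub_distrib, sum_add_distrib, h1]
    ring
  have hA : ∑ S ∈ univ.filter (k ∈ ·), pfCoeff z S k * weightedSymm r v (S.erase k) w =
      ∑ U ∈ univ.filter (k ∉ ·), (∏ j ∈ U, (z k - z j)⁻¹) * weightedSymm r v U w := by
    refine sum_bij' (fun S _ => S.erase k) (fun U _ => insert k U) ?_ ?_ ?_ ?_ ?_
    · intro S _; simp
    · intro S _; simp
    · intro S hS; exact insert_erase (by simpa using hS)
    · intro S hS; exact erase_insert (by simpa using hS)
    · intro S _; rfl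
  have hB : ∑ l, (z k - z l)⁻¹ * resolventSum z r v l w =
      ∑ S, (∑ l ∈ S, (z k - z l)⁻¹ * pfCoeff z S l) * weightedSymm r v S w := by
    simp only [resolventSum, mul_sum, sum_mul]
    rw [sum_comm' (t' := univ) (s' := fun S => S) (by simp)]
    exact sum_congr rfl fun S _ => sum_congr rfl fun l _ => by ring
  have hC : ∑ S ∈ univ.filter (k ∈ ·),
      (∑ l ∈ S, (z k - z l)⁻¹ * pfCoeff z S l) * weightedSymm r v S w =
      -∑ S ∈ univ.filter (k ∈ ·),
          pfCoeff z S k * ((∑ l ∈ S, (z k - z l)⁻¹) * weightedSymm r v S w) := by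
    rw [← sum_neg_distrib]
    refine sum_congr rfl fun S hS => ?_
    rw [sum_inv_sub_mul_pfCoeff_of_mem hz (by simpa using hS)]
    ring
  have hD : ∑ U ∈ univ.filter (k ∉ ·), (∏ j ∈ U, (z k - z j)⁻¹) * weightedSymm r v U w -
      ∑ S ∈ univ.filter (k ∉ ·),
      (∑ l ∈ S, (z k - z l)⁻¹ * pfCoeff z S l) * weightedSymm r v S w = v w := by
    rw [← sum_sub_distrib, sum_eq_single ∅]
    · simp [weightedSymm, permsOn_empty]
    · intro S hS hne
      rw [prod_inv_sub_eq_sum hz (nonempty_iff_ne_empty.2 hne), sub_self]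
      intro j hj h
      have := hz h
      simp [this, hj] at hS
    · simp
  rw [key, hA, hB, ← sum_filter_add_sum_filter_not univ (k ∈ ·), hC]
  linear_combination hD

theorem sum_inv_sub_mul_resolventSum (hz : Function.Injective z) (r : ι → K) {t : K}
    (ht : ∀ i, t ≠ z i) (w : Perm ι) :
    ∑ k, (t - z k)⁻¹ * resolventSum z r v k w + v w =
      ∑ S, (∏ j ∈ S, (t - z j)⁻¹) * weightedSymm r v S w := by
  simp only [resolventSum, mul_sum]
  rw [sum_comm' (t' := univ) (s' := fun S => S) (by simp)]
  rw [← add_sum_erase univ _ (mem_univ ∅),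
    ← add_sum_erase (a := ∅) univ (fun S => (∏ j ∈ S, (t - z j)⁻¹) * _) (mem_univ _)]
  simp only [sum_empty, prod_empty, one_mul, zero_add]
  rw [add_comm]
  congr 1
  · simp [weightedSymm, permsOn_empty]
  · refine sum_congr rfl fun S hS => ?_
    rw [prod_inv_sub_eq_sum hz (nonempty_iff_ne_empty.2 (by simpa using hS)) t (fun j _ => ht j),
      sum_mul]
    exact sum_congr rfl fun l _ => by ring

end SymmetrizedResolvent

section DunklOperators

open Equiv

variable {ι K : Type*} [Fintype ι] [DecidableEq ι] [Field K]

/-- Dunkl-type operators on functions on the symmetric group. -/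
def dunkl (z a : ι → K) (i : ι) : Module.End K (Perm ι → K) where
  toFun v w := a (w i) * v w - ∑ l, (z (w i) - z l)⁻¹ * v (swap (w i) l * w)
  map_add' v v' := by
    ext w
    simp only [Pi.add_apply, mul_add, sum_add_distrib]
    ring
  map_smul' c v := by
    ext w
    simp only [Pi.smul_apply, smul_eq_mul, RingHom.id_apply, mul_sub, mul_sum]
    congr 1
    · ring
    · exact sum_congr rfl fun l _ => by ring

theorem dunkl_apply (z a : ι → K) (i : ι) (v : Perm ι → K) (w : Perm ι) :
    dunkl z a i v w = a (w i) * v w - ∑ l, (z (w i) - z l)⁻¹ * v (swap (w i) l * w) := rfl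

omit [Fintype ι] in
theorem swap_mul_swap_eq₁ {p q x : ι} (hpq : p ≠ q) (hxp : x ≠ p) (hxq : x ≠ q) :
    swap q x * swap p x = swap p x * swap p q := by
  ext y
  simp only [Perm.mul_apply, swap_apply_def]
  split_ifs <;> simp_all

omit [Fintype ι] in
theorem swap_mul_swap_eq₂ {p q x : ι} (hpq : p ≠ q) (hxp : x ≠ p) (hxq : x ≠ q) :
    swap p q * swap q x = swap p x * swap p q := by
  ext y
  simp only [Perm.mul_apply, swap_apply_def]
  split_ifs <;> simp_all

theorem sum_swap_commutator_eq_zero {z : ι → K} (hz : Function.Injective z) {p q : ι}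
    (hpq : p ≠ q) (V : Perm ι → K) :
    ∑ r, ∑ t, (z p - z r)⁻¹ * (z q - z t)⁻¹ *
      (V (swap q t * swap p r) - V (swap p r * swap q t)) = 0 := by
  have h : ∀ r t, (z p - z r)⁻¹ * (z q - z t)⁻¹ *
      (V (swap q t * swap p r) - V (swap p r * swap q t)) =
      (if t = p then (z p - z r)⁻¹ * (z q - z p)⁻¹ *
        (V (swap q p * swap p r) - V (swap p r * swap q p)) else 0) +
      (if r = q then (z p - z q)⁻¹ * (z q - z t)⁻¹ *
        (V (swap q t * swap p q) - V (swap p q * swap q t)) else 0) +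
      (if t = r then (z p - z r)⁻¹ * (z q - z r)⁻¹ *
        (V (swap q r * swap p r) - V (swap p r * swap q r)) else 0) := by
    intro r t
    by_cases hrp : r = p
    · subst hrp; simp [hpq]
    by_cases htq : t = q
    · subst htq
      by_cases hrt : r = t
      · subst hrt; simp [Ne.symm hpq]
      · simp [Ne.symm hpq, hrt, Ne.symm hrt]
    by_cases htp : t = p
    · subst htp
      by_cases hrq : r = q
      · subst hrq; simp [hpq, swap_comm]
      · simp [hrq, Ne.symm hrp]
    by_cases hrq : r = q
    · subst hrq; simp [htp, htq]
    by_cases htr : t = r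
    · subst htr; simp [htp, htq]
    · have hc : swap q t * swap p r = swap p r * swap q t := by
        ext y
        simp only [Perm.mul_apply, swap_apply_def]
        split_ifs <;> simp_all
      simp [htp, hrq, htr, hc]
  rw [sum_congr rfl fun r _ => sum_congr rfl fun t _ => h r t]
  simp only [sum_add_distrib, sum_ite_eq', mem_univ, if_true]
  rw [sum_comm (f := fun r t => if r = q then _ else _)]
  simp only [sum_ite_eq', mem_univ, if_true]
  rw [← sum_add_distrib, ← sum_add_distrib]
  refine sum_eq_zero fun x _ => ?_
  by_cases hxp : x = p
  · subst hxp; simp [swap_comm]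
  by_cases hxq : x = q
  · subst hxq; simp [swap_comm]
  rw [swap_comm q p, swap_mul_swap_eq₂ hpq hxp hxq, swap_mul_swap_eq₁ hpq hxp hxq]
  have e1 : swap q x * swap p q = swap p q * swap p x := by
    have := congrArg (·⁻¹) (swap_mul_swap_eq₂ hpq hxp hxq)
    simpa [mul_inv_rev] using this
  have e2 : swap p x * swap q x = swap p q * swap p x := by
    have := congrArg (·⁻¹) (swap_mul_swap_eq₁ hpq hxp hxq)
    simpa [mul_inv_rev] using this
  rw [e1, e2]
  have h1 := inv_sub_mul_inv_sub (hz.ne hpq) (hz.ne (Ne.symm hxp)) (hz.ne (Ne.symm hxq))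
  have h' : (z q - z p)⁻¹ = -(z p - z q)⁻¹ := by rw [← neg_sub, inv_neg]
  rw [h']
  linear_combination (V (swap p q * swap p x) - V (swap p x * swap p q)) * h1

theorem dunkl_commute {z : ι → K} (hz : Function.Injective z) (a : ι → K) (i j : ι) :
    Commute (dunkl z a i) (dunkl z a j) := by
  rcases eq_or_ne i j with rfl | hij
  · exact Commute.refl _
  refine LinearMap.ext fun v => funext fun w => ?_
  have hpq : w i ≠ w j := w.injective.ne hij
  have main : ∀ i j, w i ≠ w j → dunkl z a i (dunkl z a j v) w =
      a (w i) * a (w j) * v w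
      - ∑ r, a (w i) * (z (w j) - z r)⁻¹ * v (swap (w j) r * w)
      - ∑ r, a (w j) * (z (w i) - z r)⁻¹ * v (swap (w i) r * w)
      - (z (w i) - z (w j))⁻¹ * (a (w i) - a (w j)) * v (swap (w i) (w j) * w)
      + ∑ r, ∑ t, (z (w i) - z r)⁻¹ * (z (w j) - z t)⁻¹ *
          v ((swap (w j) t * swap (w i) r) * w)
      + (z (w i) - z (w j))⁻¹ * ∑ t, ((z (w i) - z t)⁻¹ *
          v ((swap (w i) t * swap (w i) (w j)) * w) -
          (z (w j) - z t)⁻¹ * v ((swap (w j) t * swap (w i) (w j)) * w)) := by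
    intro i j hpq
    simp only [dunkl_apply, Perm.mul_apply]
    generalize w i = p at *
    generalize w j = q at *
    have h : ∀ r, (z p - z r)⁻¹ * (a (swap p r q) * v (swap p r * w) -
        ∑ t, (z (swap p r q) - z t)⁻¹ * v (swap (swap p r q) t * (swap p r * w))) =
        a q * (z p - z r)⁻¹ * v (swap p r * w)
        - ∑ t, (z p - z r)⁻¹ * (z q - z t)⁻¹ * v ((swap q t * swap p r) * w)
        + if r = q then (z p - z q)⁻¹ * (a p - a q) * v (swap p q * w)
          - (z p - z q)⁻¹ * ∑ t, ((z p - z t)⁻¹ * v ((swap p t * swap p q) * w) -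
          (z q - z t)⁻¹ * v ((swap q t * swap p q) * w)) else 0 := by
      intro r
      by_cases hr : r = q
      · subst hr
        simp only [swap_apply_right, if_true, mul_assoc, ← mul_sum, sum_sub_distrib]
        ring
      · simp only [hr, if_false, add_zero]
        rw [mul_sub, mul_sum]
        by_cases hrp : r = p
        · subst hrp; simp
        · rw [swap_apply_of_ne_of_ne hpq.symm (Ne.symm hr)]
          simp only [mul_assoc]
          ring
    rw [sum_congr rfl fun r _ => h r]
    simp only [sum_add_distrib, sum_sub_distrib, sum_ite_eq', mem_univ, if_true, mul_sub,
      mul_sum, ← mul_assoc]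
    ring
  simp only [Module.End.mul_apply]
  rw [main i j hpq, main j i hpq.symm]
  have hD := sum_swap_commutator_eq_zero hz hpq (fun σ => v (σ * w))
  simp only [mul_sub, sum_sub_distrib] at hD
  rw [sum_comm (f := fun r t => (z (w j) - z r)⁻¹ * (z (w i) - z t)⁻¹ * _)]
  have h' : (z (w j) - z (w i))⁻¹ = -(z (w i) - z (w j))⁻¹ := by rw [← neg_sub, inv_neg]
  rw [h', swap_comm (w j) (w i)]
  simp only [sum_sub_distrib]
  have hD' : ∑ r, ∑ t, (z (w j) - z t)⁻¹ * (z (w i) - z r)⁻¹ *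
      v (swap (w i) r * swap (w j) t * w) = ∑ r, ∑ t, (z (w i) - z r)⁻¹ * (z (w j) - z t)⁻¹ *
      v (swap (w i) r * swap (w j) t * w) :=
    sum_congr rfl fun r _ => sum_congr rfl fun t _ => by ring
  rw [hD']
  linear_combination hD

end DunklOperators

section JointEigenvector

open Equiv

theorem Module.End.exists_joint_eigenvector {ι K V : Type*} [Finite ι] [Field K] [IsAlgClosed K]
    [AddCommGroup V] [Module K V] [FiniteDimensional K V] (T : ι → Module.End K V)
    (hT : ∀ i j, Commute (T i) (T j)) (U : Submodule K V) (hU : U ≠ ⊥)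
    (hTU : ∀ i, ∀ x ∈ U, T i x ∈ U) :
    ∃ (μ : ι → K) (v : V), v ∈ U ∧ v ≠ 0 ∧ ∀ i, T i v = μ i • v := by
  classical
  have := Fintype.ofFinite ι
  have key : ∀ s : Finset ι, ∃ μ : ι → K, ∃ v ∈ U, v ≠ 0 ∧ ∀ i ∈ s, T i v = μ i • v := by
    intro s
    induction s using Finset.induction_on with
    | empty =>
      obtain ⟨v, hv, hv0⟩ := U.ne_bot_iff.1 hU
      exact ⟨0, v, hv, hv0, by simp⟩
    | insert j s hj ih =>
      obtain ⟨μ, v, hv, hv0, hs⟩ := ih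
      let W : Submodule K V := U ⊓ ⨅ i ∈ s, LinearMap.ker (T i - μ i • 1)
      have hW : ∀ x, x ∈ W ↔ x ∈ U ∧ ∀ i ∈ s, T i x = μ i • x := by
        intro x
        simp [W, sub_eq_zero]
      have hTW : ∀ x ∈ W, T j x ∈ W := by
        intro x hx
        rw [hW] at hx ⊢
        refine ⟨hTU j x hx.1, fun i hi => ?_⟩
        have := LinearMap.congr_fun (hT i j).eq x
        simp only [Module.End.mul_apply] at this
        rw [this, hx.2 i hi, map_smul]
      have : Nontrivial W := ⟨⟨v, (hW v).2 ⟨hv, hs⟩⟩, 0, fun h => hv0 (congrArg Subtype.val h)⟩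
      obtain ⟨c, hc⟩ := Module.End.exists_eigenvalue ((T j).restrict hTW)
      obtain ⟨x, hx⟩ := hc.exists_hasEigenvector
      have hxW := (hW x).1 x.2
      refine ⟨Function.update μ j c, x, hxW.1, fun h => hx.2 (Subtype.ext h), fun i hi => ?_⟩
      rcases Finset.mem_insert.1 hi with rfl | hi
      · simpa using congrArg Subtype.val hx.apply_eq_smul
      · rw [Function.update_of_ne (ne_of_mem_of_not_mem hi hj)]
        exact hxW.2 i hi
  obtain ⟨μ, v, hv, hv0, h⟩ := key Finset.univ
  exact ⟨μ, v, hv, hv0, fun i => h i (Finset.mem_univ i)⟩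

variable {ι K : Type*} [Fintype ι] [DecidableEq ι] [Field K]

/-- The Calogero–Moser Lax matrix. -/
def cmMatrix (z a : ι → K) : Matrix ι ι K :=
  Matrix.diagonal a + Matrix.of fun k l => (z k - z l)⁻¹

theorem cmMatrix_mulVec (z a g : ι → K) (k : ι) :
    (cmMatrix z a).mulVec g k = a k * g k + ∑ l, (z k - z l)⁻¹ * g l := by
  rw [cmMatrix, Matrix.add_mulVec, Pi.add_apply, Matrix.mulVec_diagonal]
  rfl

/-- The functions `w ↦ sign w * g (w i)`. -/
def signTwist (K : Type*) [Field K] (i : ι) : (ι → K) →ₗ[K] (Perm ι → K) where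
  toFun g w := ((Perm.sign w : ℤ) : K) * g (w i)
  map_add' g g' := by ext w; simp [mul_add]
  map_smul' c g := by ext w; simp; ring

theorem dunkl_signTwist (z a : ι → K) (i : ι) (g : ι → K) :
    dunkl z a i (signTwist K i g) = signTwist K i ((cmMatrix z a).mulVec g) := by
  ext w
  rw [dunkl_apply]
  change _ * (((Perm.sign w : ℤ) : K) * g (w i)) - ∑ l, _ * (((Perm.sign _ : ℤ) : K) * g _) =
    ((Perm.sign w : ℤ) : K) * _
  rw [cmMatrix_mulVec, mul_add, mul_sum, sub_eq_add_neg, ← sum_neg_distrib]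
  congr 1
  · ring
  · refine sum_congr rfl fun l _ => ?_
    rcases eq_or_ne l (w i) with rfl | h
    · simp
    · rw [Perm.sign_mul, Perm.sign_swap h.symm, Perm.mul_apply, swap_apply_left]
      push_cast
      ring

theorem aeval_dunkl_signTwist (z a : ι → K) (i : ι) (p : Polynomial K) (g : ι → K) :
    Polynomial.aeval (dunkl z a i) p (signTwist K i g) =
      signTwist K i ((Polynomial.aeval (cmMatrix z a) p).mulVec g) := by
  induction p using Polynomial.induction_on generalizing g with
  | C c => simp [Algebra.algebraMap_eq_smul_one, Matrix.smul_mulVec]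
  | add p q hp hq => simp [hp, hq, Matrix.add_mulVec]
  | monomial m c ih =>
    have hX : Polynomial.C c * Polynomial.X ^ (m + 1) =
        (Polynomial.C c * Polynomial.X ^ m) * Polynomial.X := by ring
    rw [hX]
    generalize Polynomial.C c * Polynomial.X ^ m = q at *
    rw [Polynomial.aeval_mul, Polynomial.aeval_mul, Module.End.mul_apply, Polynomial.aeval_X,
      Polynomial.aeval_X, dunkl_signTwist, ih, Matrix.mulVec_mulVec]

theorem exists_dunkl_eigenvector [IsAlgClosed K] {z : ι → K} (hz : Function.Injective z)
    (a : ι → K) :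
    ∃ (μ : ι → K) (v : Perm ι → K), v ≠ 0 ∧ (∀ i, (cmMatrix z a).charpoly.IsRoot (μ i)) ∧
      ∀ k w, a k * v w = μ (w⁻¹ k) * v w + ∑ l, (z k - z l)⁻¹ * v (swap k l * w) := by
  set χ := (cmMatrix z a).charpoly with hχ
  let U : Submodule K (Perm ι → K) :=
    ⨅ i, LinearMap.ker (Polynomial.aeval (dunkl z a i) χ)
  have hU : ∀ x, x ∈ U ↔ ∀ i, Polynomial.aeval (dunkl z a i) χ x = 0 := by
    intro x; simp [U]
  obtain ⟨μ, v, hvU, hv0, hv⟩ := Module.End.exists_joint_eigenvector (dunkl z a)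
    (dunkl_commute hz a) U
    (by
      refine (Submodule.ne_bot_iff _).2 ⟨fun w => ((Perm.sign w : ℤ) : K), (hU _).2 fun i => ?_,
        fun h => ?_⟩
      · have := aeval_dunkl_signTwist z a i χ 1
        rw [hχ, Matrix.aeval_self_charpoly, Matrix.zero_mulVec, map_zero, ← hχ] at this
        rw [← this]
        congr 1
        ext w
        simp [signTwist]
      · simpa using congrFun h 1)
    (fun i x hx => by
      rw [hU] at hx ⊢
      intro j
      have hc : Commute (dunkl z a i) (Polynomial.aeval (dunkl z a j) χ) :=
        Polynomial.induction_on χ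
          (fun c => by
            rw [Polynomial.aeval_C]
            exact (Algebra.commutes c _).symm)
          (fun p q hp hq => by rw [map_add]; exact hp.add_right hq)
          (fun n c h => by
            rw [pow_succ, ← mul_assoc, map_mul, Polynomial.aeval_X]
            exact h.mul_right (dunkl_commute hz a i j))
      have := LinearMap.congr_fun hc.eq x
      simp only [Module.End.mul_apply] at this
      rw [← this, hx j, map_zero])
  refine ⟨μ, v, hv0, fun i => ?_, fun k w => ?_⟩
  · have h1 : Module.End.HasEigenvector (dunkl z a i) (μ i) v :=
      ⟨Module.End.mem_eigenspace_iff.2 (hv i), hv0⟩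
    have h2 := Module.End.aeval_apply_of_hasEigenvector (p := χ) h1
    rw [(hU v).1 hvU i] at h2
    exact (smul_eq_zero.1 h2.symm).resolve_right hv0
  · have := congrFun (hv (w⁻¹ k)) w
    rw [dunkl_apply, show w (w⁻¹ k) = k from w.apply_symm_apply k, Pi.smul_apply, smul_eq_mul] at this
    linear_combination this

end JointEigenvector

section BaxterMatrix

open Equiv Matrix

variable {ι K : Type*} [Fintype ι] [DecidableEq ι] [Field K]

/-- The operator symmetrizing over all subsets, acting on functions on the symmetric group. -/
def baxterMatrix (ρ r : ι → K) : Matrix (Perm ι) (Perm ι) K :=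
  Matrix.of fun w w' => ∑ S : Finset ι,
    if w' * w⁻¹ ∈ permsOn S then (∏ j ∈ S, ρ j) * ∏ j ∈ S, r (w⁻¹ j) else 0

theorem baxterMatrix_mulVec (ρ r : ι → K) (v : Perm ι → K) (w : Perm ι) :
    (baxterMatrix ρ r *ᵥ v) w = ∑ S : Finset ι, (∏ j ∈ S, ρ j) * weightedSymm r v S w := by
  simp only [baxterMatrix, mulVec, dotProduct, of_apply, sum_mul, weightedSymm]
  rw [sum_comm]
  refine sum_congr rfl fun S _ => ?_
  simp only [ite_mul, zero_mul, ← mul_assoc]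
  rw [← sum_filter, mul_sum]
  refine sum_bij' (fun w' _ => w' * w⁻¹) (fun σ _ => σ * w) ?_ ?_ ?_ ?_ ?_ <;> simp

theorem baxterMatrix_isHermitian (ρ r : ι → ℂ) (hρ : ∀ i, star (ρ i) = ρ i)
    (hr : ∀ i, star (r i) = r i) : (baxterMatrix ρ r).IsHermitian := by
  refine Matrix.ext fun w w' => ?_
  simp only [conjTranspose_apply, baxterMatrix, of_apply, star_sum]
  refine sum_congr rfl fun S _ => ?_
  have h : ∀ w w' : Perm ι, w' * w⁻¹ ∈ permsOn S → w * w'⁻¹ ∈ permsOn S := by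
    intro w w' h
    have := permsOn_inv h
    rwa [_root_.mul_inv_rev, inv_inv] at this
  by_cases hS : w' * w⁻¹ ∈ permsOn S
  · rw [if_pos hS, if_pos (h _ _ hS), star_mul', star_prod, star_prod]
    simp only [hρ, hr]
    rw [← prod_inv_apply_mul r hS w, inv_mul_cancel_right]
  · rw [if_neg hS, if_neg (fun hS' => hS (h _ _ hS')), star_zero]

theorem exists_det_baxterMatrix_cmMatrix_eq_zero [IsAlgClosed K] {z : ι → K}
    (hz : Function.Injective z) (a : ι → K) :
    ∃ μ : ι → K, (∀ i, (cmMatrix z a).charpoly.IsRoot (μ i)) ∧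
      ∀ (t u : K) (η : ι → K), (∀ i, t ≠ z i) → ¬ (cmMatrix z a).charpoly.IsRoot u →
        (scalar ι u - cmMatrix z a) *ᵥ (fun k => (t - z k) * η k) = 1 →
        (baxterMatrix (fun i => (t - z i)⁻¹) (fun i => (u - μ i)⁻¹) -
          (1 + ∑ k, η k) • (1 : Matrix (Perm ι) (Perm ι) K)).det = 0 := by
  obtain ⟨μ, v, hv0, hμ, hv⟩ := exists_dunkl_eigenvector hz a
  refine ⟨μ, hμ, fun t u η ht hu hη => ?_⟩
  have huμ : ∀ i, u ≠ μ i := fun i h => hu (h ▸ hμ i)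
  have hdet : (scalar ι u - cmMatrix z a).det ≠ 0 := by
    rwa [← Matrix.eval_charpoly]
  rw [← Matrix.exists_mulVec_eq_zero_iff]
  refine ⟨v, hv0, ?_⟩
  rw [sub_mulVec, sub_eq_zero, smul_mulVec, one_mulVec]
  ext w
  rw [baxterMatrix_mulVec, ← sum_inv_sub_mul_resolventSum hz _ ht]
  have h1 : (scalar ι u - cmMatrix z a) *ᵥ
      (fun k => resolventSum z (fun i => (u - μ i)⁻¹) v k w) = fun _ => v w := by
    ext k
    rw [sub_mulVec, Pi.sub_apply, cmMatrix_mulVec, ← sub_mul_resolventSum hz hv huμ k w,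
      scalar_apply, mulVec_diagonal]
    ring
  have h2 : (fun k => resolventSum z (fun i => (u - μ i)⁻¹) v k w) =
      fun k => v w * ((t - z k) * η k) := by
    refine sub_eq_zero.1 (Matrix.eq_zero_of_mulVec_eq_zero hdet ?_)
    rw [mulVec_sub, h1, sub_eq_zero]
    have : (fun k => v w * ((t - z k) * η k)) = v w • fun k => (t - z k) * η k := rfl
    rw [this, mulVec_smul, hη]
    ext; simp
  have h3 : ∀ k, (t - z k)⁻¹ * resolventSum z (fun i => (u - μ i)⁻¹) v k w = v w * η k := by
    intro k
    have := congrFun h2 k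
    rw [this]
    have := sub_ne_zero.2 (ht k)
    field_simp
  rw [sum_congr rfl fun k _ => h3 k, ← mul_sum, Pi.smul_apply, smul_eq_mul]
  ring

/-- A regular Calogero–Moser pair can be brought to the standard form. -/
theorem exists_conj_cmMatrix {X Y : Matrix ι ι K} {v w : ι → K}
    (h : Y * X - X * Y + 1 = vecMulVec v w) {z : ι → K} (hz : Function.Injective z)
    (hY : ∀ i, Y.charpoly.IsRoot (z i)) :
    ∃ (g : (Matrix ι ι K)ˣ) (a : ι → K), Y = g.1 * diagonal z * g.2 ∧
      X = g.1 * cmMatrix z a * g.2 ∧ v = g.1 *ᵥ 1 ∧ w ᵥ* g.1 = 1 := by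
  have hb : ∀ i, ∃ b : ι → K, b ≠ 0 ∧ Y *ᵥ b = z i • b := by
    intro i
    have hd : (scalar ι (z i) - Y).det = 0 := by
      rw [← Matrix.eval_charpoly]; exact hY i
    obtain ⟨b, hb0, hb⟩ := Matrix.exists_mulVec_eq_zero_iff.2 hd
    refine ⟨b, hb0, ?_⟩
    rw [sub_mulVec, sub_eq_zero] at hb
    rw [← hb]
    ext k
    rw [scalar_apply, mulVec_diagonal]
    rfl
  choose b hb0 hb using hb
  have hli : LinearIndependent K b :=
    Module.End.eigenvectors_linearIndependent' (Matrix.toLin' Y) z hz b fun i =>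
      ⟨Module.End.mem_eigenspace_iff.2 (by simpa using hb i), hb0 i⟩
  let G : Matrix ι ι K := (Matrix.of b)ᵀ
  have hG : IsUnit G := by
    rw [← Matrix.linearIndependent_cols_iff_isUnit]
    exact hli
  obtain ⟨G, hGe⟩ := hG
  have hYG : Y * G.1 = G.1 * diagonal z := by
    ext k i
    rw [mul_diagonal, hGe]
    have := congrFun (hb i) k
    rw [Pi.smul_apply, smul_eq_mul] at this
    rw [mul_comm]
    exact this
  have key : ∀ (H : (Matrix ι ι K)ˣ), Y * H.1 = H.1 * diagonal z → ∀ i j,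
      (z i - z j) * (H.2 * X * H.1) i j + (1 : Matrix ι ι K) i j =
        (H.2 *ᵥ v) i * (w ᵥ* H.1) j := by
    intro H hH i j
    have e1 : H.2 * (Y * X - X * Y + 1) * H.1 =
        diagonal z * (H.2 * X * H.1) - (H.2 * X * H.1) * diagonal z + 1 := by
      have hH' : H.2 * Y = diagonal z * H.2 := by
        calc H.2 * Y = H.2 * (Y * H.1) * H.2 := by
              rw [mul_assoc, mul_assoc, H.3, mul_one]
          _ = _ := by rw [hH, ← mul_assoc, H.4, one_mul]
      calc H.2 * (Y * X - X * Y + 1) * H.1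
          = (H.2 * Y) * X * H.1 - H.2 * X * (Y * H.1) + H.2 * H.1 := by noncomm_ring
        _ = _ := by rw [hH, hH', H.4]; noncomm_ring
    rw [h, mul_vecMulVec, vecMulVec_mul] at e1
    have := congrFun (congrFun e1 i) j
    rw [vecMulVec_apply] at this
    rw [this, Matrix.add_apply, Matrix.sub_apply, diagonal_mul, mul_diagonal]
    ring
  have hv' : ∀ i, (G.2 *ᵥ v) i * (w ᵥ* G.1) i = 1 := by
    intro i
    rw [← key G hYG i i]
    simp
  have hD : IsUnit (diagonal (G.2 *ᵥ v)) := by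
    rw [Matrix.isUnit_iff_isUnit_det, det_diagonal, isUnit_iff_ne_zero, prod_ne_zero_iff]
    exact fun i _ => left_ne_zero_of_mul_eq_one (hv' i)
  obtain ⟨D, hDe⟩ := hD
  have hYH : Y * (G * D).1 = (G * D).1 * diagonal z := by
    rw [Units.val_mul, ← mul_assoc, hYG, hDe, mul_assoc, mul_assoc, diagonal_mul_diagonal,
      diagonal_mul_diagonal]
    simp only [mul_comm]
  have hv1 : (G * D).1 *ᵥ 1 = v := by
    rw [Units.val_mul, hDe, ← mulVec_mulVec]
    have : diagonal (G.2 *ᵥ v) *ᵥ 1 = G.2 *ᵥ v := by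
      ext i; rw [mulVec_diagonal]; simp
    rw [this, mulVec_mulVec, G.3, one_mulVec]
  have hw1 : w ᵥ* (G * D).1 = 1 := by
    rw [Units.val_mul, hDe, ← vecMul_vecMul]
    ext i
    rw [vecMul_diagonal, mul_comm, hv' i]
    rfl
  set H := G * D with hH
  have hvH : H.2 *ᵥ v = 1 := by
    rw [← hv1, mulVec_mulVec, H.4, one_mulVec]
  refine ⟨H, fun i => (H.2 * X * H.1) i i, ?_, ?_, hv1.symm, hw1⟩
  · rw [← hYH, mul_assoc, H.3, mul_one]
  · have : cmMatrix z (fun i => (H.2 * X * H.1) i i) = H.2 * X * H.1 := by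
      ext i j
      rcases eq_or_ne i j with rfl | hij
      · simp [cmMatrix]
      · have := key H hYH i j
        rw [hvH, hw1, one_apply_ne hij, Pi.one_apply, Pi.one_apply, add_zero, mul_one] at this
        rw [cmMatrix, Matrix.add_apply, diagonal_apply_ne _ hij, of_apply, zero_add]
        exact (eq_inv_of_mul_eq_one_right this).symm
    rw [this, ← mul_assoc, ← mul_assoc, H.3, one_mul, mul_assoc, H.3, mul_one]

theorem exists_det_baxterMatrix_eq_zero [IsAlgClosed K] {X Y : Matrix ι ι K} {v w : ι → K}
    (h : Y * X - X * Y + 1 = vecMulVec v w) {z : ι → K} (hz : Function.Injective z)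
    (hY : ∀ i, Y.charpoly.IsRoot (z i)) :
    ∃ μ : ι → K, (∀ i, X.charpoly.IsRoot (μ i)) ∧
      ∀ (t u : K) (ξ η : ι → K), ¬ Y.charpoly.IsRoot t → ¬ X.charpoly.IsRoot u →
        (scalar ι u - X) *ᵥ ξ = v → (scalar ι t - Y) *ᵥ η = ξ →
        (baxterMatrix (fun i => (t - z i)⁻¹) (fun i => (u - μ i)⁻¹) -
          (1 + w ⬝ᵥ η) • (1 : Matrix (Perm ι) (Perm ι) K)).det = 0 := by
  obtain ⟨g, a, hYg, hXg, hvg, hw⟩ := exists_conj_cmMatrix h hz hY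
  obtain ⟨μ, hμ, hF⟩ := exists_det_baxterMatrix_cmMatrix_eq_zero hz a
  have hχ : X.charpoly = (cmMatrix z a).charpoly := by
    rw [hXg, Matrix.charpoly_mul_comm, ← mul_assoc, g.4, one_mul]
  rw [hχ]
  have hconj : ∀ (c : K) (A : Matrix ι ι K) (x : ι → K),
      (scalar ι c - g.1 * A * g.2) *ᵥ x = g.1 *ᵥ ((scalar ι c - A) *ᵥ (g.2 *ᵥ x)) := by
    intro c A x
    rw [mulVec_mulVec, mulVec_mulVec, mul_sub, sub_mul, ← scalar_comm c (fun _ => mul_comm _ _),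
      mul_assoc (scalar ι c), g.3, mul_one]
  have hinj : ∀ x y : ι → K, g.1 *ᵥ x = g.1 *ᵥ y → x = y := by
    intro x y hxy
    have := congrArg (g.2 *ᵥ ·) hxy
    simpa only [mulVec_mulVec, g.4, one_mulVec] using this
  refine ⟨μ, hμ, fun t u ξ η ht hu hξ hη => ?_⟩
  have e : w ⬝ᵥ η = ∑ k, (g.2 *ᵥ η) k := by
    have : η = g.1 *ᵥ (g.2 *ᵥ η) := by rw [mulVec_mulVec, g.3, one_mulVec]
    conv_lhs => rw [this, dotProduct_mulVec, hw]
    simp [dotProduct]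
  rw [e]
  refine hF t u (g.2 *ᵥ η) (fun i hi => ht (hi ▸ hY i)) hu ?_
  apply hinj
  have h3 : g.2 *ᵥ ξ = (scalar ι t - diagonal z) *ᵥ (g.2 *ᵥ η) := by
    apply hinj
    rw [← hconj, ← hYg, hη, mulVec_mulVec, g.3, one_mulVec]
  rw [← hvg, ← hξ, hXg, hconj, h3]
  congr 2
  ext k
  rw [sub_mulVec, Pi.sub_apply, scalar_apply, mulVec_diagonal, mulVec_diagonal]
  ring

end BaxterMatrix

section SpectralIdempotent

open Polynomial

theorem Polynomial.exists_idempotent_of_rootMultiplicity {K : Type*} [Field K] {χ : K[X]}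
    (hχ : χ ≠ 0) (c : K) :
    ∃ κ e : K[X], χ = (X - C c) ^ χ.rootMultiplicity c * κ ∧ IsCoprime (X - C c) κ ∧
      κ ∣ e ∧ (X - C c) ^ χ.rootMultiplicity c ∣ 1 - e ∧ χ ∣ derivative e := by
  obtain ⟨κ, hκ, hκc⟩ := exists_eq_pow_rootMultiplicity_mul_and_not_dvd χ hχ c
  generalize χ.rootMultiplicity c = m at *
  have hcop : IsCoprime (X - C c) κ :=
    (irreducible_X_sub_C c).coprime_iff_not_dvd.2 hκc
  have hcop' : IsCoprime ((X - C c) ^ m) κ := hcop.pow_left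
  obtain ⟨α, β, hαβ⟩ : IsCoprime (((X - C c) ^ m) ^ 2) (κ ^ 2) := hcop'.pow
  refine ⟨κ, β * κ ^ 2, hκ, hcop, dvd_mul_of_dvd_right (dvd_pow_self κ two_ne_zero) β, ?_, ?_⟩
  · generalize (X - C c) ^ m = A at *
    exact ⟨α * A, by linear_combination -hαβ⟩
  · rw [hκ]
    generalize (X - C c) ^ m = A at *
    refine IsCoprime.mul_dvd hcop' ?_ ?_
    · have h2 : β * κ ^ 2 = 1 - α * A ^ 2 := by linear_combination hαβ
      rw [h2]
      refine ⟨-(derivative α * A + α * (2 * derivative A)), ?_⟩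
      simp only [derivative_sub, derivative_one, derivative_mul, pow_two]
      ring
    · refine ⟨derivative β * κ + β * (2 * derivative κ), ?_⟩
      simp only [derivative_mul, pow_two]
      ring

variable {ι K : Type*} [Fintype ι] [DecidableEq ι] [Field K]

theorem Matrix.aeval_eq_zero_of_charpoly_dvd (Y : Matrix ι ι K) {p : K[X]}
    (h : Y.charpoly ∣ p) : aeval Y p = 0 := by
  obtain ⟨q, rfl⟩ := h
  rw [map_mul, Matrix.aeval_self_charpoly, zero_mul]

theorem Matrix.toLin'_sub_smul_pow_apply (Y : Matrix ι ι K) (c : K) (k : ℕ) (x : ι → K) :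
    ((Matrix.toLin' Y - c • 1) ^ k) x = (aeval Y ((X - C c) ^ k)).mulVec x := by
  rw [map_pow, map_sub, aeval_X, aeval_C, ← Matrix.toLin'_apply, Matrix.toLin'_pow,
    map_sub, Algebra.algebraMap_eq_smul_one, map_smul, Matrix.toLin'_one]
  rfl

theorem Matrix.trace_aeval_eq_rootMultiplicity (Y : Matrix ι ι K) {c : K} {κ e : K[X]}
    (hκ : Y.charpoly = (X - C c) ^ Y.charpoly.rootMultiplicity c * κ)
    (hcop : IsCoprime (X - C c) κ) (hκe : κ ∣ e)
    (he : (X - C c) ^ Y.charpoly.rootMultiplicity c ∣ 1 - e) :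
    (aeval Y e).trace = (Y.charpoly.rootMultiplicity c : K) := by
  have hproj : LinearMap.IsProj (Module.End.maxGenEigenspace (Matrix.toLin' Y) c)
      (Matrix.toLin' (aeval Y e)) := by
    constructor
    · intro x
      rw [Module.End.mem_maxGenEigenspace]
      refine ⟨Y.charpoly.rootMultiplicity c, ?_⟩
      rw [Y.toLin'_sub_smul_pow_apply, Matrix.toLin'_apply, Matrix.mulVec_mulVec,
        ← map_mul, Y.aeval_eq_zero_of_charpoly_dvd, Matrix.zero_mulVec]
      conv_lhs => rw [hκ]
      exact mul_dvd_mul dvd_rfl hκe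
    · intro x hx
      rw [Module.End.mem_maxGenEigenspace] at hx
      obtain ⟨k, hk⟩ := hx
      rw [Y.toLin'_sub_smul_pow_apply] at hk
      obtain ⟨a, b, hab⟩ : IsCoprime ((X - C c) ^ k) κ := hcop.pow_left
      rw [Matrix.toLin'_apply]
      have h1 : (aeval Y (κ * (1 - e))).mulVec x = 0 := by
        rw [Y.aeval_eq_zero_of_charpoly_dvd, Matrix.zero_mulVec]
        conv_lhs => rw [hκ]
        rw [mul_comm]
        exact mul_dvd_mul dvd_rfl he
      have h2 : (aeval Y (1 - e)).mulVec x = 0 := by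
        have h3 : 1 - e = ((1 - e) * a) * (X - C c) ^ k + b * (κ * (1 - e)) := by
          linear_combination (-(1 - e)) * hab
        rw [h3, map_add, Matrix.add_mulVec, map_mul _ ((1 - e) * a), map_mul _ b,
          ← Matrix.mulVec_mulVec, hk, ← Matrix.mulVec_mulVec, h1, Matrix.mulVec_zero,
          Matrix.mulVec_zero, add_zero]
      rw [map_sub, map_one, Matrix.sub_mulVec, Matrix.one_mulVec, sub_eq_zero] at h2
      exact h2.symm
  have := hproj.trace
  rw [LinearMap.finrank_maxGenEigenspace_eq, Matrix.charpoly_toLin',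
    Matrix.trace_toLin'_eq] at this
  exact this

/-- The spectral projection onto a generalized eigenspace, as a polynomial in the matrix. -/
theorem Matrix.exists_spectral_idempotent (Y : Matrix ι ι K) (c : K) :
    ∃ e : K[X], aeval Y e * aeval Y e = aeval Y e ∧ aeval Y (derivative e) = 0 ∧
      IsNilpotent (aeval Y ((X - C c) * e)) ∧
      (aeval Y e).trace = (Y.charpoly.rootMultiplicity c : K) := by
  obtain ⟨κ, e, hκ, hcop, hκe, he, hd⟩ :=
    Polynomial.exists_idempotent_of_rootMultiplicity Y.charpoly_monic.ne_zero c
  refine ⟨e, ?_, Y.aeval_eq_zero_of_charpoly_dvd hd, ⟨Y.charpoly.rootMultiplicity c + 1, ?_⟩,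
    Y.trace_aeval_eq_rootMultiplicity hκ hcop hκe he⟩
  · have h1 : aeval Y ((1 - e) * e) = 0 := by
      apply Y.aeval_eq_zero_of_charpoly_dvd
      conv_lhs => rw [hκ]
      exact mul_dvd_mul he hκe
    rw [sub_mul, one_mul, map_sub, map_mul, sub_eq_zero] at h1
    exact h1.symm
  · rw [← map_pow, mul_pow]
    apply Y.aeval_eq_zero_of_charpoly_dvd
    conv_lhs => rw [hκ]
    exact mul_dvd_mul (pow_dvd_pow _ (Nat.le_succ _)) (hκe.trans (dvd_pow_self e (Nat.succ_ne_zero _)))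

end SpectralIdempotent

section TraceGram

open Polynomial Matrix Filter Topology

variable {ι κ : Type*} [Fintype ι] [DecidableEq ι]

theorem exists_hasDerivAt_aeval (Y M : Matrix ι ι ℂ) (f : ℂ[X]) :
    ∃ D : Matrix ι ι ℂ,
      (∀ i j, HasDerivAt (fun ε : ℂ => aeval (Y + ε • M) f i j) (D i j) 0) ∧
      ∀ q : ℂ[X], (aeval Y q * D).trace = (aeval Y (q * derivative f) * M).trace := by
  induction f using Polynomial.induction_on with
  | C c =>
    refine ⟨0, fun i j => ?_, fun q => by simp⟩
    simp only [aeval_C, Matrix.zero_apply]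
    exact hasDerivAt_const _ _
  | add f g hf hg =>
    obtain ⟨D, hD, hD'⟩ := hf
    obtain ⟨E, hE, hE'⟩ := hg
    refine ⟨D + E, fun i j => ?_, fun q => ?_⟩
    · simp only [map_add, Matrix.add_apply]
      exact (hD i j).add (hE i j)
    · rw [mul_add, trace_add, hD', hE', map_add, mul_add, map_add, add_mul, trace_add]
  | monomial m c ih =>
    rw [pow_succ, ← mul_assoc]
    generalize C c * X ^ m = f at *
    obtain ⟨D, hD, hD'⟩ := ih
    refine ⟨D * Y + aeval Y f * M, fun i j => ?_, fun q => ?_⟩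
    · have hl : ∀ l, HasDerivAt (fun ε : ℂ => (Y + ε • M) l j) (M l j) 0 := by
        intro l
        simp only [Matrix.add_apply, Matrix.smul_apply, smul_eq_mul]
        simpa using ((hasDerivAt_id (0 : ℂ)).mul_const (M l j)).const_add (Y l j)
      have := HasDerivAt.fun_sum (u := univ) fun l _ => (hD i l).mul (hl l)
      have e1 : (fun ε : ℂ => aeval (Y + ε • M) (f * X) i j) =
          fun ε => ∑ l, aeval (Y + ε • M) f i l * (Y + ε • M) l j := by
        ext ε
        rw [Polynomial.aeval_mul, aeval_X, Matrix.mul_apply]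
      have e2 : (D * Y + aeval Y f * M) i j =
          ∑ l, (D i l * (Y + (0 : ℂ) • M) l j + aeval (Y + (0 : ℂ) • M) f i l * M l j) := by
        rw [zero_smul, add_zero, Matrix.add_apply, Matrix.mul_apply, Matrix.mul_apply,
          sum_add_distrib]
      rw [e1, e2]
      exact this
    · have h1 : aeval Y q * (D * Y + aeval Y f * M) =
          aeval Y q * D * Y + aeval Y (q * f) * M := by
        rw [Polynomial.aeval_mul]; noncomm_ring
      have h2 : (aeval Y q * D * Y).trace = (aeval Y (X * q) * D).trace := by
        rw [trace_mul_comm, Polynomial.aeval_mul, aeval_X, mul_assoc]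
      rw [h1, trace_add, h2, hD', ← trace_add, ← add_mul, ← map_add]
      congr 3
      simp only [derivative_mul, derivative_X]
      ring

theorem hasDerivAt_trace_aeval (Y M : Matrix ι ι ℂ) (f : ℂ[X]) :
    HasDerivAt (fun ε : ℂ => (aeval (Y + ε • M) f).trace)
      ((aeval Y (derivative f) * M).trace) 0 := by
  obtain ⟨D, hD, hD'⟩ := exists_hasDerivAt_aeval Y M f
  have h := hD' 1
  rw [map_one, one_mul, one_mul] at h
  rw [← h]
  exact HasDerivAt.fun_sum (u := univ) fun l _ => hD l l

/-- The matrix of traces of products of polynomials in `Y`. -/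
noncomputable def traceGram (g k : κ → ℂ[X]) (Y : Matrix ι ι ℂ) : Matrix κ κ ℂ :=
  Matrix.of fun i j => (aeval Y (g i * k j)).trace

theorem card_le_of_det_traceGram_ne_zero [Fintype κ] [DecidableEq κ] {g k : κ → ℂ[X]}
    {Y : Matrix ι ι ℂ} (h : (traceGram g k Y).det ≠ 0) :
    Fintype.card κ ≤ Fintype.card (ι × ι) := by
  let A : Matrix κ (ι × ι) ℂ := Matrix.of fun i p => aeval Y (g i) p.1 p.2
  let B : Matrix (ι × ι) κ ℂ := Matrix.of fun p j => aeval Y (k j) p.2 p.1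
  have hAB : traceGram g k Y = A * B := by
    ext i j
    simp only [traceGram, of_apply, Matrix.mul_apply, A, B, Polynomial.aeval_mul, trace, diag_apply,
      Fintype.sum_prod_type]
  have h1 : (traceGram g k Y).rank = Fintype.card κ :=
    rank_of_isUnit _ ((Matrix.isUnit_iff_isUnit_det _).2 (isUnit_iff_ne_zero.2 h))
  rw [← h1, hAB]
  exact (rank_mul_le_left A B).trans (rank_le_card_width A)

theorem trace_aeval_mul_eq_zero {Y : Matrix ι ι ℂ} {p : ℂ[X]} (hp : IsNilpotent (aeval Y p))
    (q : ℂ[X]) : (aeval Y (q * p)).trace = 0 := by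
  refine IsNilpotent.eq_zero (Matrix.isNilpotent_trace_of_isNilpotent ?_)
  rw [map_mul]
  refine Commute.isNilpotent_mul_left ?_ hp
  rw [Commute, SemiconjBy, ← map_mul, ← map_mul, mul_comm]

theorem trace_aeval_derivative_mul_eq_zero [Fintype κ] [DecidableEq κ] {g k : κ → ℂ[X]}
    {Y M : Matrix ι ι ℂ} {p q : ℂ[X]} (hp : IsNilpotent (aeval Y p))
    (hq : IsNilpotent (aeval Y q)) (hdet : (traceGram g k Y).det ≠ 0)
    (hev : ∀ᶠ ε in 𝓝 (0 : ℂ), (traceGram (Sum.elim g fun _ : Unit => p)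
      (Sum.elim k fun _ => q) (Y + ε • M)).det = 0) :
    (aeval Y (derivative (p * q)) * M).trace = 0 := by
  set G : ℂ → Matrix (κ ⊕ Unit) (κ ⊕ Unit) ℂ := fun ε => traceGram (Sum.elim g fun _ : Unit => p)
      (Sum.elim k fun _ => q) (Y + ε • M) with hG
  have hder : ∀ i j, HasDerivAt (fun ε => G ε i j) ((aeval Y (derivative
      ((Sum.elim g fun _ : Unit => p) i * (Sum.elim k fun _ => q) j)) * M).trace) 0 :=
    fun i j => hasDerivAt_trace_aeval Y M _
  have hcol : ∀ i, G 0 i (Sum.inr ()) = 0 := by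
    intro i
    simp only [hG, traceGram, of_apply, zero_smul, add_zero, Sum.elim_inr]
    exact trace_aeval_mul_eq_zero hq _
  have hrow : ∀ j, G 0 (Sum.inr ()) j = 0 := by
    intro j
    simp only [hG, traceGram, of_apply, zero_smul, add_zero, Sum.elim_inr]
    rw [mul_comm]
    exact trace_aeval_mul_eq_zero hp _
  set c : κ ⊕ Unit → ℂ := fun i => (aeval Y (derivative
      ((Sum.elim g fun _ : Unit => p) i * q)) * M).trace with hc
  have hlim : Tendsto (fun ε => (updateCol (G ε) (Sum.inr ())
      (ε⁻¹ • fun i => G ε i (Sum.inr ()))).det) (𝓝[≠] 0)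
      (𝓝 (updateCol (G 0) (Sum.inr ()) c).det) := by
    have hd : Continuous fun A : Matrix (κ ⊕ Unit) (κ ⊕ Unit) ℂ => A.det :=
      continuous_id.matrix_det
    refine (hd.tendsto _).comp ?_
    refine tendsto_pi_nhds.2 fun i => tendsto_pi_nhds.2 fun j => ?_
    simp only [updateCol_apply]
    split_ifs with hj
    · have := (hder i (Sum.inr ())).tendsto_slope
      refine this.congr fun ε => ?_
      simp [slope, hcol]
    · exact ((hder i j).continuousAt.tendsto).mono_left nhdsWithin_le_nhds
  have hzero : (updateCol (G 0) (Sum.inr ()) c).det = 0 := by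
    refine tendsto_nhds_unique hlim (tendsto_const_nhds.congr' ?_)
    filter_upwards [hev.filter_mono nhdsWithin_le_nhds] with ε hε
    rw [det_updateCol_smul, updateCol_eq_self]
    simp only [hG, hε, mul_zero]
  have hblock : updateCol (G 0) (Sum.inr ()) c = fromBlocks (traceGram g k Y)
      (Matrix.of fun i _ => c (Sum.inl i)) 0 (Matrix.of fun _ _ => c (Sum.inr ())) := by
    ext i j
    rcases j with j | j
    · rw [updateCol_ne (by simp)]
      rcases i with i | i
      · simp [hG, traceGram]
      · exact hrow _
    · rcases i with i | i
      · simp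
      · simp
  rw [hblock, det_fromBlocks_zero₂₁, mul_eq_zero] at hzero
  have := hzero.resolve_left hdet
  rw [det_unique] at this
  exact this

end TraceGram

section RegularDense

open Polynomial Matrix Filter Topology

variable {ι : Type*} [Fintype ι] [DecidableEq ι]

theorem trace_mul_cube_linear_coeff_eq_zero {A X Q : Matrix ι ι ℂ}
    (h : ∀ᶠ s in 𝓝 (0 : ℂ), (A * (X + s • Q) ^ 3).trace = 0) :
    (A * (Q * X * X + X * Q * X + X * X * Q)).trace = 0 := by
  set c₀ := (A * (X * X * X)).trace
  set c₁ := (A * (Q * X * X + X * Q * X + X * X * Q)).trace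
  set c₂ := (A * (Q * Q * X + Q * X * Q + X * Q * Q)).trace
  set c₃ := (A * (Q * Q * Q)).trace
  have hf : ∀ s : ℂ, (A * (X + s • Q) ^ 3).trace = c₀ + s * c₁ + s ^ 2 * c₂ + s ^ 3 * c₃ := by
    intro s
    have : A * (X + s • Q) ^ 3 = A * (X * X * X) + s • (A * (Q * X * X + X * Q * X + X * X * Q))
        + s ^ 2 • (A * (Q * Q * X + Q * X * Q + X * Q * Q)) + s ^ 3 • (A * (Q * Q * Q)) := by
      simp only [pow_succ, pow_zero, one_mul, mul_add, add_mul, smul_mul_assoc, mul_smul_comm,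
        smul_add, smul_smul, ← mul_assoc]
      abel
    rw [this]
    simp only [trace_add, trace_smul, smul_eq_mul]
    rfl
  have hd : HasDerivAt (fun s : ℂ => c₀ + s * c₁ + s ^ 2 * c₂ + s ^ 3 * c₃) c₁ 0 := by
    have h1 := ((hasDerivAt_id (0 : ℂ)).mul_const c₁).const_add c₀
    have h2 := (hasDerivAt_pow 2 (0 : ℂ)).mul_const c₂
    have h3 := (hasDerivAt_pow 3 (0 : ℂ)).mul_const c₃
    refine (((h1.add h2).add h3).congr_deriv ?_ :)
    simp
  have h0 : HasDerivAt (fun s : ℂ => c₀ + s * c₁ + s ^ 2 * c₂ + s ^ 3 * c₃) 0 0 := by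
    refine (hasDerivAt_const (0 : ℂ) (0 : ℂ)).congr_of_eventuallyEq ?_
    filter_upwards [h] with s hs
    rw [← hf, hs]
  exact hd.unique h0

theorem trace_sq_mul_of_vecMulVec {P N : Matrix ι ι ℂ} {v w : ι → ℂ}
    (hN : N = vecMulVec v w) :
    (P * N * P * (P * N * P)).trace = (P * N * P).trace ^ 2 := by
  have h : P * N * P = vecMulVec (P *ᵥ v) (w ᵥ* P) := by
    rw [hN, mul_vecMulVec, vecMulVec_mul]
  rw [h, vecMulVec_mul_vecMulVec, trace_vecMulVec]
  simp only [trace_vecMulVec, pow_two]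
  rw [dotProduct_comm (w ᵥ* P), dotProduct_smul, smul_eq_mul]

theorem rootMultiplicity_le_one_of_trace_eq_zero {X Y : Matrix ι ι ℂ} {v w : ι → ℂ}
    (h : Y * X - X * Y + 1 = vecMulVec v w)
    (H : ∀ p q : ℂ[X], IsNilpotent (aeval Y p) → IsNilpotent (aeval Y q) → ∀ (s : ℂ[X]) (d : ℕ),
      ∀ᶠ σ in 𝓝 (0 : ℂ), (aeval Y (derivative (p * q)) * (X + σ • aeval Y s) ^ d).trace = 0)
    (c : ℂ) : Y.charpoly.rootMultiplicity c ≤ 1 := by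
  obtain ⟨e, hPP, hde, hnil, htr⟩ := Y.exists_spectral_idempotent c
  set P := aeval Y e with hP
  obtain ⟨g, hg⟩ : ∃ g : ℂ[X], g = (Polynomial.X - C c) * e := ⟨_, rfl⟩
  rw [← hg] at hnil
  set W := aeval Y g with hW
  have hWY : W = (Y - c • 1) * P := by
    rw [hW, hg, Polynomial.aeval_mul, map_sub, aeval_X, aeval_C, Algebra.algebraMap_eq_smul_one]
  have hPY : P * Y = Y * P := by
    have : aeval Y (e * Polynomial.X) = aeval Y (Polynomial.X * e) := by rw [mul_comm]
    simpa only [Polynomial.aeval_mul, aeval_X] using this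
  have hWP : W * P = W := by rw [hWY, mul_assoc, hPP]
  have hPW : P * W = W := by
    rw [← hWP]
    have : aeval Y (e * (g * e)) = aeval Y (g * e * e) := by congr 1; ring
    simp only [Polynomial.aeval_mul] at this
    rw [← hP, ← hW] at this
    rw [this, mul_assoc, hPP]
  have hdg : aeval Y (derivative g) = P := by
    rw [hg, derivative_mul, map_add, map_mul (aeval Y) _ (derivative e), hde, mul_zero, add_zero]
    simp [hP]
  have hA1 : aeval Y (derivative (g * g)) = 2 * W := by
    rw [derivative_mul, map_add, Polynomial.aeval_mul, Polynomial.aeval_mul, hdg, ← hW, hPW, hWP,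
      two_mul]
  have hA2 : aeval Y (derivative (g * (g * g))) = 3 * (W * W) := by
    rw [derivative_mul, map_add, Polynomial.aeval_mul, Polynomial.aeval_mul (p := g) (q := derivative (g * g)),
      hA1, hdg, Polynomial.aeval_mul, ← hW, ← mul_assoc, hPW]
    noncomm_ring
  have hnil2 : IsNilpotent (aeval Y (g * g)) := by
    rw [Polynomial.aeval_mul]
    exact Commute.isNilpotent_mul_left (Commute.refl _) hnil
  have H1 : ∀ (s : ℂ[X]) (d : ℕ),
      ∀ᶠ σ in 𝓝 (0 : ℂ), (W * (X + σ • aeval Y s) ^ d).trace = 0 := by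
    intro s d
    filter_upwards [H g g hnil hnil s d] with σ hσ
    rw [hA1, two_mul, add_mul, trace_add] at hσ
    linear_combination hσ / 2
  have H2 : ∀ (s : ℂ[X]) (d : ℕ),
      ∀ᶠ σ in 𝓝 (0 : ℂ), (W * W * (X + σ • aeval Y s) ^ d).trace = 0 := by
    intro s d
    filter_upwards [H g (g * g) hnil hnil2 s d] with σ hσ
    rw [hA2, show (3 : Matrix ι ι ℂ) * (W * W) = W * W + W * W + W * W by noncomm_ring, add_mul,
      add_mul, trace_add, trace_add] at hσ
    linear_combination hσ / 3
  have t1 : (W * W * X * X).trace = 0 := by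
    have := (H2 0 2).self_of_nhds
    simpa [pow_two, mul_assoc] using this
  have t2 : (W * X * W * X).trace = 0 := by
    have := trace_mul_cube_linear_coeff_eq_zero (H1 g 3)
    rw [← hW] at this
    have e1 : W * (W * X * X + X * W * X + X * X * W) =
      W * W * X * X + W * X * W * X + W * X * X * W := by noncomm_ring
    have e2 : (W * X * X * W).trace = (W * W * X * X).trace := by
      rw [trace_mul_comm]; simp only [mul_assoc]
    rw [e1, trace_add, trace_add, e2, t1] at this
    simpa using this
  have t3 : (W * W * X * P * X).trace = 0 := by
    have := trace_mul_cube_linear_coeff_eq_zero (H2 e 3)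
    rw [← hP] at this
    have e1 : W * W * (P * X * X + X * P * X + X * X * P) =
      W * (W * P) * X * X + W * W * X * P * X + W * W * X * X * P := by noncomm_ring
    have e2 : (W * W * X * X * P).trace = (W * W * X * X).trace := by
      rw [trace_mul_comm]
      simp only [← mul_assoc, hPW]
    rw [e1, hWP, trace_add, trace_add, e2, t1] at this
    simpa using this
  set N := vecMulVec v w with hN
  set K := W * X * P - P * X * W with hK
  have hB : P * N * P = K + P := by
    rw [← h, hK, hWY]
    have e1 : (Y - c • 1) * P * X * P - P * X * ((Y - c • 1) * P) =
        Y * P * X * P - P * X * Y * P := by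
      simp only [sub_mul, mul_sub, smul_mul_assoc, one_mul, mul_smul_comm, mul_assoc]
      abel
    rw [e1, ← hPY]
    have e2 : P * (Y * X - X * Y + 1) * P = P * Y * X * P - P * X * Y * P + P * P := by
      noncomm_ring
    rw [e2, hPP]
  have hKt : K.trace = 0 := by
    have e1 : (W * X * P).trace = (W * X).trace := by
      rw [trace_mul_comm, ← mul_assoc, hPW]
    have e2 : (P * X * W).trace = (W * X).trace := by
      rw [trace_mul_comm, ← mul_assoc, hWP]
    rw [hK, trace_sub, e1, e2, sub_self]
  have hKP : K * P = K := by
    rw [hK, sub_mul, mul_assoc _ P P, hPP, mul_assoc _ W P, hWP]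
  have hPK : P * K = K := by
    rw [hK, mul_sub, ← mul_assoc, ← mul_assoc, hPW, ← mul_assoc, ← mul_assoc, hPP]
  have hKK : (K * K).trace = 0 := by
    have e0 : K * K = W * X * (P * W) * X * P - W * X * (P * P) * X * W - P * X * (W * W) * X * P
        + P * X * (W * P) * X * W := by
      rw [hK]; noncomm_ring
    rw [hPP, hPW, hWP] at e0
    have e1 : (W * X * W * X * P).trace = 0 := by
      rw [trace_mul_comm, ← t2]
      simp only [← mul_assoc, hPW]
    have e2 : (W * X * P * X * W).trace = 0 := by
      rw [trace_mul_comm, ← t3]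
      simp only [← mul_assoc]
    have e3 : (P * X * (W * W) * X * P).trace = 0 := by
      rw [trace_mul_comm, ← t3, mul_assoc (P * X), ← mul_assoc, trace_mul_comm]
      simp only [← mul_assoc, hPP]
    have e4 : (P * X * W * X * W).trace = 0 := by
      rw [trace_mul_comm, ← t2]
      simp only [← mul_assoc, hWP]
    rw [e0, trace_add, trace_sub, trace_sub, e1, e2, e3, e4]
    simp
  have hfin := trace_sq_mul_of_vecMulVec (P := P) hN
  have e5 : (K + P) * (K + P) = K * K + K + K + P := by
    rw [add_mul, mul_add, mul_add, hKP, hPK, hPP]; abel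
  rw [hB, e5] at hfin
  simp only [trace_add, hKK, hKt, zero_add, htr] at hfin
  have hm : Y.charpoly.rootMultiplicity c = Y.charpoly.rootMultiplicity c ^ 2 := by
    exact_mod_cast hfin
  generalize Y.charpoly.rootMultiplicity c = m at hm
  by_contra hlt
  nlinarith

theorem exists_injective_isRoot_charpoly {Y : Matrix ι ι ℂ}
    (h : ∀ c, Y.charpoly.rootMultiplicity c ≤ 1) :
    ∃ z : ι → ℂ, Function.Injective z ∧ ∀ i, Y.charpoly.IsRoot (z i) := by
  have hnd : Y.charpoly.roots.Nodup :=
    Multiset.nodup_iff_count_le_one.2 fun c => by rw [count_roots]; exact h c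
  have hcard : Fintype.card ι = Fintype.card Y.charpoly.roots.toFinset := by
    rw [Fintype.card_coe, Multiset.toFinset_card_of_nodup hnd,
      IsAlgClosed.card_roots_eq_natDegree, charpoly_natDegree_eq_dim]
  let e := Fintype.equivOfCardEq hcard
  refine ⟨fun i => e i, Subtype.val_injective.comp e.injective, fun i => ?_⟩
  have := (e i).2
  rw [Multiset.mem_toFinset] at this
  exact isRoot_of_mem_roots this

theorem exists_regular_mem_of_isOpen {U : Set (Matrix ι ι ℂ × Matrix ι ι ℂ)} (hU : IsOpen U)
    {X Y : Matrix ι ι ℂ} {v w : ι → ℂ} (hXY : (X, Y) ∈ U)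
    (h : Y * X - X * Y + 1 = vecMulVec v w) :
    ∃ X' Y' : Matrix ι ι ℂ, (X', Y') ∈ U ∧ Y' * X' - X' * Y' + 1 = vecMulVec v w ∧
      ∃ z : ι → ℂ, Function.Injective z ∧ ∀ i, Y'.charpoly.IsRoot (z i) := by
  let Q : ℕ → Prop := fun r => ∃ X Y : Matrix ι ι ℂ, (X, Y) ∈ U ∧
    Y * X - X * Y + 1 = vecMulVec v w ∧ ∃ g k : Fin r → ℂ[X], (traceGram g k Y).det ≠ 0
  have hQ0 : Q 0 := ⟨X, Y, hXY, h, Fin.elim0, Fin.elim0, by simp⟩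
  obtain ⟨r, hr, hr'⟩ : ∃ r, Q r ∧ ¬ Q (r + 1) := by
    by_contra! hcon
    have hall : ∀ r, Q r := fun r => Nat.rec hQ0 hcon r
    obtain ⟨_, _, _, _, g, k, hd⟩ := hall (Fintype.card (ι × ι) + 1)
    have := card_le_of_det_traceGram_ne_zero hd
    rw [Fintype.card_fin] at this
    omega
  obtain ⟨X, Y, hXY, h, g, k, hd⟩ := hr
  refine ⟨X, Y, hXY, h, exists_injective_isRoot_charpoly
    (rootMultiplicity_le_one_of_trace_eq_zero h fun p q hp hq s d => ?_)⟩
  have hc1 : Continuous fun σ : ℂ => (X + σ • aeval Y s, Y) := by fun_prop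
  have h1 : ∀ᶠ σ in 𝓝 (0 : ℂ), (X + σ • aeval Y s, Y) ∈ U :=
    hc1.continuousAt.eventually_mem (hU.mem_nhds (by simpa using hXY))
  filter_upwards [h1] with σ hσ
  refine trace_aeval_derivative_mul_eq_zero hp hq hd ?_
  set X' := X + σ • aeval Y s with hX'
  have hc2 : Continuous fun ε : ℂ => (X', Y + ε • X' ^ d) := by fun_prop
  have h2 : ∀ᶠ ε in 𝓝 (0 : ℂ), (X', Y + ε • X' ^ d) ∈ U :=
    hc2.continuousAt.eventually_mem (hU.mem_nhds (by simpa using hσ))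
  filter_upwards [h2] with ε hε
  by_contra hne
  let e : Fin (r + 1) ≃ Fin r ⊕ Unit := (Fintype.equivFinOfCardEq (by simp)).symm
  refine hr' ⟨X', Y + ε • X' ^ d, hε, ?_, (Sum.elim g fun _ : Unit => p) ∘ e,
    (Sum.elim k fun _ : Unit => q) ∘ e, ?_⟩
  · have c1 : Y * aeval Y s = aeval Y s * Y := by
      have : aeval Y (Polynomial.X * s) = aeval Y (s * Polynomial.X) := by rw [mul_comm]
      simpa only [map_mul, aeval_X] using this
    have c2 : X' ^ d * X' = X' * X' ^ d := (Commute.refl X').pow_left d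
    rw [add_mul, mul_add X' Y, smul_mul_assoc, mul_smul_comm, c2, add_sub_add_right_eq_sub, ← h,
      hX', mul_add, add_mul, mul_smul_comm, smul_mul_assoc, c1, add_sub_add_right_eq_sub]
  · have : traceGram ((Sum.elim g fun _ : Unit => p) ∘ e) ((Sum.elim k fun _ : Unit => q) ∘ e)
        (Y + ε • X' ^ d) = (traceGram (Sum.elim g fun _ : Unit => p)
        (Sum.elim k fun _ : Unit => q) (Y + ε • X' ^ d)).submatrix e e := rfl
    rw [this, det_submatrix_equiv_self]
    exact hne

end RegularDense

section ClosureOfRegular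

open Polynomial Matrix Filter Topology

variable {ι : Type*} [Fintype ι] [DecidableEq ι]

theorem norm_le_of_isRoot_charpoly {A : Matrix ι ι ℂ} {z : ℂ} (h : A.charpoly.IsRoot z) :
    ‖z‖ ≤ ∑ k, ∑ j, ‖A k j‖ := by
  have hz : Module.End.HasEigenvalue (Matrix.toLin' A) z := by
    rw [Module.End.hasEigenvalue_iff_isRoot_charpoly, Matrix.charpoly_toLin']
    exact h
  obtain ⟨k, hk⟩ := eigenvalue_mem_ball hz
  rw [mem_closedBall_iff_norm] at hk
  calc ‖z‖ ≤ ‖A k k‖ + ‖z - A k k‖ := by simpa using norm_add_le (A k k) (z - A k k)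
    _ ≤ ‖A k k‖ + ∑ j ∈ univ.erase k, ‖A k j‖ := by gcongr
    _ = ∑ j, ‖A k j‖ := Finset.add_sum_erase _ (fun j => ‖A k j‖) (Finset.mem_univ k)
    _ ≤ _ := Finset.single_le_sum (f := fun k => ∑ j, ‖A k j‖)
      (fun _ _ => Finset.sum_nonneg fun _ _ => norm_nonneg _) (Finset.mem_univ k)

theorem im_eq_zero_of_isHermitian_of_det_eq_zero {A : Matrix ι ι ℂ} (hA : A.IsHermitian) {c : ℂ}
    (h : (A - c • (1 : Matrix ι ι ℂ)).det = 0) : c.im = 0 := by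
  obtain ⟨x, hx, hxA⟩ := exists_mulVec_eq_zero_iff.2 h
  rw [sub_mulVec, sub_eq_zero, smul_mulVec, one_mulVec] at hxA
  have h1 : star x ⬝ᵥ (A *ᵥ x) = c * (star x ⬝ᵥ x) := by rw [hxA, dotProduct_smul, smul_eq_mul]
  have h2 : star (star x ⬝ᵥ (A *ᵥ x)) = star x ⬝ᵥ (A *ᵥ x) := by
    rw [← star_dotProduct, star_mulVec, hA.eq, dotProduct_mulVec]
  have h3 : star (star x ⬝ᵥ x) = star x ⬝ᵥ x := (star_dotProduct x x).symm
  have h4 : star x ⬝ᵥ x ≠ 0 := fun h0 => hx (by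
    open ComplexOrder in exact dotProduct_star_self_eq_zero.1 h0)
  rw [h1, star_mul', h3] at h2
  exact Complex.conj_eq_iff_im.1 (mul_right_cancel₀ h4 h2)

theorem exists_tendsto_of_isRoot_charpoly {α : Type*} {l : Ultrafilter α} {A : α → Matrix ι ι ℂ}
    {A₀ : Matrix ι ι ℂ} (hA : Tendsto A l (𝓝 A₀)) {z : α → ι → ℂ}
    (hz : ∀ᶠ a in (l : Filter α), ∀ i, (A a).charpoly.IsRoot (z a i)) :
    ∃ z₀ : ι → ℂ, Tendsto z l (𝓝 z₀) ∧ ∀ i, A₀.charpoly.IsRoot (z₀ i) := by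
  have hB : Continuous fun M : Matrix ι ι ℂ => ∑ k, ∑ j, ‖M k j‖ := by fun_prop
  set R := (∑ k, ∑ j, ‖A₀ k j‖) + 1 with hR
  have hev : ∀ᶠ a in (l : Filter α), z a ∈ Metric.closedBall (0 : ι → ℂ) R := by
    have h1 := ((hB.tendsto A₀).comp hA).eventually_lt_const (show _ < R from lt_add_one _)
    filter_upwards [hz, h1] with a ha hlt
    rw [mem_closedBall_zero_iff, pi_norm_le_iff_of_nonneg (by positivity)]
    exact fun i => (norm_le_of_isRoot_charpoly (ha i)).trans hlt.le
  obtain ⟨z₀, -, hz₀⟩ := (isCompact_closedBall (0 : ι → ℂ) R).ultrafilter_le_nhds' (l.map z) hev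
  refine ⟨z₀, hz₀, fun i => ?_⟩
  have hc : Continuous fun p : Matrix ι ι ℂ × (ι → ℂ) => (scalar ι (p.2 i) - p.1).det := by
    simp only [scalar_apply]
    fun_prop
  have h2 := (hc.tendsto (A₀, z₀)).comp (hA.prodMk_nhds hz₀)
  have h3 : Tendsto (fun _ : α => (0 : ℂ)) l (𝓝 (scalar ι (z₀ i) - A₀).det) := by
    refine h2.congr' ?_
    filter_upwards [hz] with a ha
    have := ha i
    rwa [IsRoot, eval_charpoly] at this
  rw [IsRoot, eval_charpoly]
  exact tendsto_nhds_unique h3 tendsto_const_nhds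

theorem tendsto_inv_of_det_ne_zero {α : Type*} {l : Filter α} {A : α → Matrix ι ι ℂ}
    {A₀ : Matrix ι ι ℂ} (hA : Tendsto A l (𝓝 A₀)) (h : A₀.det ≠ 0) :
    Tendsto (fun a => (A a)⁻¹) l (𝓝 A₀⁻¹) := by
  simp only [Matrix.inv_def, Ring.inverse_eq_inv']
  have h1 : Continuous fun M : Matrix ι ι ℂ => M.det := by fun_prop
  have h2 : Continuous fun M : Matrix ι ι ℂ => M.adjugate := by fun_prop
  exact (((h1.tendsto A₀).comp hA).inv₀ h).smul ((h2.tendsto A₀).comp hA)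

theorem exists_det_baxterMatrix_inv_eq_zero_of_injective {X Y : Matrix ι ι ℂ} {v w : ι → ℂ}
    (h : Y * X - X * Y + 1 = vecMulVec v w) {z : ι → ℂ} (hz : Function.Injective z)
    (hY : ∀ i, Y.charpoly.IsRoot (z i)) :
    ∃ μ : ι → ℂ, (∀ i, X.charpoly.IsRoot (μ i)) ∧
      ∀ t u, ¬ Y.charpoly.IsRoot t → ¬ X.charpoly.IsRoot u →
        (baxterMatrix (fun i => (t - z i)⁻¹) (fun i => (u - μ i)⁻¹) -
          (1 + w ⬝ᵥ ((scalar ι t - Y)⁻¹ *ᵥ ((scalar ι u - X)⁻¹ *ᵥ v))) •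
            (1 : Matrix (Equiv.Perm ι) (Equiv.Perm ι) ℂ)).det = 0 := by
  have hinv : ∀ (A : Matrix ι ι ℂ) (s : ℂ) (x : ι → ℂ), ¬ A.charpoly.IsRoot s →
      (scalar ι s - A) *ᵥ ((scalar ι s - A)⁻¹ *ᵥ x) = x := by
    intro A s x hs
    rw [IsRoot, eval_charpoly] at hs
    rw [mulVec_mulVec, mul_nonsing_inv _ (isUnit_iff_ne_zero.2 hs), one_mulVec]
  obtain ⟨μ, hμ, H⟩ := exists_det_baxterMatrix_eq_zero h hz hY
  exact ⟨μ, hμ, fun t u ht hu => H t u _ _ ht hu (hinv X u v hu) (hinv Y t _ ht)⟩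

theorem continuous_det_baxterMatrix_sub :
    Continuous fun q : (ι → ℂ) × (ι → ℂ) × ℂ =>
      (baxterMatrix q.1 q.2.1 - (1 + q.2.2) •
        (1 : Matrix (Equiv.Perm ι) (Equiv.Perm ι) ℂ)).det := by
  have : Continuous fun q : (ι → ℂ) × (ι → ℂ) × ℂ => baxterMatrix q.1 q.2.1 := by
    refine continuous_matrix fun a b => ?_
    simp only [baxterMatrix, of_apply]
    refine continuous_finsetSum _ fun T _ => ?_
    split_ifs <;> fun_prop
  exact Continuous.matrix_det (this.sub
    ((continuous_const.add (continuous_snd.comp continuous_snd)).smul continuous_const))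

theorem det_baxterMatrix_inv_eq_zero_of_tendsto {α : Type*} {l : Filter α} [l.NeBot]
    {X Y : α → Matrix ι ι ℂ} {X₀ Y₀ : Matrix ι ι ℂ} {z μ : α → ι → ℂ} {z₀ μ₀ v w : ι → ℂ}
    (hX : Tendsto X l (𝓝 X₀)) (hY : Tendsto Y l (𝓝 Y₀)) (hz : Tendsto z l (𝓝 z₀))
    (hμ : Tendsto μ l (𝓝 μ₀)) (hYz : ∀ i, Y₀.charpoly.IsRoot (z₀ i))
    (hXμ : ∀ i, X₀.charpoly.IsRoot (μ₀ i)) {t u : ℂ} (ht : ¬ Y₀.charpoly.IsRoot t)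
    (hu : ¬ X₀.charpoly.IsRoot u)
    (H : ∀ᶠ a in l, ¬ (Y a).charpoly.IsRoot t → ¬ (X a).charpoly.IsRoot u →
      (baxterMatrix (fun i => (t - z a i)⁻¹) (fun i => (u - μ a i)⁻¹) -
          (1 + w ⬝ᵥ ((scalar ι t - Y a)⁻¹ *ᵥ ((scalar ι u - X a)⁻¹ *ᵥ v))) •
            (1 : Matrix (Equiv.Perm ι) (Equiv.Perm ι) ℂ)).det = 0) :
    (baxterMatrix (fun i => (t - z₀ i)⁻¹) (fun i => (u - μ₀ i)⁻¹) -
          (1 + w ⬝ᵥ ((scalar ι t - Y₀)⁻¹ *ᵥ ((scalar ι u - X₀)⁻¹ *ᵥ v))) •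
            (1 : Matrix (Equiv.Perm ι) (Equiv.Perm ι) ℂ)).det = 0 := by
  have hty : Tendsto (fun a => scalar ι t - Y a) l (𝓝 (scalar ι t - Y₀)) :=
    tendsto_const_nhds.sub hY
  have hux : Tendsto (fun a => scalar ι u - X a) l (𝓝 (scalar ι u - X₀)) :=
    tendsto_const_nhds.sub hX
  have htd : (scalar ι t - Y₀).det ≠ 0 := by rwa [IsRoot, eval_charpoly] at ht
  have hud : (scalar ι u - X₀).det ≠ 0 := by rwa [IsRoot, eval_charpoly] at hu
  have hdc : Continuous fun M : Matrix ι ι ℂ => M.det := by fun_prop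
  have hne : ∀ᶠ a in l, ¬ (Y a).charpoly.IsRoot t ∧ ¬ (X a).charpoly.IsRoot u := by
    filter_upwards [((hdc.tendsto _).comp hty).eventually_ne htd,
      ((hdc.tendsto _).comp hux).eventually_ne hud] with a h1 h2
    simp only [IsRoot, eval_charpoly]
    exact ⟨h1, h2⟩
  have hmv : Continuous fun q : Matrix ι ι ℂ × Matrix ι ι ℂ =>
      w ⬝ᵥ (q.2 *ᵥ (q.1 *ᵥ v)) := by fun_prop
  have hf : Tendsto (fun a => w ⬝ᵥ ((scalar ι t - Y a)⁻¹ *ᵥ ((scalar ι u - X a)⁻¹ *ᵥ v))) l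
      (𝓝 (w ⬝ᵥ ((scalar ι t - Y₀)⁻¹ *ᵥ ((scalar ι u - X₀)⁻¹ *ᵥ v)))) := by
    have h2 := (tendsto_inv_of_det_ne_zero hux hud).prodMk_nhds
      (tendsto_inv_of_det_ne_zero hty htd)
    have h3 := (hmv.tendsto _).comp h2
    exact h3
  have hres : ∀ {y : α → ι → ℂ} {y₀ : ι → ℂ} {s : ℂ},
      Tendsto y l (𝓝 y₀) → (∀ i, s ≠ y₀ i) →
      Tendsto (fun a i => (s - y a i)⁻¹) l (𝓝 fun i => (s - y₀ i)⁻¹) := by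
    intro y y₀ s hy hs
    rw [tendsto_pi_nhds] at hy ⊢
    exact fun i => (tendsto_const_nhds.sub (hy i)).inv₀ (sub_ne_zero.2 (hs i))
  have hzt := hres (s := t) hz fun i hi => ht (by rw [hi]; exact hYz i)
  have hμu := hres (s := u) hμ fun i hi => hu (by rw [hi]; exact hXμ i)
  have hlim := (continuous_det_baxterMatrix_sub.tendsto _).comp
    (hzt.prodMk_nhds (hμu.prodMk_nhds hf))
  refine tendsto_nhds_unique (hlim.congr' ?_) tendsto_const_nhds
  filter_upwards [H, hne] with p hp hpn
  exact hp hpn.1 hpn.2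

theorem exists_det_baxterMatrix_inv_eq_zero {X Y : Matrix ι ι ℂ} {v w : ι → ℂ}
    (h : Y * X - X * Y + 1 = vecMulVec v w) :
    ∃ z μ : ι → ℂ, (∀ i, Y.charpoly.IsRoot (z i)) ∧ (∀ i, X.charpoly.IsRoot (μ i)) ∧
      ∀ t u, ¬ Y.charpoly.IsRoot t → ¬ X.charpoly.IsRoot u →
        (baxterMatrix (fun i => (t - z i)⁻¹) (fun i => (u - μ i)⁻¹) -
          (1 + w ⬝ᵥ ((scalar ι t - Y)⁻¹ *ᵥ ((scalar ι u - X)⁻¹ *ᵥ v))) •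
            (1 : Matrix (Equiv.Perm ι) (Equiv.Perm ι) ℂ)).det = 0 := by
  let S : Set (Matrix ι ι ℂ × Matrix ι ι ℂ) := {p | p.2 * p.1 - p.1 * p.2 + 1 = vecMulVec v w ∧
      ∃ z : ι → ℂ, Function.Injective z ∧ ∀ i, p.2.charpoly.IsRoot (z i)}
  have hmem : (X, Y) ∈ closure S := by
    rw [mem_closure_iff]
    intro U hU hXY
    obtain ⟨X', Y', hU', h', hz⟩ := exists_regular_mem_of_isOpen hU hXY h
    exact ⟨(X', Y'), hU', h', hz⟩
  obtain ⟨l, hlS, hl⟩ := mem_closure_iff_ultrafilter.1 hmem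
  have key : ∀ p : Matrix ι ι ℂ × Matrix ι ι ℂ, ∃ z μ : ι → ℂ, p ∈ S →
      (∀ i, p.2.charpoly.IsRoot (z i)) ∧ (∀ i, p.1.charpoly.IsRoot (μ i)) ∧
      ∀ t u, ¬ p.2.charpoly.IsRoot t → ¬ p.1.charpoly.IsRoot u →
        (baxterMatrix (fun i => (t - z i)⁻¹) (fun i => (u - μ i)⁻¹) -
          (1 + w ⬝ᵥ ((scalar ι t - p.2)⁻¹ *ᵥ ((scalar ι u - p.1)⁻¹ *ᵥ v))) •
            (1 : Matrix (Equiv.Perm ι) (Equiv.Perm ι) ℂ)).det = 0 := by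
    intro p
    by_cases hp : p ∈ S
    · obtain ⟨hp, z, hz, hYz⟩ := hp
      obtain ⟨μ, hμ, H⟩ := exists_det_baxterMatrix_inv_eq_zero_of_injective hp hz hYz
      exact ⟨z, μ, fun _ => ⟨hYz, hμ, H⟩⟩
    · exact ⟨0, 0, fun h => absurd h hp⟩
  choose z μ hzμ using key
  have hX : Tendsto (fun p : Matrix ι ι ℂ × Matrix ι ι ℂ => p.1) l (𝓝 X) :=
    (continuous_fst.tendsto (X, Y)).mono_left hl
  have hY : Tendsto (fun p : Matrix ι ι ℂ × Matrix ι ι ℂ => p.2) l (𝓝 Y) :=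
    (continuous_snd.tendsto (X, Y)).mono_left hl
  have hS : ∀ᶠ p in (l : Filter _), p ∈ S := hlS
  obtain ⟨z₀, hz₀, hYz⟩ := exists_tendsto_of_isRoot_charpoly hY (z := z)
    (hS.mono fun p hp => (hzμ p hp).1)
  obtain ⟨μ₀, hμ₀, hXμ⟩ := exists_tendsto_of_isRoot_charpoly hX (z := μ)
    (hS.mono fun p hp => (hzμ p hp).2.1)
  refine ⟨z₀, μ₀, hYz, hXμ, fun t u ht hu => ?_⟩
  exact det_baxterMatrix_inv_eq_zero_of_tendsto hX hY hz₀ hμ₀ hYz hXμ ht hu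
    (hS.mono fun p hp => (hzμ p hp).2.2 t u)

theorem im_dotProduct_inv_mulVec_inv_eq_zero {X Y : Matrix ι ι ℂ} {v w : ι → ℂ}
    (h : Y * X - X * Y + 1 = vecMulVec v w) (hX : ∀ z, X.charpoly.IsRoot z → z.im = 0)
    (hY : ∀ z, Y.charpoly.IsRoot z → z.im = 0) {t u : ℝ} (ht : ¬ Y.charpoly.IsRoot t)
    (hu : ¬ X.charpoly.IsRoot u) :
    (w ⬝ᵥ ((scalar ι (t : ℂ) - Y)⁻¹ *ᵥ ((scalar ι (u : ℂ) - X)⁻¹ *ᵥ v))).im = 0 := by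
  obtain ⟨z, μ, hz, hμ, H⟩ := exists_det_baxterMatrix_inv_eq_zero h
  have hF := baxterMatrix_isHermitian (fun i => ((t : ℂ) - z i)⁻¹) (fun i => ((u : ℂ) - μ i)⁻¹)
    (fun i => by
      have : star (z i) = z i := Complex.conj_eq_iff_im.2 (hY _ (hz i))
      rw [star_inv₀, star_sub, this]
      simp)
    (fun i => by
      have : star (μ i) = μ i := Complex.conj_eq_iff_im.2 (hX _ (hμ i))
      rw [star_inv₀, star_sub, this]
      simp)
  have := H t u ht hu
  set f := w ⬝ᵥ ((scalar ι (t : ℂ) - Y)⁻¹ *ᵥ ((scalar ι (u : ℂ) - X)⁻¹ *ᵥ v))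
  have hr := im_eq_zero_of_isHermitian_of_det_eq_zero hF this
  simpa using hr

end ClosureOfRegular

section RealForm

open Polynomial Matrix Filter Topology

variable {ι : Type*} [Fintype ι] [DecidableEq ι]

theorem tendsto_smul_inv_scalar_sub (A : Matrix ι ι ℂ) :
    Tendsto (fun t : ℝ => (t : ℂ) • (scalar ι (t : ℂ) - A)⁻¹) atTop (𝓝 1) := by
  have h0 : Tendsto (fun t : ℝ => ((t⁻¹ : ℝ) : ℂ)) atTop (𝓝 0) := by
    exact (Complex.continuous_ofReal.tendsto' 0 0 Complex.ofReal_zero).comp tendsto_inv_atTop_zero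
  have h1 : Tendsto (fun t : ℝ => 1 - ((t⁻¹ : ℝ) : ℂ) • A) atTop (𝓝 1) := by
    have := (tendsto_const_nhds (x := (1 : Matrix ι ι ℂ))).sub (h0.smul_const A)
    simpa using this
  have h2 := tendsto_inv_of_det_ne_zero h1 (by simp)
  rw [inv_one] at h2
  refine h2.congr' ?_
  have hdc : Continuous fun M : Matrix ι ι ℂ => M.det := by fun_prop
  filter_upwards [eventually_gt_atTop 0,
    ((hdc.tendsto _).comp h1).eventually_ne (b₂ := 0) (by simp)] with t ht hd
  have ht' : (t : ℂ) ≠ 0 := by exact_mod_cast ht.ne'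
  have hA : scalar ι (t : ℂ) - A = (t : ℂ) • (1 - ((t⁻¹ : ℝ) : ℂ) • A) := by
    rw [smul_sub, smul_smul]
    push_cast
    rw [mul_inv_cancel₀ ht', one_smul, scalar_apply, smul_one_eq_diagonal]
  have hd' : IsUnit (scalar ι (t : ℂ) - A).det := by
    rw [hA, det_smul]
    exact (mul_ne_zero (pow_ne_zero _ ht') hd).isUnit
  refine inv_eq_right_inv ?_
  rw [mul_smul_comm, ← smul_mul_assoc, ← hA, mul_nonsing_inv _ hd']

theorem im_map_pow_eq_zero_of_resolvent {A : Matrix ι ι ℂ} (φ : Matrix ι ι ℂ →ₗ[ℂ] ℂ)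
    (h : ∀ t : ℝ, ¬ A.charpoly.IsRoot (t : ℂ) → (φ (scalar ι (t : ℂ) - A)⁻¹).im = 0) (b : ℕ) :
    (φ (A ^ b)).im = 0 := by
  have hφ : Continuous φ := φ.continuous_of_finiteDimensional
  have hroot : ∀ᶠ t : ℝ in atTop, ¬ A.charpoly.IsRoot (t : ℂ) := by
    filter_upwards [eventually_gt_atTop (∑ k, ∑ j, ‖A k j‖)] with t ht hr
    have := norm_le_of_isRoot_charpoly hr
    rw [Complex.norm_real] at this
    exact absurd ((le_abs_self t).trans this) (not_le.2 ht)
  have hlim : ∀ b : ℕ, (∀ t : ℝ, ¬ A.charpoly.IsRoot (t : ℂ) →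
      (φ ((scalar ι (t : ℂ) - A)⁻¹ * A ^ b)).im = 0) → (φ (A ^ b)).im = 0 := by
    intro b hb
    have hc : Continuous fun M : Matrix ι ι ℂ => (φ (M * A ^ b)).im :=
      Complex.continuous_im.comp (hφ.comp (by fun_prop))
    have h1 := (hc.tendsto 1).comp (tendsto_smul_inv_scalar_sub A)
    rw [one_mul] at h1
    refine tendsto_nhds_unique (h1.congr' ?_) tendsto_const_nhds
    filter_upwards [hroot] with t ht
    have := hb t ht
    simp only [Function.comp_apply, smul_mul_assoc, map_smul, smul_eq_mul, Complex.im_ofReal_mul, this,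
      mul_zero]
  refine hlim b ?_
  induction b with
  | zero => simpa using h
  | succ b ih =>
    intro t ht
    have hd : IsUnit (scalar ι (t : ℂ) - A).det := by
      rw [IsRoot, eval_charpoly] at ht
      exact isUnit_iff_ne_zero.2 ht
    have e : (scalar ι (t : ℂ) - A)⁻¹ * A ^ (b + 1) =
        (t : ℂ) • ((scalar ι (t : ℂ) - A)⁻¹ * A ^ b) - A ^ b := by
      have h1 : (scalar ι (t : ℂ) - A)⁻¹ * ((scalar ι (t : ℂ) - A) * A ^ b) = A ^ b := by
        rw [← mul_assoc, nonsing_inv_mul _ hd, one_mul]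
      have h2 : scalar ι (t : ℂ) = (t : ℂ) • 1 := by
        rw [scalar_apply, smul_one_eq_diagonal]
      nth_rw 2 [h2] at h1
      rw [sub_mul, smul_mul_assoc, one_mul, mul_sub, mul_smul_comm] at h1
      rw [pow_succ', eq_sub_iff_add_eq', ← eq_sub_iff_add_eq]
      exact h1.symm
    rw [e, map_sub, map_smul, Complex.sub_im, smul_eq_mul, Complex.im_ofReal_mul, ih t ht,
      hlim b ih]
    simp

theorem im_dotProduct_pow_mulVec_eq_zero {X Y : Matrix ι ι ℂ} {v w : ι → ℂ}
    (h : Y * X - X * Y + 1 = vecMulVec v w) (hX : ∀ z, X.charpoly.IsRoot z → z.im = 0)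
    (hY : ∀ z, Y.charpoly.IsRoot z → z.im = 0) (a b : ℕ) :
    (w ⬝ᵥ (Y ^ a *ᵥ (X ^ b *ᵥ v))).im = 0 := by
  let φ : Matrix ι ι ℂ → (ι → ℂ) → Matrix ι ι ℂ →ₗ[ℂ] ℂ := fun B x =>
    { toFun := fun M => w ⬝ᵥ (B *ᵥ (M *ᵥ x))
      map_add' := fun M N => by rw [add_mulVec, mulVec_add, dotProduct_add]
      map_smul' := fun c M => by rw [smul_mulVec, mulVec_smul, dotProduct_smul]; rfl }
  have h1 := im_map_pow_eq_zero_of_resolvent (A := Y) (φ 1 (X ^ b *ᵥ v)) (fun t ht => by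
    have h2 := im_map_pow_eq_zero_of_resolvent (A := X) (φ (scalar ι (t : ℂ) - Y)⁻¹ v)
      (fun u hu => im_dotProduct_inv_mulVec_inv_eq_zero h hX hY ht hu) b
    simpa [φ] using h2) a
  simpa [φ] using h1

end RealForm

section RealStructure

open Matrix

variable {ι : Type*} [Fintype ι] [DecidableEq ι]

theorem exists_eq_vecMulVec_of_rank_le_one {A : Matrix ι ι ℂ} (h : A.rank ≤ 1) :
    ∃ v w : ι → ℂ, A = vecMulVec v w := by
  obtain ⟨⟨v, _⟩, hv⟩ := finrank_le_one_iff.1 (show Module.finrank ℂ A.mulVecLin.range ≤ 1 from h)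
  choose w hw using fun j => hv ⟨A.mulVecLin (Pi.single j 1), LinearMap.mem_range_self _ _⟩
  refine ⟨v, w, ?_⟩
  ext i j
  have := congrFun (congrArg Subtype.val (hw j)) i
  simp only [mulVecLin_apply, mulVec_single_one] at this
  rw [vecMulVec_apply, mul_comm]
  exact this.symm

theorem subsingleton_of_mul_sub_mul_add_one_eq_zero {V : Type*} [AddCommGroup V] [Module ℂ V]
    [FiniteDimensional ℂ V] {f g : Module.End ℂ V} (h : f * g - g * f + 1 = 0) :
    Subsingleton V := by
  have := congrArg (LinearMap.trace ℂ V) h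
  rw [map_add, map_sub, LinearMap.trace_mul_comm, sub_self, zero_add, LinearMap.trace_one,
    map_zero, Nat.cast_eq_zero] at this
  exact Module.finrank_zero_iff.1 this

variable {X Y : Matrix ι ι ℂ} {v w : ι → ℂ}

theorem mulVec_mulVec_comm_of_vecMulVec (h : Y * X - X * Y + 1 = vecMulVec v w) (x : ι → ℂ) :
    X *ᵥ (Y *ᵥ x) = Y *ᵥ (X *ᵥ x) + x - (w ⬝ᵥ x) • v := by
  have := congrArg (· *ᵥ x) h
  simp only [add_mulVec, sub_mulVec, one_mulVec, ← mulVec_mulVec, vecMulVec_mulVec] at this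
  rw [op_smul_eq_smul] at this
  rw [← this]
  abel

theorem eq_bot_of_invariant_of_dotProduct_eq_zero (h : Y * X - X * Y + 1 = vecMulVec v w)
    {K : Submodule ℂ (ι → ℂ)} (hX : ∀ x ∈ K, X *ᵥ x ∈ K) (hY : ∀ x ∈ K, Y *ᵥ x ∈ K)
    (hw : ∀ x ∈ K, w ⬝ᵥ x = 0) : K = ⊥ := by
  let f : Module.End ℂ K := (toLin' Y).restrict (p := K) hY
  let g : Module.End ℂ K := (toLin' X).restrict (p := K) hX
  rw [← Submodule.subsingleton_iff_eq_bot]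
  refine subsingleton_of_mul_sub_mul_add_one_eq_zero (f := f) (g := g) ?_
  ext1 x
  apply Subtype.ext
  have := mulVec_mulVec_comm_of_vecMulVec h (x : ι → ℂ)
  rw [hw x x.2, zero_smul, sub_zero] at this
  change Y *ᵥ (X *ᵥ (x : ι → ℂ)) - X *ᵥ (Y *ᵥ (x : ι → ℂ)) + x = 0
  rw [this]
  abel

theorem eq_top_of_invariant_of_mem (h : Y * X - X * Y + 1 = vecMulVec v w)
    {K : Submodule ℂ (ι → ℂ)} (hX : ∀ x ∈ K, X *ᵥ x ∈ K) (hY : ∀ x ∈ K, Y *ᵥ x ∈ K)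
    (hv : v ∈ K) : K = ⊤ := by
  let f : Module.End ℂ ((ι → ℂ) ⧸ K) := K.mapQ K (toLin' Y) hY
  let g : Module.End ℂ ((ι → ℂ) ⧸ K) := K.mapQ K (toLin' X) hX
  rw [← Submodule.Quotient.subsingleton_iff]
  refine subsingleton_of_mul_sub_mul_add_one_eq_zero (f := f) (g := g) ?_
  ext x
  change K.mkQ (Y *ᵥ (X *ᵥ _) - X *ᵥ (Y *ᵥ _) + _) = 0
  rw [mulVec_mulVec_comm_of_vecMulVec h]
  rw [Submodule.mkQ_apply, Submodule.Quotient.mk_eq_zero]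
  convert K.smul_mem (w ⬝ᵥ Pi.single x 1) hv using 1
  simp only [LinearMap.single_apply]
  abel

theorem exists_real_submodule (h : Y * X - X * Y + 1 = vecMulVec v w)
    (hr : ∀ a b : ℕ, (w ⬝ᵥ (Y ^ a *ᵥ (X ^ b *ᵥ v))).im = 0) :
    ∃ E : Submodule ℝ (ι → ℂ), (∀ x ∈ E, X *ᵥ x ∈ E) ∧ (∀ x ∈ E, Y *ᵥ x ∈ E) ∧ v ∈ E ∧
      ∀ x ∈ E, (w ⬝ᵥ x).im = 0 := by
  let s : Set (ι → ℂ) := Set.range fun p : ℕ × ℕ => Y ^ p.1 *ᵥ (X ^ p.2 *ᵥ v)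
  have hs : ∀ a b : ℕ, Y ^ a *ᵥ (X ^ b *ᵥ v) ∈ Submodule.span ℝ s := fun a b =>
    Submodule.subset_span ⟨(a, b), rfl⟩
  have hsv : v ∈ Submodule.span ℝ s := by simpa using hs 0 0
  have hmap : ∀ A : Matrix ι ι ℂ, (∀ a b : ℕ, A *ᵥ (Y ^ a *ᵥ (X ^ b *ᵥ v)) ∈
      Submodule.span ℝ s) → ∀ x ∈ Submodule.span ℝ s, A *ᵥ x ∈ Submodule.span ℝ s := by
    intro A hA x hx
    induction hx using Submodule.span_induction with
    | mem x hx => obtain ⟨p, rfl⟩ := hx; exact hA _ _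
    | zero => rw [mulVec_zero]; exact zero_mem _
    | add x y _ _ hx hy => rw [mulVec_add]; exact add_mem hx hy
    | smul c x _ hx => rw [mulVec_smul]; exact Submodule.smul_mem _ _ hx
  have hY : ∀ x ∈ Submodule.span ℝ s, Y *ᵥ x ∈ Submodule.span ℝ s := by
    refine hmap Y fun a b => ?_
    rw [mulVec_mulVec, ← pow_succ']
    exact hs (a + 1) b
  refine ⟨Submodule.span ℝ s, hmap X fun a b => ?_, hY, hsv, fun x hx => ?_⟩
  · induction a with
    | zero => simpa [pow_succ'] using hs 0 (b + 1)
    | succ a ih =>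
      rw [pow_succ', ← mulVec_mulVec, mulVec_mulVec_comm_of_vecMulVec h]
      refine sub_mem (add_mem (hY _ ih) (hs a b)) ?_
      have e : w ⬝ᵥ (Y ^ a *ᵥ (X ^ b *ᵥ v)) = ((w ⬝ᵥ (Y ^ a *ᵥ (X ^ b *ᵥ v))).re : ℂ) :=
        Complex.ext rfl (by simpa using hr a b)
      rw [e, Complex.coe_smul]
      exact Submodule.smul_mem _ _ hsv
  · induction hx using Submodule.span_induction with
    | mem x hx => obtain ⟨p, rfl⟩ := hx; exact hr _ _
    | zero => simp
    | add x y _ _ hx hy => rw [dotProduct_add, Complex.add_im, hx, hy, add_zero]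
    | smul c x _ hx => rw [dotProduct_smul, Complex.smul_im, hx, smul_zero]

theorem exists_basis_mem_real_submodule (h : Y * X - X * Y + 1 = vecMulVec v w)
    {E : Submodule ℝ (ι → ℂ)} (hX : ∀ x ∈ E, X *ᵥ x ∈ E) (hY : ∀ x ∈ E, Y *ᵥ x ∈ E)
    (hv : v ∈ E) (hw : ∀ x ∈ E, (w ⬝ᵥ x).im = 0) :
    ∃ b : Module.Basis ι ℂ (ι → ℂ), (∀ i, b i ∈ E) ∧ ∀ x ∈ E, ∀ i, (b.repr x i).im = 0 := by
  let K : Submodule ℂ (ι → ℂ) :=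
    { carrier := {x | x ∈ E ∧ Complex.I • x ∈ E}
      add_mem' := fun hx hy => ⟨add_mem hx.1 hy.1, by rw [smul_add]; exact add_mem hx.2 hy.2⟩
      zero_mem' := by simp
      smul_mem' := fun c x hx => by
        have e1 : c • x = c.re • x + c.im • Complex.I • x := by
          nth_rw 1 [← Complex.re_add_im c]
          rw [add_smul, mul_smul, Complex.coe_smul, Complex.coe_smul]
        have e2 : Complex.I • c • x = c.re • Complex.I • x - c.im • x := by
          rw [e1, smul_add, smul_comm Complex.I c.re, smul_comm Complex.I c.im, smul_smul,
            Complex.I_mul_I, neg_smul, one_smul, smul_neg, sub_eq_add_neg]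
        refine ⟨?_, ?_⟩
        · rw [e1]
          exact add_mem (E.smul_mem _ hx.1) (E.smul_mem _ hx.2)
        · rw [e2]
          exact sub_mem (E.smul_mem _ hx.2) (E.smul_mem _ hx.1) }
  have hK : K = ⊥ := by
    refine eq_bot_of_invariant_of_dotProduct_eq_zero h
      (fun x hx => ⟨hX _ hx.1, by rw [← mulVec_smul]; exact hX _ hx.2⟩)
      (fun x hx => ⟨hY _ hx.1, by rw [← mulVec_smul]; exact hY _ hx.2⟩) fun x hx => ?_
    have h1 := hw _ hx.1
    have h2 := hw _ hx.2
    rw [dotProduct_smul, smul_eq_mul, Complex.I_mul_im] at h2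
    exact Complex.ext h2 h1
  have hspan : Submodule.span ℂ (E : Set (ι → ℂ)) = ⊤ := by
    have hmap : ∀ A : Matrix ι ι ℂ, (∀ x ∈ E, A *ᵥ x ∈ E) →
        ∀ x ∈ Submodule.span ℂ (E : Set (ι → ℂ)), A *ᵥ x ∈ Submodule.span ℂ (E : Set (ι → ℂ)) := by
      intro A hA x hx
      induction hx using Submodule.span_induction with
      | mem x hx => exact Submodule.subset_span (hA x hx)
      | zero => rw [mulVec_zero]; exact zero_mem _
      | add x y _ _ hx hy => rw [mulVec_add]; exact add_mem hx hy
      | smul c x _ hx => rw [mulVec_smul]; exact Submodule.smul_mem _ _ hx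
    exact eq_top_of_invariant_of_mem h (hmap X hX) (hmap Y hY) (Submodule.subset_span hv)
  let b₀ := Module.Basis.ofSpan hspan.ge
  let b := b₀.reindex (b₀.indexEquiv (Pi.basisFun ℂ ι))
  have hb : ∀ i, b i ∈ E := fun i =>
    Module.Basis.ofSpan_subset hspan.ge ⟨(b₀.indexEquiv (Pi.basisFun ℂ ι)).symm i, by simp [b, b₀]⟩
  refine ⟨b, hb, fun x hx i => ?_⟩
  set y := ∑ j, (b.repr x j).im • b j with hy
  have hyE : y ∈ E := sum_mem fun j _ => E.smul_mem _ (hb j)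
  have hIy : Complex.I • y = x - ∑ j, (b.repr x j).re • b j := by
    rw [eq_sub_iff_add_eq, hy, Finset.smul_sum, ← Finset.sum_add_distrib]
    conv_rhs => rw [← b.sum_repr x]
    refine Finset.sum_congr rfl fun j _ => ?_
    conv_rhs => rw [← Complex.re_add_im (b.repr x j), add_smul, mul_comm, mul_smul,
      Complex.coe_smul, Complex.coe_smul]
    rw [add_comm]
  have hyK : y ∈ K := ⟨hyE, by
    rw [hIy]; exact sub_mem hx (sum_mem fun j _ => E.smul_mem _ (hb j))⟩
  rw [hK, Submodule.mem_bot] at hyK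
  have hli := Fintype.linearIndependent_iff.1 b.linearIndependent (fun j => ((b.repr x j).im : ℂ))
    (by simpa only [Complex.coe_smul] using hyK) i
  exact_mod_cast hli

theorem exists_conj_im_eq_zero (h : Y * X - X * Y + 1 = vecMulVec v w)
    (hr : ∀ a b : ℕ, (w ⬝ᵥ (Y ^ a *ᵥ (X ^ b *ᵥ v))).im = 0) :
    ∃ P Q : Matrix ι ι ℂ, Q * P = 1 ∧ P * Q = 1 ∧
      (∀ i j, ((Q * X * P) i j).im = 0) ∧ ∀ i j, ((Q * Y * P) i j).im = 0 := by
  obtain ⟨E, hX, hY, hv, hw⟩ := exists_real_submodule h hr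
  obtain ⟨b, hb, hbE⟩ := exists_basis_mem_real_submodule h hX hY hv hw
  let Q := LinearMap.toMatrix' (b.equivFun : (ι → ℂ) →ₗ[ℂ] ι → ℂ)
  let P := LinearMap.toMatrix' (b.equivFun.symm : (ι → ℂ) →ₗ[ℂ] ι → ℂ)
  have hent : ∀ A : Matrix ι ι ℂ, (∀ x ∈ E, A *ᵥ x ∈ E) → ∀ i j, ((Q * A * P) i j).im = 0 := by
    intro A hA i j
    have : (Q * A * P) i j = b.repr (A *ᵥ b j) i := by
      have e1 : (Q * A * P) i j = ((Q * A * P) *ᵥ Pi.single j 1) i := by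
        rw [mulVec_single_one]; rfl
      have e2 : P *ᵥ Pi.single j 1 = b j := by
        simp only [P, LinearMap.toMatrix'_mulVec]
        simp [Module.Basis.equivFun_symm_apply, Pi.single_apply]
      rw [e1, ← mulVec_mulVec, ← mulVec_mulVec, e2]
      simp only [Q, LinearMap.toMatrix'_mulVec]
      simp [Module.Basis.equivFun_apply]
    rw [this]
    exact hbE _ (hA _ (hb j)) i
  refine ⟨P, Q, ?_, ?_, hent X hX, hent Y hY⟩
  · rw [← LinearMap.toMatrix'_comp]
    simp
  · rw [← LinearMap.toMatrix'_comp]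
    simp

theorem coeff_det_im_eq_zero_of_conj {n m : ℕ} {X Y P Q : Matrix (Fin n) (Fin n) ℂ}
    (hQP : Q * P = 1) (hPQ : P * Q = 1) (hX : ∀ i j, ((Q * X * P) i j).im = 0)
    (hY : ∀ i j, ((Q * Y * P) i j).im = 0) (d : Fin m →₀ ℕ) :
    (MvPolynomial.coeff d (Matrix.det (X.map (MvPolynomial.C (σ := Fin m)) +
      ∑ j : Fin m, (MvPolynomial.C ((((j : ℕ) + 1 : ℕ) : ℂ)) * MvPolynomial.X j) •
        (Y ^ (j : ℕ)).map (MvPolynomial.C (σ := Fin m))))).im = 0 := by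
  let c := (MvPolynomial.C (σ := Fin m) (R := ℂ)).mapMatrix (m := Fin n)
  let s := (starRingEnd ℂ).mapMatrix (m := Fin n)
  have hreal : ∀ A : Matrix (Fin n) (Fin n) ℂ, (∀ i j, (A i j).im = 0) → s A = A := by
    intro A hA
    ext i j
    exact Complex.conj_eq_iff_im.2 (hA i j)
  have hpow : ∀ k : ℕ, Q * Y ^ k * P = (Q * Y * P) ^ k := by
    intro k
    induction k with
    | zero => simp [hQP]
    | succ k ih =>
      rw [pow_succ, pow_succ, ← ih]
      simp only [mul_assoc]
      rw [← mul_assoc P Q, hPQ, one_mul]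
  set M := fun A B : Matrix (Fin n) (Fin n) ℂ => c A +
      ∑ j : Fin m, (MvPolynomial.C ((((j : ℕ) + 1 : ℕ) : ℂ)) * MvPolynomial.X j) • c (B ^ (j : ℕ))
    with hM
  have hconj : c Q * M X Y * c P = M (Q * X * P) (Q * Y * P) := by
    simp only [hM, mul_add, add_mul, Finset.mul_sum, Finset.sum_mul, mul_smul_comm, smul_mul_assoc,
      ← map_mul, hpow]
  have hdet : (M X Y).det = (M (Q * X * P) (Q * Y * P)).det := by
    have : (c Q).det * (c P).det = 1 := by
      rw [← det_mul, ← map_mul, hQP, map_one, det_one]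
    rw [← hconj, det_mul, det_mul, mul_right_comm, this, one_mul]
  have hstar : (MvPolynomial.map (starRingEnd ℂ)).mapMatrix (M (Q * X * P) (Q * Y * P)) =
      M (Q * X * P) (Q * Y * P) := by
    have hc : ∀ A, (MvPolynomial.map (starRingEnd ℂ)).mapMatrix (c A) = c (s A) := by
      intro A
      ext i j : 2
      simp [c, s]
    have hσ : ∀ (a : MvPolynomial (Fin m) ℂ) (B : Matrix (Fin n) (Fin n) (MvPolynomial (Fin m) ℂ)),
        (MvPolynomial.map (starRingEnd ℂ)).mapMatrix (a • B) =
          MvPolynomial.map (starRingEnd ℂ) a • (MvPolynomial.map (starRingEnd ℂ)).mapMatrix B := by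
      intro a B
      ext i j : 2
      simp
    have hX' := hreal _ hX
    have hY' := hreal _ hY
    generalize Q * X * P = X' at hX' ⊢
    generalize Q * Y * P = Y' at hY' ⊢
    simp only [hM, map_add, map_sum, hσ, hc, map_pow, hX', hY', map_mul, MvPolynomial.map_X,
      map_natCast]
  have hfix : MvPolynomial.map (starRingEnd ℂ) (M X Y).det = (M X Y).det := by
    rw [hdet, RingHom.map_det, hstar]
  have := congrArg (MvPolynomial.coeff d) hfix
  rw [MvPolynomial.coeff_map] at this
  exact Complex.conj_eq_iff_im.1 this

end RealStructure

end CalogeroMoserReality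

/-- If `(X, Z)` is a Calogero–Moser pair and both `X` and `Z` have only real
eigenvalues, then for every `m ≥ 1` the tau polynomial
`det (X + ∑_{j=1}^m j · T_j · (−Z)^{j−1}) ∈ ℂ[T₁, …, T_m]` has real coefficients. -/
theorem tau_function_real_coefficients (n : ℕ) (hn : 1 ≤ n)
    (X Z : Matrix (Fin n) (Fin n) ℂ)
    (hrank : (X * Z - Z * X + 1).rank = 1)
    (hX : ∀ z : ℂ, (Matrix.charpoly X).IsRoot z → z.im = 0)
    (hZ : ∀ z : ℂ, (Matrix.charpoly Z).IsRoot z → z.im = 0) :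
    ∀ m : ℕ, 1 ≤ m → ∀ d : Fin m →₀ ℕ,
      ((MvPolynomial.coeff d
        (Matrix.det
          (X.map (MvPolynomial.C (σ := Fin m)) +
            ∑ j : Fin m,
              (MvPolynomial.C ((((j : ℕ) + 1 : ℕ) : ℂ)) * MvPolynomial.X j) •
                ((-Z) ^ (j : ℕ)).map (MvPolynomial.C (σ := Fin m))))).im = 0) := by
  obtain ⟨v, w, hvw⟩ := exists_eq_vecMulVec_of_rank_le_one hrank.le
  have h : -Z * X - X * -Z + 1 = Matrix.vecMulVec v w := by
    rw [← hvw]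
    noncomm_ring
  have hY : ∀ z : ℂ, (Matrix.charpoly (-Z)).IsRoot z → z.im = 0 := by
    intro z hz
    have hz' : (Matrix.charpoly Z).IsRoot (-z) := by
      rw [Polynomial.IsRoot, Matrix.eval_charpoly] at hz ⊢
      have e : Matrix.scalar (Fin n) (-z) - Z = -(Matrix.scalar (Fin n) z - -Z) := by
        rw [map_neg]
        abel
      rw [e, Matrix.det_neg, hz, mul_zero]
    simpa using hZ _ hz'
  obtain ⟨P, Q, hQP, hPQ, hXr, hYr⟩ :=
    exists_conj_im_eq_zero h fun a b => im_dotProduct_pow_mulVec_eq_zero h hX hY a b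
  intro m _ d
  exact coeff_det_im_eq_zero_of_conj hQP hPQ hXr hYr d
end

section
/- Let X₁,…,X_k, Y₁,…,Y_k be n×n real matrices. If there exists g ∈ GL_n(ℂ) such that Y_i = g X_i g⁻¹ for all i = 1,…,k, then there exists h ∈ GL_n(ℝ) such that Y_i = h X_i h⁻¹ for all i = 1,…,k. -/
open Polynomial in
/-- If `A + iB` is invertible for real matrices `A`, `B`, then so is `A + tB` for some real `t`. -/
theorem exists_isUnit_det_add_smul {m : Type*} [Fintype m] [DecidableEq m] (A B : Matrix m m ℝ)
    (h : (A.map Complex.ofReal + Complex.I • B.map Complex.ofReal).det ≠ 0) :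
    ∃ t : ℝ, IsUnit (A + t • B).det := by
  set p : ℝ[X] := (A.map C + (X : ℝ[X]) • B.map C).det with hp
  have hI : aeval Complex.I p = (A.map Complex.ofReal + Complex.I • B.map Complex.ofReal).det := by
    rw [hp, AlgHom.map_det]
    congr 1
    ext i j
    simp [mul_comm Complex.I]
  have ht (t : ℝ) : p.eval t = (A + t • B).det := by
    rw [hp, ← coe_evalRingHom, RingHom.map_det]
    congr 1
    ext i j
    simp [mul_comm t]
  by_contra! hdet
  have hzero : p = 0 := Polynomial.funext fun t ↦ by
    simpa [ht t] using hdet t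
  exact h (by rw [← hI, hzero, map_zero])

/-- The real and imaginary parts of a complex matrix intertwining real matrices intertwine them. -/
theorem re_im_intertwine {m : Type*} [Fintype m] (X Y : Matrix m m ℝ) (g : Matrix m m ℂ)
    (h : Y.map Complex.ofReal * g = g * X.map Complex.ofReal) :
    Y * g.map Complex.re = g.map Complex.re * X ∧ Y * g.map Complex.im = g.map Complex.im * X := by
  constructor <;> ext i j
  · simpa [Matrix.mul_apply] using congrArg Complex.re (congrFun₂ h i j)
  · simpa [Matrix.mul_apply] using congrArg Complex.im (congrFun₂ h i j)

/-- If two `k`-tuples of real `n × n` matrices are simultaneously conjugate over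
`GL_n(ℂ)`, then they are simultaneously conjugate over `GL_n(ℝ)`. -/
theorem real_simultaneous_conjugation (n k : ℕ)
    (X Y : Fin k → Matrix (Fin n) (Fin n) ℝ)
    (hconj : ∃ g : (Matrix (Fin n) (Fin n) ℂ)ˣ, ∀ i,
      (Y i).map Complex.ofReal =
        (g : Matrix (Fin n) (Fin n) ℂ) * (X i).map Complex.ofReal *
          ((g⁻¹ : (Matrix (Fin n) (Fin n) ℂ)ˣ) : Matrix (Fin n) (Fin n) ℂ)) :
    ∃ h : (Matrix (Fin n) (Fin n) ℝ)ˣ, ∀ i,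
      Y i = (h : Matrix (Fin n) (Fin n) ℝ) * X i *
        ((h⁻¹ : (Matrix (Fin n) (Fin n) ℝ)ˣ) : Matrix (Fin n) (Fin n) ℝ) := by
  obtain ⟨g, hg⟩ := hconj
  have hparts (i : Fin k) := re_im_intertwine (X i) (Y i) g.val (by simp [hg i, mul_assoc])
  have hsplit : (g.val.map Complex.re).map Complex.ofReal +
      Complex.I • (g.val.map Complex.im).map Complex.ofReal = g.val := by
    ext i j
    simp [mul_comm Complex.I, Complex.re_add_im]
  obtain ⟨t, ht⟩ := exists_isUnit_det_add_smul (g.val.map Complex.re) (g.val.map Complex.im)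
    (by rw [hsplit]; exact ((Matrix.isUnit_iff_isUnit_det _).mp g.isUnit).ne_zero)
  obtain ⟨u, hu⟩ := (Matrix.isUnit_iff_isUnit_det _).mpr ht
  refine ⟨u, fun i ↦ ?_⟩
  rw [Units.eq_mul_inv_iff_mul_eq, hu]
  simp [mul_add, add_mul, (hparts i).1, (hparts i).2]
end

section
/- Let A be a commutative ℝ-algebra equipped with the structure of an ℝ[t]-algebra (ℝ[t] the univariate polynomial ring) such that A is flat and finitely generated as an ℝ[t]-module. Suppose that for every p ∈ ℝ the quotient ℝ-algebra A(p) := A/(t−p)A is isomorphic, as an ℝ-algebra, to a finite product of fields. Then for all p, q ∈ ℝ there is an ℝ-algebra isomorphism A(p) ≅ A(q). -/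
/-- A presentation of a commutative `ℝ`-algebra `R` as a finite product of fields
`K₁ × ⋯ × K_m` (each `K_i` a field which is an `ℝ`-algebra). -/
structure ProductOfFieldsPresentation (R : Type) [CommRing R] [Algebra ℝ R] : Type 1 where
  m : ℕ
  K : Fin m → Type
  [fieldK : ∀ j, Field (K j)]
  [algK : ∀ j, Algebra ℝ (K j)]
  iso : R ≃ₐ[ℝ] ((j : Fin m) → K j)

open Polynomial in
/-- A basis of a finite free `R[X]`-algebra specialises to a basis of the quotient by `X - C p`. -/
theorem exists_basis_specialisation {R A ι : Type*} [CommRing R] [CommRing A] [Algebra R A]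
    [Algebra R[X] A] [IsScalarTower R R[X] A] [Finite ι] (b : Module.Basis ι R[X] A) (p : R) :
    ∃ b' : Module.Basis ι R (A ⧸ Ideal.span {algebraMap R[X] A (X - C p)}),
      (∀ i, b' i = Ideal.Quotient.mk _ (b i)) ∧
      ∀ a i, b'.repr (Ideal.Quotient.mk _ a) i = (b.repr a i).eval p := by
  have := Fintype.ofFinite ι
  set I := Ideal.span {algebraMap R[X] A (X - C p)}
  have hsmul (f : R[X]) (a : A) :
      Ideal.Quotient.mk I (f • a) = f.eval p • Ideal.Quotient.mk I a := by
    obtain ⟨g, hg⟩ := X_sub_C_dvd_sub_C_eval (a := p) (p := f)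
    have h : f • a - C (f.eval p) • a ∈ I := by
      rw [← sub_smul, hg, Algebra.smul_def, map_mul, mul_assoc]
      exact I.mul_mem_right _ (Ideal.subset_span rfl)
    rw [Ideal.Quotient.eq.mpr h, ← Polynomial.algebraMap_eq, algebraMap_smul]
    rfl
  have hrepr (a : A) : Ideal.Quotient.mk I a =
      ∑ i, (b.repr a i).eval p • Ideal.Quotient.mk I (b i) := by
    conv_lhs => rw [← b.sum_repr a]
    rw [map_sum]
    exact Finset.sum_congr rfl fun i _ => hsmul _ _
  have hli : LinearIndependent R fun i => Ideal.Quotient.mk I (b i) := by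
    rw [Fintype.linearIndependent_iff]
    intro v hv i
    have h : Ideal.Quotient.mk I (∑ j, C (v j) • b j) = 0 := by
      rw [map_sum, ← hv]
      exact Finset.sum_congr rfl fun j _ => by rw [hsmul, eval_C]
    obtain ⟨a, ha⟩ := Ideal.mem_span_singleton'.mp (Ideal.Quotient.eq_zero_iff_mem.mp h)
    rw [mul_comm, ← Algebra.smul_def] at ha
    have h2 := congrArg (fun x => (b.repr x i).eval p) ha
    simp only [b.repr_sum_self, map_smul, Finsupp.smul_apply, smul_eq_mul, eval_mul, eval_sub,
      eval_X, eval_C, sub_self, zero_mul] at h2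
    exact h2.symm
  have hsp : ⊤ ≤ Submodule.span R (Set.range fun i => Ideal.Quotient.mk I (b i)) := by
    intro x _
    obtain ⟨a, rfl⟩ := Ideal.Quotient.mk_surjective x
    rw [hrepr]
    exact Submodule.sum_mem _ fun i _ =>
      Submodule.smul_mem _ _ (Submodule.subset_span ⟨i, rfl⟩)
  refine ⟨Module.Basis.mk hli hsp, fun i => Module.Basis.mk_apply _ _ i, fun a i => ?_⟩
  have h : Ideal.Quotient.mk I a =
      ∑ j, (b.repr a j).eval p • Module.Basis.mk hli hsp j := by
    simpa using hrepr a
  rw [h, Module.Basis.repr_sum_self]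

open Polynomial in
theorem trace_specialisation {R A ι : Type*} [CommRing R] [CommRing A] [Algebra R A]
    [Algebra R[X] A] [IsScalarTower R R[X] A] [Finite ι] (b : Module.Basis ι R[X] A) (p : R)
    (a : A) :
    Algebra.trace R (A ⧸ Ideal.span {algebraMap R[X] A (X - C p)}) (Ideal.Quotient.mk _ a) =
      (Algebra.trace R[X] A a).eval p := by
  classical
  have := Fintype.ofFinite ι
  obtain ⟨b', hb', hr⟩ := exists_basis_specialisation b p
  rw [Algebra.trace_eq_matrix_trace b', Algebra.trace_eq_matrix_trace b, Matrix.trace,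
    Matrix.trace, eval_finsetSum]
  refine Finset.sum_congr rfl fun i _ => ?_
  rw [Matrix.diag_apply, Matrix.diag_apply, Algebra.leftMulMatrix_eq_repr_mul,
    Algebra.leftMulMatrix_eq_repr_mul, hb', ← map_mul, hr]

theorem trace_pi_apply {R ι : Type*} {S : ι → Type*} [CommRing R] [∀ i, CommRing (S i)]
    [∀ i, Algebra R (S i)] [∀ i, Module.Free R (S i)] [∀ i, Module.Finite R (S i)] [Fintype ι]
    (x : ∀ i, S i) : Algebra.trace R (∀ i, S i) x = ∑ i, Algebra.trace R (S i) (x i) := by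
  classical
  nontriviality R
  let c i := Module.Free.chooseBasis R (S i)
  rw [Algebra.trace_eq_matrix_trace (Pi.basis c), Matrix.trace, Fintype.sum_sigma]
  refine Finset.sum_congr rfl fun i _ => ?_
  rw [Algebra.trace_eq_matrix_trace (c i), Matrix.trace]
  refine Finset.sum_congr rfl fun j _ => ?_
  simp [Algebra.leftMulMatrix_eq_repr_mul, Pi.basis_repr]

theorem trace_real_pi_prod_complex_pi {ι κ : Type*} [Fintype ι] [Fintype κ]
    (x : (ι → ℝ) × (κ → ℂ)) :
    Algebra.trace ℝ ((ι → ℝ) × (κ → ℂ)) x = ∑ i, x.1 i + ∑ j, 2 * (x.2 j).re := by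
  simp [Algebra.trace_prod_apply, trace_pi_apply, Algebra.trace_complex_apply]

theorem ProductOfFieldsPresentation.exists_algEquiv_real_complex {R : Type} [CommRing R]
    [Algebra ℝ R] [Module.Finite ℝ R] (h : ProductOfFieldsPresentation R) :
    ∃ r s : ℕ, Nonempty (R ≃ₐ[ℝ] (Fin r → ℝ) × (Fin s → ℂ)) := by
  classical
  obtain ⟨m, K, e⟩ := h
  have hfin (j) : Module.Finite ℝ (K j) :=
    Module.Finite.of_surjective ((Pi.evalAlgHom ℝ K j).comp e.toAlgHom).toLinearMap
      ((Function.surjective_eval j).comp e.surjective)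
  let P j := Nonempty (K j ≃ₐ[ℝ] ℝ)
  have hC (j) (hj : ¬ P j) : Nonempty (K j ≃ₐ[ℝ] ℂ) :=
    (Real.nonempty_algEquiv_or (K j)).resolve_left hj
  let f (j : {j // P j}) : K j ≃ₐ[ℝ] ℝ := j.2.some
  let g (j : {j // ¬ P j}) : K j ≃ₐ[ℝ] ℂ := (hC j j.2).some
  let e₁ : (∀ j, K j) ≃ₐ[ℝ] (∀ j : {j // P j}, K j) × (∀ j : {j // ¬ P j}, K j) :=
    AlgEquiv.ofRingEquiv (f := RingEquiv.piEquivPiSubtypeProd P K) fun _ => rfl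
  let e₂ := AlgEquiv.prodCongr (AlgEquiv.piCongrRight f) (AlgEquiv.piCongrRight g)
  let e₃ := AlgEquiv.prodCongr
    (AlgEquiv.piCongrLeft ℝ (fun _ => ℝ) (Fintype.equivFin {j // P j}))
    (AlgEquiv.piCongrLeft ℝ (fun _ => ℂ) (Fintype.equivFin {j // ¬ P j}))
  exact ⟨_, _, ⟨((e.trans e₁).trans e₂).trans e₃⟩⟩

theorem QuadraticForm.finrank_add_finrank_le_of_pos_of_neg {U V W : Type*} [AddCommGroup U]
    [AddCommGroup V] [AddCommGroup W] [Module ℝ U] [Module ℝ V] [Module ℝ W]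
    [FiniteDimensional ℝ U] [FiniteDimensional ℝ V] [FiniteDimensional ℝ W]
    (Q : QuadraticForm ℝ W) (f : U →ₗ[ℝ] W) (g : V →ₗ[ℝ] W)
    (hf : ∀ u ≠ 0, 0 < Q (f u)) (hg : ∀ v ≠ 0, Q (g v) < 0) :
    Module.finrank ℝ U + Module.finrank ℝ V ≤ Module.finrank ℝ W := by
  rw [← Module.finrank_prod]
  refine LinearMap.finrank_le_finrank_of_injective (f := f.coprod g)
    ((injective_iff_map_eq_zero _).mpr ?_)
  rintro ⟨u, v⟩ h
  rw [LinearMap.coprod_apply] at h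
  have hQ : Q (f u) = Q (g v) := by rw [eq_neg_of_add_eq_zero_left h, QuadraticMap.map_neg]
  have hu : u = 0 := by
    by_contra hu
    have h₁ := hf u hu
    have hv : v ≠ 0 := by
      rintro rfl
      simp [hQ] at h₁
    linarith [hg v hv]
  have hv : v = 0 := by
    by_contra hv
    have h₁ := hg v hv
    simp [← hQ, hu] at h₁
  simp [hu, hv]

theorem QuadraticForm.eventually_pos {X U W : Type*} [TopologicalSpace X]
    [NormedAddCommGroup U] [NormedSpace ℝ U] [FiniteDimensional ℝ U] [AddCommGroup W]
    [Module ℝ W] [TopologicalSpace W] [IsTopologicalAddGroup W] [ContinuousSMul ℝ W]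
    {Q : X → QuadraticForm ℝ W} (hQ : Continuous fun z : X × W => Q z.1 z.2) {x₀ : X}
    (f : U →ₗ[ℝ] W) (hf : ∀ u ≠ 0, 0 < Q x₀ (f u)) :
    ∀ᶠ x in nhds x₀, ∀ u ≠ 0, 0 < Q x (f u) := by
  have := FiniteDimensional.proper_real U
  have hfc : Continuous f := f.continuous_of_finiteDimensional
  have hsphere : ∀ᶠ x in nhds x₀, ∀ u ∈ Metric.sphere (0 : U) 1, 0 < Q x (f u) := by
    refine (isCompact_sphere (0 : U) 1).eventually_forall_of_forall_eventually fun u hu => ?_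
    have hc : Continuous fun z : X × U => Q z.1 (f z.2) :=
      hQ.comp (continuous_fst.prodMk (hfc.comp continuous_snd))
    exact hc.continuousAt.eventually_const_lt (hf u (ne_zero_of_mem_unit_sphere ⟨u, hu⟩))
  filter_upwards [hsphere] with x hx u hu
  have h := hx (‖u‖⁻¹ • u) (by simp [norm_smul, hu])
  rw [map_smul, QuadraticMap.map_smul] at h
  exact pos_of_mul_pos_right h (mul_self_nonneg _)

theorem QuadraticForm.eventually_neg {X U W : Type*} [TopologicalSpace X]
    [NormedAddCommGroup U] [NormedSpace ℝ U] [FiniteDimensional ℝ U] [AddCommGroup W]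
    [Module ℝ W] [TopologicalSpace W] [IsTopologicalAddGroup W] [ContinuousSMul ℝ W]
    {Q : X → QuadraticForm ℝ W} (hQ : Continuous fun z : X × W => Q z.1 z.2) {x₀ : X}
    (f : U →ₗ[ℝ] W) (hf : ∀ u ≠ 0, Q x₀ (f u) < 0) :
    ∀ᶠ x in nhds x₀, ∀ u ≠ 0, Q x (f u) < 0 := by
  simpa using QuadraticForm.eventually_pos (Q := fun x => -Q x) hQ.neg f (by simpa using hf)

/-- If a continuous family of quadratic forms on a finite-dimensional space admits, at every
point, complementary-dimensional positive and negative definite subspaces, then the dimension of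
the negative one is locally constant. -/
theorem QuadraticForm.isLocallyConstant_index {X W : Type*} [TopologicalSpace X]
    [AddCommGroup W] [Module ℝ W] [FiniteDimensional ℝ W] [TopologicalSpace W]
    [IsTopologicalAddGroup W] [ContinuousSMul ℝ W]
    {Q : X → QuadraticForm ℝ W} (hQ : Continuous fun z : X × W => Q z.1 z.2) (k s : X → ℕ)
    (hks : ∀ x, k x + s x = Module.finrank ℝ W)
    (hpos : ∀ x, ∃ f : (Fin (k x) → ℝ) →ₗ[ℝ] W, ∀ u ≠ 0, 0 < Q x (f u))
    (hneg : ∀ x, ∃ g : (Fin (s x) → ℝ) →ₗ[ℝ] W, ∀ u ≠ 0, Q x (g u) < 0) :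
    IsLocallyConstant s := by
  refine (IsLocallyConstant.iff_eventually_eq s).mpr fun x => ?_
  obtain ⟨f, hf⟩ := hpos x
  obtain ⟨g, hg⟩ := hneg x
  filter_upwards [QuadraticForm.eventually_pos hQ f hf, QuadraticForm.eventually_neg hQ g hg]
    with y hfy hgy
  obtain ⟨f', hf'⟩ := hpos y
  obtain ⟨g', hg'⟩ := hneg y
  have h₁ := (Q y).finrank_add_finrank_le_of_pos_of_neg f g' hfy hg'
  have h₂ := (Q y).finrank_add_finrank_le_of_pos_of_neg f' g hf' hgy
  simp only [Module.finrank_fin_fun] at h₁ h₂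
  have := hks x
  have := hks y
  omega

/-- The quadratic form `x ↦ tr(x²)`. -/
noncomputable def traceQuadraticForm (K R : Type*) [CommRing K] [CommRing R] [Algebra K R] :
    QuadraticForm K R :=
  (Algebra.traceForm K R).toQuadraticMap

theorem traceQuadraticForm_apply {K R : Type*} [CommRing K] [CommRing R] [Algebra K R] (x : R) :
    traceQuadraticForm K R x = Algebra.trace K R (x * x) := rfl

theorem traceQuadraticForm_map_algEquiv {K R S : Type*} [CommRing K] [CommRing R] [CommRing S]
    [Algebra K R] [Algebra K S] (e : R ≃ₐ[K] S) (x : R) :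
    traceQuadraticForm K S (e x) = traceQuadraticForm K R x := by
  rw [traceQuadraticForm_apply, traceQuadraticForm_apply, ← map_mul, Algebra.trace_eq_of_algEquiv]

theorem exists_traceQuadraticForm_pos {r s : ℕ} :
    ∃ f : (Fin (r + s) → ℝ) →ₗ[ℝ] (Fin r → ℝ) × (Fin s → ℂ),
      ∀ u ≠ 0, 0 < traceQuadraticForm ℝ _ (f u) := by
  refine ⟨(LinearMap.funLeft ℝ ℝ (Fin.castAdd s)).prod
    ((Complex.ofRealCLM.toLinearMap.compLeft (Fin s)) ∘ₗ LinearMap.funLeft ℝ ℝ (Fin.natAdd r)),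
    fun u hu => ?_⟩
  have h : 0 < ∑ i, u i * u i := by
    obtain ⟨i, hi⟩ := Function.ne_iff.mp hu
    exact Finset.sum_pos' (fun i _ => mul_self_nonneg _)
      ⟨i, Finset.mem_univ _, mul_self_pos.mpr hi⟩
  rw [Fin.sum_univ_add] at h
  have h' : 0 ≤ ∑ i : Fin s, u (Fin.natAdd r i) * u (Fin.natAdd r i) :=
    Finset.sum_nonneg fun i _ => mul_self_nonneg _
  rw [traceQuadraticForm_apply, trace_real_pi_prod_complex_pi]
  simp only [LinearMap.prod_apply, Function.prod, Prod.fst_mul, Prod.snd_mul, Pi.mul_apply,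
    LinearMap.funLeft_apply, LinearMap.comp_apply, LinearMap.compLeft_apply, Function.comp_apply,
    ContinuousLinearMap.coe_coe, Complex.ofRealCLM_apply, ← Complex.ofReal_mul,
    Complex.ofReal_re, ← Finset.mul_sum]
  linarith

theorem exists_traceQuadraticForm_neg {r s : ℕ} :
    ∃ f : (Fin s → ℝ) →ₗ[ℝ] (Fin r → ℝ) × (Fin s → ℂ),
      ∀ u ≠ 0, traceQuadraticForm ℝ _ (f u) < 0 := by
  refine ⟨LinearMap.inr ℝ _ _ ∘ₗ
    ((LinearMap.mulLeft ℝ Complex.I ∘ₗ Complex.ofRealCLM.toLinearMap).compLeft (Fin s)),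
    fun u hu => ?_⟩
  have h : 0 < ∑ i, u i * u i := by
    obtain ⟨i, hi⟩ := Function.ne_iff.mp hu
    exact Finset.sum_pos' (fun i _ => mul_self_nonneg _)
      ⟨i, Finset.mem_univ _, mul_self_pos.mpr hi⟩
  rw [traceQuadraticForm_apply, trace_real_pi_prod_complex_pi]
  simp [← Finset.mul_sum, h]

/-- Let `A` be a commutative `ℝ[t]`-algebra which is flat and finite as an
`ℝ[t]`-module, such that for every `p ∈ ℝ` the specialisation `A(p) = A/(t−p)A` is an `ℝ`-algebra
isomorphic to a finite product of fields. Then all the specialisations `A(p)`, `p ∈ ℝ`, are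
isomorphic `ℝ`-algebras. -/
theorem specialisations_isomorphic (A : Type) [CommRing A]
    [Algebra ℝ A] [Algebra (Polynomial ℝ) A] [IsScalarTower ℝ (Polynomial ℝ) A]
    [Module.Flat (Polynomial ℝ) A] [Module.Finite (Polynomial ℝ) A]
    (hfields : ∀ p : ℝ, Nonempty (ProductOfFieldsPresentation
      (A ⧸ Ideal.span {algebraMap (Polynomial ℝ) A (Polynomial.X - Polynomial.C p)})))
    (p q : ℝ) :
    Nonempty
      ((A ⧸ Ideal.span {algebraMap (Polynomial ℝ) A (Polynomial.X - Polynomial.C p)}) ≃ₐ[ℝ]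
       (A ⧸ Ideal.span {algebraMap (Polynomial ℝ) A (Polynomial.X - Polynomial.C q)})) := by
  let b := Module.Free.chooseBasis (Polynomial ℝ) A
  set ι := Module.Free.ChooseBasisIndex (Polynomial ℝ) A
  choose b' hb' _ using exists_basis_specialisation (R := ℝ) b
  have hfin (x : ℝ) : Module.Finite ℝ
      (A ⧸ Ideal.span {algebraMap (Polynomial ℝ) A (Polynomial.X - Polynomial.C x)}) :=
    Module.Finite.of_basis (b' x)
  choose r s e using fun x => (hfields x).some.exists_algEquiv_real_complex
  let E x := (e x).some
  let Q (x : ℝ) : QuadraticForm ℝ (ι → ℝ) :=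
    (traceQuadraticForm ℝ _).comp (b' x).equivFun.symm.toLinearMap
  have hQE (x : ℝ) (v) : Q x ((b' x).equivFun ((E x).symm v)) = traceQuadraticForm ℝ _ v := by
    rw [← traceQuadraticForm_map_algEquiv (E x).symm]
    simp [Q]
  have hQ_apply (x : ℝ) (v : ι → ℝ) : Q x v =
      ∑ i, ∑ j, v i * v j * (Algebra.trace (Polynomial ℝ) A (b i * b j)).eval x := by
    have h : Q x v = Algebra.trace ℝ _ ((∑ i, v i • b' x i) * ∑ j, v j • b' x j) := by
      simp [Q, traceQuadraticForm_apply, Module.Basis.equivFun_symm_apply]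
    rw [h, Finset.sum_mul_sum, map_sum]
    refine Finset.sum_congr rfl fun i _ => ?_
    rw [map_sum]
    refine Finset.sum_congr rfl fun j _ => ?_
    rw [smul_mul_smul_comm, map_smul, hb', hb', ← map_mul, trace_specialisation b, smul_eq_mul]
  have hQ : Continuous fun z : ℝ × (ι → ℝ) => Q z.1 z.2 := by
    simp only [hQ_apply]
    fun_prop
  have hrank (x : ℝ) : r x + s x + s x = Module.finrank ℝ (ι → ℝ) := by
    rw [← ((b' x).equivFun.symm.trans (E x).toLinearEquiv).symm.finrank_eq]
    simp [Module.finrank_pi_fintype ℝ (M := fun _ : Fin (s x) => ℂ)]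
    ring
  have hs : s p = s q := by
    refine (QuadraticForm.isLocallyConstant_index hQ (fun x => r x + s x) s hrank
      (fun x => ?_) (fun x => ?_)).apply_eq_of_preconnectedSpace p q
    · obtain ⟨f, hf⟩ := exists_traceQuadraticForm_pos (r := r x) (s := s x)
      refine ⟨((b' x).equivFun.toLinearMap ∘ₗ (E x).symm.toLinearMap) ∘ₗ f, fun u hu => ?_⟩
      exact (hf u hu).trans_eq (hQE x _).symm
    · obtain ⟨f, hf⟩ := exists_traceQuadraticForm_neg (r := r x) (s := s x)
      refine ⟨((b' x).equivFun.toLinearMap ∘ₗ (E x).symm.toLinearMap) ∘ₗ f, fun u hu => ?_⟩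
      exact (hQE x _).trans_lt (hf u hu)
  have hr : r p = r q := by
    have := hrank p
    have := hrank q
    omega
  have Ep := E p
  rw [hr, hs] at Ep
  exact ⟨Ep.trans (E q).symm⟩
end

section
/- With K = ℂ(x₁,…,xₙ,y₁,…,yₙ) and the degenerate Dunkl operators D_i = M_{y_i} + c·Σ_{j≠i} M_{1/(x_i−x_j)} ∘ (s_{ij} − id) ∈ End_ℂ(K) for a fixed c ∈ ℂ, the following identities hold: (a) [D_i, M_{x_k}] = c·s_{ik} for all i ≠ k, and [D_i, M_{x_i}] = −c·Σ_{j≠i} s_{ij}; (b) the operators D₁,…,Dₙ pairwise commute, i.e., [D_i, D_j] = 0 for all i, j; (c) for every σ ∈ S_n (acting on K by the induced automorphism) and every i, σ ∘ D_i ∘ σ⁻¹ = D_{σ(i)}. Consequently the operators M_{x_i}, D_i and the action of S_n give a well-defined realization (Dunkl embedding) of the rational Cherednik algebra H_{0,c}(S_n) on K. -/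
/-- The field `K = ℂ(x₁, …, xₙ, y₁, …, yₙ)` of rational functions in `2n` variables: the
fraction field of the polynomial ring `ℂ[x₁, …, xₙ, y₁, …, yₙ]` (the `x`-variables are indexed
by `Sum.inl`, the `y`-variables by `Sum.inr`). -/
abbrev DunklField (n : ℕ) : Type := FractionRing (MvPolynomial (Fin n ⊕ Fin n) ℂ)

/-- The variable `x i` as an element of `K`. -/
noncomputable def xVar (n : ℕ) (i : Fin n) : DunklField n :=
  algebraMap (MvPolynomial (Fin n ⊕ Fin n) ℂ) (DunklField n) (MvPolynomial.X (Sum.inl i))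

/-- The variable `y i` as an element of `K`. -/
noncomputable def yVar (n : ℕ) (i : Fin n) : DunklField n :=
  algebraMap (MvPolynomial (Fin n ⊕ Fin n) ℂ) (DunklField n) (MvPolynomial.X (Sum.inr i))

lemma xVar_injective (n : ℕ) : Function.Injective (xVar n) := fun _ _ h ↦
  Sum.inl_injective <| MvPolynomial.X_injective <|
    IsFractionRing.injective (MvPolynomial (Fin n ⊕ Fin n) ℂ) (DunklField n) h

lemma perm_mul_apply_of_rename
    {n : ℕ} {s : Equiv.Perm (Fin n) → (DunklField n ≃ₐ[ℂ] DunklField n)}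
    (hs : ∀ (σ : Equiv.Perm (Fin n)) (f : MvPolynomial (Fin n ⊕ Fin n) ℂ),
      s σ (algebraMap (MvPolynomial (Fin n ⊕ Fin n) ℂ) (DunklField n) f) =
        algebraMap (MvPolynomial (Fin n ⊕ Fin n) ℂ) (DunklField n)
          (MvPolynomial.rename (Sum.map σ σ) f))
    (σ τ : Equiv.Perm (Fin n)) (f : DunklField n) : s (σ * τ) f = s σ (s τ f) := by
  obtain ⟨p, q, -, rfl⟩ :=
    IsFractionRing.div_surjective (A := MvPolynomial (Fin n ⊕ Fin n) ℂ) f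
  simp only [map_div₀, hs, MvPolynomial.rename_rename, Sum.map_comp_map, Equiv.Perm.coe_mul]

section Dunkl

variable {R F ι : Type*} [CommRing R] [Field F] [Algebra R F] [DecidableEq ι]

/-- The summand `M_{(x_i - x_j)⁻¹} ∘ (s_{ij} - id)` of the Dunkl operator `D i`. -/
noncomputable def dunklTerm (x : ι → F) (s : Equiv.Perm ι → (F ≃ₐ[R] F))
    (i j : ι) : Module.End R F :=
  (LinearMap.mulLeft R ((x i - x j)⁻¹)).comp
    ((s (Equiv.swap i j)).toLinearMap - LinearMap.id)

lemma dunklTerm_apply (x : ι → F) (s : Equiv.Perm ι → (F ≃ₐ[R] F))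
    (i j : ι) (f : F) :
    dunklTerm x s i j f = (x i - x j)⁻¹ * (s (Equiv.swap i j) f - f) := rfl

lemma dunklTerm_comm (x : ι → F) (s : Equiv.Perm ι → (F ≃ₐ[R] F))
    (i j : ι) : dunklTerm x s j i = -dunklTerm x s i j := by
  ext f
  rw [LinearMap.neg_apply, dunklTerm_apply, dunklTerm_apply, Equiv.swap_comm j i,
    ← neg_sub (x i), inv_neg, neg_mul]

variable {x y : ι → F} {s : Equiv.Perm ι → (F ≃ₐ[R] F)}

lemma lie_mulLeft_dunklTerm (a : F) (i j : ι) :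
    ⁅(LinearMap.mulLeft R a : Module.End R F), dunklTerm x s i j⁆ =
      LinearMap.mulLeft R ((x i - x j)⁻¹ * (a - s (Equiv.swap i j) a)) ∘ₗ
        (s (Equiv.swap i j)).toLinearMap := by
  ext f
  simp only [Ring.lie_def, LinearMap.sub_apply, Module.End.mul_apply, LinearMap.mulLeft_apply,
    dunklTerm_apply, LinearMap.comp_apply, AlgEquiv.toLinearMap_apply, map_mul]
  ring

lemma lie_mulLeft_dunklTerm_eq_zero {a : F} {i j : ι}
    (h : s (Equiv.swap i j) a = a) :
    ⁅(LinearMap.mulLeft R a : Module.End R F), dunklTerm x s i j⁆ = 0 := by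
  rw [lie_mulLeft_dunklTerm, h, sub_self, mul_zero, LinearMap.mulLeft_zero_eq_zero,
    LinearMap.zero_comp]

lemma lie_dunklTerm_of_disjoint
    (hx : ∀ (σ : Equiv.Perm ι) (k : ι), s σ (x k) = x (σ k))
    (hmul : ∀ (σ τ : Equiv.Perm ι) (f : F), s (σ * τ) f = s σ (s τ f))
    {i j k l : ι} (hij : i ≠ j) (hil : i ≠ l) (hjk : j ≠ k)
    (hkl : k ≠ l) : ⁅dunklTerm x s i k, dunklTerm x s j l⁆ = 0 := by
  have hcomm : Equiv.swap i k * Equiv.swap j l = Equiv.swap j l * Equiv.swap i k := by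
    rw [Equiv.mul_swap_eq_swap_mul, Equiv.swap_apply_of_ne_of_ne hij.symm hjk,
      Equiv.swap_apply_of_ne_of_ne hil.symm hkl.symm]
  ext f
  have hf := hmul (Equiv.swap i k) (Equiv.swap j l) f
  rw [hcomm, hmul] at hf
  simp only [Ring.lie_def, LinearMap.sub_apply, Module.End.mul_apply, dunklTerm_apply, map_mul,
    map_sub, map_inv₀, hx, LinearMap.zero_apply, hf, Equiv.swap_apply_of_ne_of_ne hij.symm hjk,
    Equiv.swap_apply_of_ne_of_ne hil.symm hkl.symm, Equiv.swap_apply_of_ne_of_ne hij hil,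
    Equiv.swap_apply_of_ne_of_ne hjk.symm hkl]
  ring

/-- The classical Yang–Baxter equation for the summands of the Dunkl operators. -/
lemma dunklTerm_yang_baxter (hinj : Function.Injective x)
    (hx : ∀ (σ : Equiv.Perm ι) (k : ι), s σ (x k) = x (σ k))
    (hmul : ∀ (σ τ : Equiv.Perm ι) (f : F), s (σ * τ) f = s σ (s τ f))
    {i j k : ι} (hij : i ≠ j) (hik : i ≠ k) (hjk : j ≠ k) :
    ⁅dunklTerm x s i j, dunklTerm x s j k⁆ + ⁅dunklTerm x s i k, dunklTerm x s j i⁆ +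
      ⁅dunklTerm x s i k, dunklTerm x s j k⁆ = 0 := by
  have e₁ : Equiv.swap i k * Equiv.swap i j = Equiv.swap i j * Equiv.swap j k := by
    rw [Equiv.mul_swap_eq_swap_mul (Equiv.swap i j), Equiv.swap_apply_right,
      Equiv.swap_apply_of_ne_of_ne hik.symm hjk.symm]
  have e₂ : Equiv.swap j k * Equiv.swap i k = Equiv.swap i j * Equiv.swap j k := by
    rw [Equiv.mul_swap_eq_swap_mul (Equiv.swap j k), Equiv.swap_apply_right,
      Equiv.swap_apply_of_ne_of_ne hij hik]
  have e₃ : Equiv.swap i j * Equiv.swap i k = Equiv.swap j k * Equiv.swap i j := by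
    rw [Equiv.mul_swap_eq_swap_mul (Equiv.swap i j), Equiv.swap_apply_left,
      Equiv.swap_apply_of_ne_of_ne hik.symm hjk.symm]
  have e₄ : Equiv.swap i k * Equiv.swap j k = Equiv.swap j k * Equiv.swap i j := by
    rw [Equiv.mul_swap_eq_swap_mul (Equiv.swap j k), Equiv.swap_apply_left,
      Equiv.swap_apply_of_ne_of_ne hij hik]
  rw [dunklTerm_comm x s i j]
  ext f
  have h₁ := congrArg (s · f) e₁
  have h₂ := congrArg (s · f) e₂
  have h₃ := congrArg (s · f) e₃
  have h₄ := congrArg (s · f) e₄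
  simp only [hmul] at h₁ h₂ h₃ h₄
  have nij := sub_ne_zero.mpr <| hinj.ne hij
  have nik := sub_ne_zero.mpr <| hinj.ne hik
  have njk := sub_ne_zero.mpr <| hinj.ne hjk
  simp only [Ring.lie_def, LinearMap.add_apply, LinearMap.neg_apply, LinearMap.sub_apply,
    Module.End.mul_apply, dunklTerm_apply, map_mul, map_neg, map_sub, map_inv₀, hx,
    LinearMap.zero_apply, h₁, h₂, h₃, h₄, Equiv.swap_apply_left, Equiv.swap_apply_right,
    Equiv.swap_apply_of_ne_of_ne hij hik, Equiv.swap_apply_of_ne_of_ne hij.symm hjk,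
    Equiv.swap_apply_of_ne_of_ne hik.symm hjk.symm]
  rw [← neg_sub (x j) (x k)]
  simp only [inv_neg]
  have key : (x i - x j)⁻¹ * (x j - x k)⁻¹ =
      (x i - x k)⁻¹ * ((x i - x j)⁻¹ + (x j - x k)⁻¹) := by
    field_simp
    ring
  grind

variable [Fintype ι]

attribute [local instance] LieRing.ofAssociativeRing LieAlgebra.ofAssociativeAlgebra

/-- The Dunkl operators commute. -/
lemma lie_dunkl_eq_zero (hinj : Function.Injective x)
    (hx : ∀ (σ : Equiv.Perm ι) (k : ι), s σ (x k) = x (σ k))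
    (hy : ∀ (σ : Equiv.Perm ι) (k : ι), s σ (y k) = y (σ k))
    (hmul : ∀ (σ τ : Equiv.Perm ι) (f : F), s (σ * τ) f = s σ (s τ f))
    (c : R) {i j : ι} (hij : i ≠ j) :
    ⁅(LinearMap.mulLeft R (y i) : Module.End R F) +
        c • ∑ k ∈ Finset.univ.erase i, dunklTerm x s i k,
      (LinearMap.mulLeft R (y j) : Module.End R F) +
        c • ∑ k ∈ Finset.univ.erase j, dunklTerm x s j k⁆ = 0 := by
  have hmem (k : ι) (hk : k ∈ (Finset.univ.erase i).erase j) : i ≠ k ∧ j ≠ k := by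
    simp only [Finset.mem_erase, Finset.mem_univ, and_true] at hk
    exact ⟨hk.2.symm, hk.1.symm⟩
  rw [← Finset.add_sum_erase (Finset.univ.erase i) _ (a := j) (by simpa using hij.symm),
    ← Finset.add_sum_erase (Finset.univ.erase j) _ (a := i) (by simpa using hij),
    Finset.erase_right_comm (a := j) (b := i)]
  set S := (Finset.univ.erase i).erase j
  have hyy : ⁅(LinearMap.mulLeft R (y i) : Module.End R F),
      LinearMap.mulLeft R (y j)⁆ = 0 := by
    ext f
    simp only [Ring.lie_def, LinearMap.sub_apply, Module.End.mul_apply,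
      LinearMap.mulLeft_apply, LinearMap.zero_apply]
    ring
  have hyA : ⁅(LinearMap.mulLeft R (y i) : Module.End R F),
      dunklTerm x s j i⁆ + ⁅dunklTerm x s i j, LinearMap.mulLeft R (y j)⁆ = 0 := by
    rw [← lie_skew (dunklTerm x s i j), lie_mulLeft_dunklTerm, lie_mulLeft_dunklTerm,
      Equiv.swap_comm j i, hy, hy, Equiv.swap_apply_left, Equiv.swap_apply_right,
      ← neg_sub (x i), ← neg_sub (y i), inv_neg, neg_mul, mul_neg, add_neg_cancel]
  have hyA₁ : ∑ k ∈ S, ⁅(LinearMap.mulLeft R (y i) : Module.End R F),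
      dunklTerm x s j k⁆ = 0 := Finset.sum_eq_zero fun k hk ↦
    lie_mulLeft_dunklTerm_eq_zero <| by
      rw [hy, Equiv.swap_apply_of_ne_of_ne hij (hmem k hk).1]
  have hyA₂ : ∑ k ∈ S, ⁅dunklTerm x s i k,
      (LinearMap.mulLeft R (y j) : Module.End R F)⁆ = 0 :=
    Finset.sum_eq_zero fun k hk ↦ by
      rw [← lie_skew, lie_mulLeft_dunklTerm_eq_zero, neg_zero]
      rw [hy, Equiv.swap_apply_of_ne_of_ne hij.symm (hmem k hk).2]
  have hAA : ⁅dunklTerm x s i j, dunklTerm x s j i⁆ = 0 := by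
    rw [dunklTerm_comm x s i j, lie_neg, lie_self, neg_zero]
  have hdiag : ∑ l ∈ S, ∑ k ∈ S, ⁅dunklTerm x s i k, dunklTerm x s j l⁆ =
      ∑ k ∈ S, ⁅dunklTerm x s i k, dunklTerm x s j k⁆ :=
    Finset.sum_congr rfl fun l hl ↦ Finset.sum_eq_single_of_mem l hl fun k hk hkl ↦
      lie_dunklTerm_of_disjoint hx hmul hij (hmem l hl).1 (hmem k hk).2 hkl
  have hyb : ∑ k ∈ S, ⁅dunklTerm x s i j, dunklTerm x s j k⁆ +
      ∑ k ∈ S, ⁅dunklTerm x s i k, dunklTerm x s j i⁆ +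
      ∑ k ∈ S, ⁅dunklTerm x s i k, dunklTerm x s j k⁆ = 0 := by
    rw [← Finset.sum_add_distrib, ← Finset.sum_add_distrib]
    exact Finset.sum_eq_zero fun k hk ↦
      dunklTerm_yang_baxter hinj hx hmul hij (hmem k hk).1 (hmem k hk).2
  simp only [add_lie, lie_add, smul_lie, LieAlgebra.lie_smul, sum_lie, lie_sum,
    Finset.sum_add_distrib, ← Finset.smul_sum, hyy, hyA₁, hyA₂, hAA, hdiag]
  linear_combination (norm := module) c • hyA + (c * c) • hyb

/-- The Dunkl operator identities over an arbitrary field with an action of the symmetric group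
permuting two families `x`, `y`, the first of which is injective. -/
theorem dunkl_operator_identities_of_injective (hinj : Function.Injective x)
    (hx : ∀ (σ : Equiv.Perm ι) (k : ι), s σ (x k) = x (σ k))
    (hy : ∀ (σ : Equiv.Perm ι) (k : ι), s σ (y k) = y (σ k))
    (hmul : ∀ (σ τ : Equiv.Perm ι) (f : F), s (σ * τ) f = s σ (s τ f)) (c : R)
    (D : ι → (F →ₗ[R] F))
    (hD : ∀ i, D i =
      LinearMap.mulLeft R (y i) + c • ∑ j ∈ Finset.univ.erase i, dunklTerm x s i j) :
    (∀ i k : ι, i ≠ k →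
      D i ∘ₗ LinearMap.mulLeft R (x k) - LinearMap.mulLeft R (x k) ∘ₗ D i =
        c • (s (Equiv.swap i k)).toLinearMap) ∧
    (∀ i : ι,
      D i ∘ₗ LinearMap.mulLeft R (x i) - LinearMap.mulLeft R (x i) ∘ₗ D i =
        -(c • ∑ j ∈ Finset.univ.erase i, (s (Equiv.swap i j)).toLinearMap)) ∧
    (∀ i j : ι, D i ∘ₗ D j = D j ∘ₗ D i) ∧
    (∀ (σ : Equiv.Perm ι) (i : ι),
      (s σ).toLinearMap ∘ₗ D i ∘ₗ (s σ⁻¹).toLinearMap = D (σ i)) := by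
  have hlie (i k : ι) :
      D i ∘ₗ LinearMap.mulLeft R (x k) - LinearMap.mulLeft R (x k) ∘ₗ D i =
        c • ∑ j ∈ Finset.univ.erase i,
          LinearMap.mulLeft R ((x i - x j)⁻¹ *
            (x (Equiv.swap i j k) - x k)) ∘ₗ (s (Equiv.swap i j)).toLinearMap := by
    ext f
    simp only [hD, LinearMap.sub_apply, LinearMap.comp_apply, LinearMap.add_apply,
      LinearMap.smul_apply, LinearMap.sum_apply, LinearMap.mulLeft_apply, dunklTerm_apply,
      AlgEquiv.toLinearMap_apply, map_mul, hx]
    rw [mul_add, mul_smul_comm, Finset.mul_sum, add_sub_add_comm, ← smul_sub,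
      ← Finset.sum_sub_distrib, mul_left_comm, sub_self, zero_add]
    refine congrArg (c • ·) (Finset.sum_congr rfl fun j _ ↦ ?_)
    ring
  refine ⟨fun i k hik ↦ ?_, fun i ↦ ?_, fun i j ↦ ?_, fun σ i ↦ ?_⟩
  · rw [hlie, Finset.sum_eq_single_of_mem k (by simpa using hik.symm)]
    · rw [Equiv.swap_apply_right, inv_mul_cancel₀ (sub_ne_zero.mpr <| hinj.ne hik),
        LinearMap.mulLeft_one, LinearMap.id_comp]
    · intro j _ hjk
      rw [Equiv.swap_apply_of_ne_of_ne hik.symm hjk.symm, sub_self, mul_zero,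
        LinearMap.mulLeft_zero_eq_zero, LinearMap.zero_comp]
  · rw [hlie]
    ext f
    simp only [LinearMap.neg_apply, LinearMap.smul_apply, LinearMap.sum_apply,
      LinearMap.comp_apply, LinearMap.mulLeft_apply, AlgEquiv.toLinearMap_apply]
    rw [← smul_neg, ← Finset.sum_neg_distrib]
    refine congrArg (c • ·) (Finset.sum_congr rfl fun j hj ↦ ?_)
    rw [Equiv.swap_apply_left, ← neg_sub (x i), mul_neg, inv_mul_cancel₀
      (sub_ne_zero.mpr <| hinj.ne (Finset.ne_of_mem_erase hj).symm), neg_one_mul]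
  · rcases eq_or_ne i j with rfl | hij
    · rfl
    · rw [hD i, hD j]
      exact sub_eq_zero.mp (lie_dunkl_eq_zero hinj hx hy hmul c hij)
  · have hinv (f : F) : s σ (s σ⁻¹ f) = f := by
      have hone : s 1 f = f := (s 1).injective (by rw [← hmul, one_mul])
      rw [← hmul, mul_inv_cancel, hone]
    ext f
    simp only [hD, LinearMap.comp_apply, LinearMap.add_apply, LinearMap.smul_apply,
      LinearMap.sum_apply, LinearMap.mulLeft_apply, dunklTerm_apply,
      AlgEquiv.toLinearMap_apply, map_add, map_mul, map_smul, map_sum, map_sub, map_inv₀,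
      hx, hy, hinv]
    refine congrArg (y (σ i) * f + c • ·)
      (Finset.sum_equiv σ (fun j ↦ by simp) fun j _ ↦ ?_)
    rw [← hmul, ← hmul, Equiv.mul_swap_eq_swap_mul, mul_assoc, mul_inv_cancel, mul_one]

end Dunkl

/-- **the Dunkl embedding for `H_{0,c}(S_n)`.**
Let `K = ℂ(x₁, …, xₙ, y₁, …, yₙ)`, let `s σ` (for `σ ∈ S_n`) be the `ℂ`-algebra automorphism of
`K` permuting the `x`-variables and the `y`-variables simultaneously by `σ` (characterised by its
action on polynomials, hypothesis `hs`), and for `c ∈ ℂ` let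
`D i = M_{y_i} + c • ∑_{j ≠ i} M_{(x_i − x_j)⁻¹} ∘ (s_{ij} − id)`
be the degenerate Dunkl operators (`M_f` is multiplication by `f`, and `s_{ij} = s (swap i j)`).
Then: (a) `[D_i, M_{x_k}] = c • s_{ik}` for `i ≠ k` and `[D_i, M_{x_i}] = −c • ∑_{j ≠ i} s_{ij}`;
(b) the `D_i` pairwise commute; (c) `σ ∘ D_i ∘ σ⁻¹ = D_{σ i}`.  Consequently the operators
`M_{x_i}`, `D_i` and the `S_n`-action yield a well-defined realization of the rational Cherednik
algebra `H_{0,c}(S_n)` on `K`. -/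
theorem dunkl_operator_identities (n : ℕ) (hn : 2 ≤ n) (c : ℂ)
    (s : Equiv.Perm (Fin n) → (DunklField n ≃ₐ[ℂ] DunklField n))
    (hs : ∀ (σ : Equiv.Perm (Fin n)) (f : MvPolynomial (Fin n ⊕ Fin n) ℂ),
      s σ (algebraMap (MvPolynomial (Fin n ⊕ Fin n) ℂ) (DunklField n) f) =
        algebraMap (MvPolynomial (Fin n ⊕ Fin n) ℂ) (DunklField n)
          (MvPolynomial.rename (Sum.map σ σ) f))
    (D : Fin n → (DunklField n →ₗ[ℂ] DunklField n))
    (hD : ∀ i, D i =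
      LinearMap.mulLeft ℂ (yVar n i) +
        c • ∑ j ∈ Finset.univ.erase i,
          (LinearMap.mulLeft ℂ ((xVar n i - xVar n j)⁻¹)).comp
            ((s (Equiv.swap i j)).toLinearMap - LinearMap.id)) :
    (∀ i k : Fin n, i ≠ k →
      D i ∘ₗ LinearMap.mulLeft ℂ (xVar n k) - LinearMap.mulLeft ℂ (xVar n k) ∘ₗ D i =
        c • (s (Equiv.swap i k)).toLinearMap) ∧
    (∀ i : Fin n,
      D i ∘ₗ LinearMap.mulLeft ℂ (xVar n i) - LinearMap.mulLeft ℂ (xVar n i) ∘ₗ D i =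
        -(c • ∑ j ∈ Finset.univ.erase i, (s (Equiv.swap i j)).toLinearMap)) ∧
    (∀ i j : Fin n, D i ∘ₗ D j = D j ∘ₗ D i) ∧
    (∀ (σ : Equiv.Perm (Fin n)) (i : Fin n),
      (s σ).toLinearMap ∘ₗ D i ∘ₗ (s σ⁻¹).toLinearMap = D (σ i)) := by
  have hx (σ : Equiv.Perm (Fin n)) (k : Fin n) : s σ (xVar n k) = xVar n (σ k) := by
    simp only [xVar, hs, MvPolynomial.rename_X, Sum.map_inl]
  have hy (σ : Equiv.Perm (Fin n)) (k : Fin n) : s σ (yVar n k) = yVar n (σ k) := by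
    simp only [yVar, hs, MvPolynomial.rename_X, Sum.map_inr]
  exact dunkl_operator_identities_of_injective (xVar_injective n) hx hy
    (perm_mul_apply_of_rename hs) c D hD
end

section
/- Let n ≥ 1 and let X, Z be n×n complex matrices such that [X,Z] + Iₙ has rank 1 and X has n distinct eigenvalues. Suppose there exists g ∈ GL_n(ℂ) such that the entrywise complex conjugate matrices satisfy conj(X) = g X g⁻¹ and conj(Z) = g Z g⁻¹. Then there exists h ∈ GL_n(ℂ) such that h X h⁻¹ and h Z h⁻¹ both have all entries real. -/
open Polynomial in
/-- Hilbert 90 for `GL_n(ℂ)` and complex conjugation. -/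
theorem exists_unit_map_conj_mul_eq {ι : Type*} [Fintype ι] [DecidableEq ι]
    (G : Matrix ι ι ℂ) (hG : (starRingEnd ℂ).mapMatrix G * G = 1) :
    ∃ h : (Matrix ι ι ℂ)ˣ, (starRingEnd ℂ).mapMatrix (h : Matrix ι ι ℂ) * G = h := by
  let P : ℂ[X] :=
    ((X : ℂ[X]) • (1 + G).map C + (Complex.I • (1 - G)).map C : Matrix ι ι ℂ[X]).det
  have hP (t : ℂ) : P.eval t = (t • (1 + G) + Complex.I • (1 - G)).det := by
    rw [← coe_evalRingHom, RingHom.map_det]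
    congr 1
    ext i j
    simp [RingHom.mapMatrix_apply]
    ring
  have hP0 : P ≠ 0 := by
    intro h0
    have h1 := hP (-Complex.I)
    have h2 : (-Complex.I) • (1 + G) + Complex.I • (1 - G) = (-2 * Complex.I) • G := by
      module
    rw [h0, eval_zero, h2, Matrix.det_smul] at h1
    have hdet : G.det ≠ 0 := by
      intro h
      simpa [h] using congrArg Matrix.det hG
    exact mul_ne_zero (pow_ne_zero _ (by simp)) hdet h1.symm
  obtain ⟨t, ht⟩ : ∃ t : ℝ, P.eval (t : ℂ) ≠ 0 := by
    by_contra! hroot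
    refine hP0 (eq_zero_of_infinite_isRoot P
      ((Set.infinite_range_of_injective Complex.ofReal_injective).mono ?_))
    rintro _ ⟨t, rfl⟩
    exact hroot t
  rw [hP] at ht
  obtain ⟨h, hh⟩ := (Matrix.isUnit_iff_isUnit_det _).2 (isUnit_iff_ne_zero.2 ht)
  refine ⟨h, ?_⟩
  have h1 : (h : Matrix ι ι ℂ) =
      ((t : ℂ) + Complex.I) • (1 : Matrix ι ι ℂ) + ((t : ℂ) - Complex.I) • G := by
    rw [hh]; module
  have h2 : (starRingEnd ℂ).mapMatrix (h : Matrix ι ι ℂ) =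
      ((t : ℂ) - Complex.I) • (1 : Matrix ι ι ℂ) +
        ((t : ℂ) + Complex.I) • (starRingEnd ℂ).mapMatrix G := by
    rw [h1]
    ext i j
    by_cases hij : i = j <;> simp [hij, sub_eq_add_neg]
  rw [h2, h1, add_mul, smul_mul_assoc, smul_mul_assoc, hG, one_mul, add_comm]

/-- An endomorphism commuting with `x` and `z` and annihilating `[x, z] + 1` vanishes. -/
theorem Module.End.eq_zero_of_commute_of_mul_commutator_add_one {K V : Type*} [Field K]
    [CharZero K] [AddCommGroup V] [Module K V] [FiniteDimensional K V] {x z b : Module.End K V}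
    (hx : Commute b x) (hz : Commute b z) (h : b * (x * z - z * x + 1) = 0) : b = 0 := by
  have invariant {y : Module.End K V} (hy : Commute b y) :
      ∀ v ∈ LinearMap.range b, y v ∈ LinearMap.range b := by
    rintro _ ⟨v, rfl⟩
    exact ⟨y v, LinearMap.congr_fun hy.eq v⟩
  let x' : Module.End K (LinearMap.range b) := x.restrict (invariant hx)
  let z' : Module.End K (LinearMap.range b) := z.restrict (invariant hz)
  have hb : Commute b (x * z - z * x + 1) :=
    ((hx.mul_right hz).sub_right (hz.mul_right hx)).add_right (Commute.one_right b)
  have hT : x' * z' - z' * x' + 1 = 0 := by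
    ext ⟨_, v, rfl⟩
    exact LinearMap.congr_fun (hb.eq.symm.trans h) v
  have htr := congrArg (LinearMap.trace K _) hT
  rw [map_add, map_sub, LinearMap.trace_mul_comm, sub_self, zero_add, LinearMap.trace_one,
    map_zero, Nat.cast_eq_zero, Submodule.finrank_eq_zero] at htr
  exact LinearMap.range_eq_bot.1 htr

theorem Matrix.eq_zero_of_commute_of_mul_commutator_add_one {ι K : Type*} [Fintype ι]
    [DecidableEq ι] [Field K] [CharZero K] {X Z B : Matrix ι ι K}
    (hX : Commute B X) (hZ : Commute B Z) (h : B * (X * Z - Z * X + 1) = 0) : B = 0 := by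
  refine (map_eq_zero_iff (Matrix.toLinAlgEquiv' (R := K) (n := ι))
    (AlgEquiv.injective _)).1 ?_
  refine Module.End.eq_zero_of_commute_of_mul_commutator_add_one (hX.map _) (hZ.map _) ?_
  simpa only [map_mul, map_add, map_sub, map_one, map_zero] using
    congrArg (Matrix.toLinAlgEquiv' (R := K) (n := ι)) h

theorem commute_map_conj_mul_self {ι : Type*} [Fintype ι] [DecidableEq ι]
    {g Y : Matrix ι ι ℂ} (h : (starRingEnd ℂ).mapMatrix Y * g = g * Y) :
    Commute ((starRingEnd ℂ).mapMatrix g * g) Y := by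
  have h' := congrArg (starRingEnd ℂ).mapMatrix h
  have hYY : (starRingEnd ℂ).mapMatrix ((starRingEnd ℂ).mapMatrix Y) = Y := by
    ext i j; simp
  rw [map_mul, map_mul, hYY] at h'
  rw [Commute, SemiconjBy, mul_assoc, ← h, ← mul_assoc, ← h', mul_assoc]

open Matrix in
/-- If `g` intertwines a Calogero–Moser pair with its complex conjugate, then `conj g * g` is a
positive scalar. -/
theorem exists_map_conj_mul_self_eq_smul_one {ι : Type*} [Fintype ι] [DecidableEq ι]
    {X Z g : Matrix ι ι ℂ} (hg : IsUnit g) (hrank : (X * Z - Z * X + 1).rank = 1)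
    (hX : (starRingEnd ℂ).mapMatrix X * g = g * X)
    (hZ : (starRingEnd ℂ).mapMatrix Z * g = g * Z) :
    ∃ s : ℝ, s ≠ 0 ∧ (starRingEnd ℂ).mapMatrix g * g = ((s : ℂ) ^ 2) • 1 := by
  set T := X * Z - Z * X + 1 with hT
  have conj_mulVec (M : Matrix ι ι ℂ) (w : ι → ℂ) :
      (starRingEnd ℂ).mapMatrix M *ᵥ star w = star (M *ᵥ w) := by
    ext i
    simp [Matrix.mulVec, dotProduct]
  have hTg : (starRingEnd ℂ).mapMatrix T * g = g * T := by
    simp only [hT, map_add, map_sub, map_mul, map_one, add_mul, sub_mul, mul_add, mul_sub,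
      one_mul, mul_one, mul_assoc, hX, hZ]
    simp only [← mul_assoc, hX, hZ]
  rw [Matrix.rank, finrank_eq_one_iff'] at hrank
  obtain ⟨⟨v, u, rfl⟩, hv0, hv⟩ := hrank
  have hv0' : T *ᵥ u ≠ 0 := fun h => hv0 (Subtype.ext h)
  have hspan (w : ι → ℂ) : ∃ c : ℂ, c • T *ᵥ u = T *ᵥ w := by
    obtain ⟨c, hc⟩ := hv ⟨T *ᵥ w, w, rfl⟩
    exact ⟨c, congrArg Subtype.val hc⟩
  obtain ⟨c, hc⟩ := hspan (star (g *ᵥ u))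
  have hgv : g *ᵥ T *ᵥ u = star (c • T *ᵥ u) := by
    rw [Matrix.mulVec_mulVec, ← hTg, ← Matrix.mulVec_mulVec, hc, ← conj_mulVec, star_star]
  have hc0 : c ≠ 0 := by
    rintro rfl
    rw [zero_smul, star_zero] at hgv
    exact hv0' (Matrix.mulVec_injective_of_isUnit hg (hgv.trans (Matrix.mulVec_zero g).symm))
  have hggv : ((starRingEnd ℂ).mapMatrix g * g) *ᵥ T *ᵥ u = ((‖c‖ : ℂ) ^ 2) • T *ᵥ u := by
    rw [← Matrix.mulVec_mulVec, hgv, conj_mulVec, Matrix.mulVec_smul, hgv, star_smul, star_smul,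
      star_smul, star_star, star_star, smul_smul]
    congr 1
    exact Complex.conj_mul' c
  refine ⟨‖c‖, norm_ne_zero_iff.2 hc0, sub_eq_zero.1 ?_⟩
  have hscalar (Y : Matrix ι ι ℂ) : Commute (((‖c‖ : ℂ) ^ 2) • (1 : Matrix ι ι ℂ)) Y :=
    (Commute.one_left Y).smul_left _
  refine Matrix.eq_zero_of_commute_of_mul_commutator_add_one
    ((commute_map_conj_mul_self hX).sub_left (hscalar X))
    ((commute_map_conj_mul_self hZ).sub_left (hscalar Z)) ?_
  refine Matrix.ext_of_mulVec_single fun i => ?_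
  obtain ⟨d, hd⟩ := hspan (Pi.single i 1)
  rw [← Matrix.mulVec_mulVec, ← hT, ← hd, Matrix.mulVec_smul, Matrix.sub_mulVec, hggv,
    Matrix.smul_mulVec, Matrix.one_mulVec, sub_self, smul_zero, Matrix.zero_mulVec]

theorem im_conj_eq_zero_of_map_conj_mul_eq {ι : Type*} [Fintype ι] [DecidableEq ι]
    {Y g : Matrix ι ι ℂ} (h : (Matrix ι ι ℂ)ˣ) (hg : IsUnit g) {s : ℂ}
    (hh : (starRingEnd ℂ).mapMatrix (h : Matrix ι ι ℂ) * g = s • (h : Matrix ι ι ℂ))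
    (hY : (starRingEnd ℂ).mapMatrix Y * g = g * Y) (i j : ι) :
    (((h : Matrix ι ι ℂ) * Y * ((h⁻¹ : (Matrix ι ι ℂ)ˣ) : Matrix ι ι ℂ)) i j).im = 0 := by
  set W := (h : Matrix ι ι ℂ) * Y * ((h⁻¹ : (Matrix ι ι ℂ)ˣ) : Matrix ι ι ℂ) with hW
  have hWh : W * h = h * Y := by rw [hW, Units.inv_mul_cancel_right]
  have hreal : (starRingEnd ℂ).mapMatrix W = W := by
    refine ((h.isUnit.map (starRingEnd ℂ).mapMatrix).mul hg).mul_right_cancel ?_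
    rw [← mul_assoc, ← map_mul, hWh, map_mul, mul_assoc, hY, ← mul_assoc, hh, smul_mul_assoc,
      mul_smul_comm, hWh]
  exact Complex.conj_eq_iff_im.1 (congrFun (congrFun hreal i) j)


/-- Let `(X, Z)` be a Calogero–Moser pair with `X` having `n` distinct
eigenvalues. If `(conj X, conj Z) = (g X g⁻¹, g Z g⁻¹)` for some `g ∈ GL_n(ℂ)`, then `(X, Z)` can
be simultaneously conjugated to a pair of real matrices. -/
theorem calogero_moser_conjugate_real (n : ℕ) (hn : 1 ≤ n)
    (X Z : Matrix (Fin n) (Fin n) ℂ)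
    (hrank : (X * Z - Z * X + 1).rank = 1)
    (hdist : (Matrix.charpoly X).roots.toFinset.card = n)
    (g : (Matrix (Fin n) (Fin n) ℂ)ˣ)
    (hXc : X.map (starRingEnd ℂ) = (g : Matrix (Fin n) (Fin n) ℂ) * X *
      ((g⁻¹ : (Matrix (Fin n) (Fin n) ℂ)ˣ) : Matrix (Fin n) (Fin n) ℂ))
    (hZc : Z.map (starRingEnd ℂ) = (g : Matrix (Fin n) (Fin n) ℂ) * Z *
      ((g⁻¹ : (Matrix (Fin n) (Fin n) ℂ)ˣ) : Matrix (Fin n) (Fin n) ℂ)) :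
    ∃ h : (Matrix (Fin n) (Fin n) ℂ)ˣ,
      (∀ i j, (((h : Matrix (Fin n) (Fin n) ℂ) * X *
        ((h⁻¹ : (Matrix (Fin n) (Fin n) ℂ)ˣ) : Matrix (Fin n) (Fin n) ℂ)) i j).im = 0) ∧
      (∀ i j, (((h : Matrix (Fin n) (Fin n) ℂ) * Z *
        ((h⁻¹ : (Matrix (Fin n) (Fin n) ℂ)ˣ) : Matrix (Fin n) (Fin n) ℂ)) i j).im = 0) := by
  have intertwine {Y : Matrix (Fin n) (Fin n) ℂ}
      (hY : Y.map (starRingEnd ℂ) = (g : Matrix (Fin n) (Fin n) ℂ) * Y *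
        ((g⁻¹ : (Matrix (Fin n) (Fin n) ℂ)ˣ) : Matrix (Fin n) (Fin n) ℂ)) :
      (starRingEnd ℂ).mapMatrix Y * (g : Matrix (Fin n) (Fin n) ℂ) = g * Y := by
    rw [RingHom.mapMatrix_apply, hY, Units.inv_mul_cancel_right]
  obtain ⟨s, hs0, hs⟩ := exists_map_conj_mul_self_eq_smul_one g.isUnit hrank
    (intertwine hXc) (intertwine hZc)
  have hs0' : (s : ℂ) ≠ 0 := Complex.ofReal_ne_zero.2 hs0
  have hsg : (starRingEnd ℂ).mapMatrix ((s : ℂ)⁻¹ • (g : Matrix (Fin n) (Fin n) ℂ)) =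
      (s : ℂ)⁻¹ • (starRingEnd ℂ).mapMatrix (g : Matrix (Fin n) (Fin n) ℂ) := by
    ext i j
    simp
  obtain ⟨h, hh⟩ := exists_unit_map_conj_mul_eq
    ((s : ℂ)⁻¹ • (g : Matrix (Fin n) (Fin n) ℂ)) (by
      rw [hsg, smul_mul_smul_comm, hs, smul_smul]
      field_simp
      exact one_smul _ _)
  have hhg : (starRingEnd ℂ).mapMatrix (h : Matrix (Fin n) (Fin n) ℂ) * g =
      (s : ℂ) • (h : Matrix (Fin n) (Fin n) ℂ) := by
    rw [← smul_inv_smul₀ hs0' (_ * _), ← mul_smul_comm, hh]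
  exact ⟨h, im_conj_eq_zero_of_map_conj_mul_eq h g.isUnit hhg (intertwine hXc),
    im_conj_eq_zero_of_map_conj_mul_eq h g.isUnit hhg (intertwine hZc)⟩
end

section
/- Let μ₁,…,μ_k be distinct complex numbers, let V₁,…,V_k be nonzero finite-dimensional ℂ-subspaces of ℂ[x], set N = Σ_j dim V_j, and let q₁,…,q_N : ℝ → ℂ be any basis of the ℂ-vector space W of functions x ↦ Σ_{j=1}^k e^{μ_j x} p_j(x) with p_j ∈ V_j. Then there exists a polynomial P ∈ ℂ[x] such that Wr(q₁,…,q_N)(x) = e^{(Σ_j (dim V_j)·μ_j)·x} · P(x) for all x ∈ ℝ. -/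
open Polynomial in
/-- The operator `p ↦ p' + c p`, i.e. differentiation of `e^{c x} p(x)` conjugated to `ℂ[x]`. -/
noncomputable def Polynomial.twistedDerivative (c : ℂ) : Module.End ℂ ℂ[X] :=
  derivative + c • LinearMap.id

open Polynomial in
theorem Polynomial.hasDerivAt_exp_mul_eval (c : ℂ) (p : ℂ[X]) (x : ℝ) :
    HasDerivAt (fun x : ℝ => Complex.exp (c * (x : ℂ)) * p.eval (x : ℂ))
      (Complex.exp (c * (x : ℂ)) * (twistedDerivative c p).eval (x : ℂ)) x := by
  have h : HasDerivAt (fun z : ℂ => Complex.exp (c * z) * p.eval z)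
      (Complex.exp (c * (x : ℂ)) * (twistedDerivative c p).eval (x : ℂ)) (x : ℂ) := by
    refine (((hasDerivAt_id (x : ℂ)).const_mul c).cexp.fun_mul
      (p.hasDerivAt (x : ℂ))).congr_deriv ?_
    simp [twistedDerivative]
    ring
  exact h.comp_ofReal

open Polynomial in
/-- Iterated derivatives of a quasipolynomial. -/
theorem Polynomial.iteratedDeriv_sum_exp_mul_eval {ι : Type*} [Fintype ι] (μ : ι → ℂ)
    (p : ι → ℂ[X]) (n : ℕ) :
    iteratedDeriv n (fun x : ℝ => ∑ j, Complex.exp (μ j * (x : ℂ)) * (p j).eval (x : ℂ)) =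
      fun x : ℝ => ∑ j, Complex.exp (μ j * (x : ℂ)) *
        ((twistedDerivative (μ j) ^ n) (p j)).eval (x : ℂ) := by
  induction n with
  | zero => simp
  | succ n ih =>
    rw [iteratedDeriv_succ, ih]
    funext x
    simp only [pow_succ', Module.End.mul_apply]
    exact (HasDerivAt.fun_sum fun j _ => hasDerivAt_exp_mul_eval (μ j) _ x).deriv


/-- For distinct complex numbers `μ₁, …, μ_k`, nonzero finite-dimensional
subspaces `V₁, …, V_k ⊆ ℂ[x]`, `N = ∑ dim V_j`, and a basis `q₁, …, q_N` of the space of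
quasipolynomials `⊕_j e^{μ_j x} V_j` (as functions `ℝ → ℂ`), the Wronskian `Wr(q₁, …, q_N)`
equals `e^{(∑_j dim V_j · μ_j) x} · P(x)` for some polynomial `P ∈ ℂ[x]`. -/
theorem wronskian_of_quasipolynomials (k : ℕ) (μ : Fin k → ℂ) (hμ : Function.Injective μ)
    (V : Fin k → Submodule ℂ (Polynomial ℂ))
    (hVfin : ∀ j, FiniteDimensional ℂ (V j))
    (hVne : ∀ j, V j ≠ ⊥)
    (N : ℕ) (hN : N = ∑ j, Module.finrank ℂ (V j))
    (q : Fin N → (ℝ → ℂ))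
    (hqmem : ∀ i, ∃ p : (j : Fin k) → Polynomial ℂ, (∀ j, p j ∈ V j) ∧
      q i = fun x : ℝ => ∑ j, Complex.exp (μ j * (x : ℂ)) * (p j).eval (x : ℂ))
    (hqind : LinearIndependent ℂ q)
    (hqspan : ∀ p : (j : Fin k) → Polynomial ℂ, (∀ j, p j ∈ V j) →
      (fun x : ℝ => ∑ j, Complex.exp (μ j * (x : ℂ)) * (p j).eval (x : ℂ)) ∈
        Submodule.span ℂ (Set.range q)) :
    ∃ P : Polynomial ℂ, ∀ x : ℝ,
      (Matrix.of fun i j : Fin N => iteratedDeriv (i : ℕ) (q j) x).det =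
        Complex.exp ((∑ j, (Module.finrank ℂ (V j) : ℂ) * μ j) * (x : ℂ)) * P.eval (x : ℂ) := by
  choose p hpV hq using hqmem
  let b := fun j => Module.finBasis ℂ (V j)
  let I := Σ j, Fin (Module.finrank ℂ (V j))
  let e : Fin N ≃ I := Fintype.equivOfCardEq (by simp [I, hN])
  let B : Matrix I (Fin N) ℂ := Matrix.of fun s l => (b s.1).repr ⟨p l s.1, hpV l s.1⟩ s.2
  let D : Matrix (Fin N) I (Polynomial ℂ) := Matrix.of fun i s =>
    (Polynomial.twistedDerivative (μ s.1) ^ (i : ℕ)) (b s.1 s.2 : Polynomial ℂ)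
  have hp (l : Fin N) (j : Fin k) :
      p l j = ∑ a, B ⟨j, a⟩ l • (b j a : Polynomial ℂ) := by
    have h := congrArg (V j).subtype ((b j).sum_repr ⟨p l j, hpV l j⟩)
    rw [map_sum] at h
    exact h.symm
  refine ⟨(D.submatrix id e).det * Polynomial.C (B.submatrix e id).det, fun x => ?_⟩
  let A : Matrix (Fin N) I ℂ := Matrix.of fun i s =>
    Complex.exp (μ s.1 * (x : ℂ)) * (D i s).eval (x : ℂ)
  have hfac : (Matrix.of fun i j : Fin N => iteratedDeriv (i : ℕ) (q j) x) = A * B := by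
    ext i l
    rw [Matrix.of_apply, hq, Polynomial.iteratedDeriv_sum_exp_mul_eval, Matrix.mul_apply,
      Fintype.sum_sigma]
    refine Finset.sum_congr rfl fun j _ => ?_
    rw [hp, map_sum, Polynomial.eval_finsetSum, Finset.mul_sum]
    refine Finset.sum_congr rfl fun a _ => ?_
    simp only [map_smul, Polynomial.eval_smul, smul_eq_mul, A, D, Matrix.of_apply]
    ring
  have hA : (A.submatrix id e).det = (∏ l, Complex.exp (μ (e l).1 * (x : ℂ))) *
      (D.submatrix id e).det.eval (x : ℂ) := by
    rw [← Polynomial.coe_evalRingHom, RingHom.map_det, ← Matrix.det_mul_row]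
    rfl
  have hexp : ∏ l, Complex.exp (μ (e l).1 * (x : ℂ)) =
      Complex.exp ((∑ j, (Module.finrank ℂ (V j) : ℂ) * μ j) * (x : ℂ)) := by
    rw [e.prod_comp (fun s : I => Complex.exp (μ s.1 * (x : ℂ))), ← Complex.exp_sum,
      Fintype.sum_sigma, Finset.sum_mul]
    simp [mul_assoc]
  have hAB : A * B = A.submatrix id e * B.submatrix e id := by
    rw [Matrix.submatrix_mul_equiv, Matrix.submatrix_id_id]
  rw [hfac, hAB, Matrix.det_mul, hA, hexp, Polynomial.eval_mul, Polynomial.eval_C, mul_assoc]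
end
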